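/- For any p > 1 there exists η > 0 such that the following holds. Let (u,P) be a smooth solution of the incompressible Navier–Stokes equations on Q₁ = (−1,0) × B₁ satisfying sup_{−1<t<0} ∫_{B₁} |u(t,x)|² dx + ∫_{−1}^0 ∫_{B₁} |∇u(t,x)|² dx dt + ∫_{−1}^0 ( ∫_{B₁} |P(t,x)| dx )^p dt ≤ η. Then |u(t,x)| ≤ 1 for every (t,x) ∈ Q_{1/2} = (−1/4,0) × B_{1/2}. -/

import Mathlib

open MeasureTheory Set Metric
open scoped ENNReal NNReal

noncomputable section

/-- `ℝ³` with the Euclidean norm. -/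
abbrev E3 := EuclideanSpace ℝ (Fin 3)

/-- Spatial partial derivative `∂ⱼ f` of a scalar function. -/
def pd (f : E3 → ℝ) (j : Fin 3) (x : E3) : ℝ :=
  fderiv ℝ f x (EuclideanSpace.single j 1)

/-- `|∇f|² = Σ_{i,j} |∂ⱼ fᵢ|²`. -/
def gradSq (f : E3 → E3) (x : E3) : ℝ :=
  ∑ i, ∑ j, (pd (fun y => f y i) j x) ^ 2

/-- `(u,P)` is a smooth solution of the incompressible Navier–Stokes equations on the
open set `U ⊆ ℝ × ℝ³`: `u` and `P` are infinitely differentiable on `U`, and on `U` one has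
`∂ₜuᵢ + Σⱼ uⱼ ∂ⱼuᵢ + ∂ᵢP − Δuᵢ = 0` and `div u = 0`. -/
def IsNSSolution (u : ℝ → E3 → E3) (P : ℝ → E3 → ℝ) (U : Set (ℝ × E3)) : Prop :=
  ContDiffOn ℝ (⊤ : ℕ∞) (fun q : ℝ × E3 => u q.1 q.2) U ∧
  ContDiffOn ℝ (⊤ : ℕ∞) (fun q : ℝ × E3 => P q.1 q.2) U ∧
  (∀ q ∈ U, ∀ i : Fin 3,
    deriv (fun s => u s q.2 i) q.1
      + (∑ j, u q.1 q.2 j * pd (fun y => u q.1 y i) j q.2)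
      + pd (fun y => P q.1 y) i q.2
      - ∑ j, pd (pd (fun y => u q.1 y i) j) j q.2 = 0) ∧
  (∀ q ∈ U, ∑ i, pd (fun y => u q.1 y i) i q.2 = 0)

open scoped ContDiff Convolution

section PartialDerivatives

variable {f g : E3 → ℝ} {j : Fin 3} {x : E3}

lemma pd_add (hf : DifferentiableAt ℝ f x) (hg : DifferentiableAt ℝ g x) :
    pd (fun y => f y + g y) j x = pd f j x + pd g j x := by
  simp [pd, fderiv_fun_add hf hg]

lemma pd_sub (hf : DifferentiableAt ℝ f x) (hg : DifferentiableAt ℝ g x) :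
    pd (fun y => f y - g y) j x = pd f j x - pd g j x := by
  simp [pd, fderiv_fun_sub hf hg]

lemma pd_mul (hf : DifferentiableAt ℝ f x) (hg : DifferentiableAt ℝ g x) :
    pd (fun y => f y * g y) j x = pd f j x * g x + f x * pd g j x := by
  simp [pd, fderiv_fun_mul hf hg]; ring

lemma pd_const_mul (c : ℝ) (hf : DifferentiableAt ℝ f x) :
    pd (fun y => c * f y) j x = c * pd f j x := by
  simp [pd, fderiv_const_mul hf]

lemma pd_const (c : ℝ) : pd (fun _ => c) j x = 0 := by
  simp [pd]

lemma pd_sum {ι : Type*} (s : Finset ι) {F : ι → E3 → ℝ}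
    (hF : ∀ i ∈ s, DifferentiableAt ℝ (F i) x) :
    pd (fun y => ∑ i ∈ s, F i y) j x = ∑ i ∈ s, pd (F i) j x := by
  simp [pd, fderiv_fun_sum hF]

lemma pd_congr (h : f =ᶠ[nhds x] g) : pd f j x = pd g j x := by
  simp [pd, h.fderiv_eq]

lemma pd_eventuallyEq (h : f =ᶠ[nhds x] g) : pd f j =ᶠ[nhds x] pd g j := by
  filter_upwards [h.eventuallyEq_nhds] with y hy using pd_congr hy

lemma contDiff_pd (hf : ContDiff ℝ ∞ f) (j : Fin 3) : ContDiff ℝ ∞ (pd f j) := by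
  have h : ContDiff ℝ ∞ (fderiv ℝ f) := hf.fderiv_right (by simp)
  exact h.clm_apply contDiff_const

lemma continuous_pd (hf : ContDiff ℝ ∞ f) (j : Fin 3) : Continuous (pd f j) :=
  (contDiff_pd hf j).continuous

lemma ContDiff.diffAt (hf : ContDiff ℝ ∞ f) : DifferentiableAt ℝ f x :=
  (hf.differentiable (by simp)).differentiableAt

lemma pd_comm (hf : ContDiff ℝ ∞ f) (i j : Fin 3) (x : E3) :
    pd (pd f i) j x = pd (pd f j) i x := by
  have h : ContDiff ℝ ∞ (fderiv ℝ f) := hf.fderiv_right (by simp)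
  have hd : DifferentiableAt ℝ (fderiv ℝ f) x := (h.differentiable (by simp)).differentiableAt
  have key : ∀ a b : Fin 3, pd (pd f a) b x
      = fderiv ℝ (fderiv ℝ f) x (EuclideanSpace.single b 1) (EuclideanSpace.single a 1) := by
    intro a b
    have : pd f a = fun y => fderiv ℝ f y (EuclideanSpace.single a 1) := rfl
    rw [pd, this, fderiv_clm_apply hd (differentiableAt_const _)]
    simp
  rw [key, key]
  have hs : IsSymmSndFDerivAt ℝ f x :=
    hf.contDiffAt.isSymmSndFDerivAt (by simpa using WithTop.coe_le_coe.2 (le_top (a := (2 : ℕ∞))))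
  exact hs _ _

lemma hasCompactSupport_pd (hf : HasCompactSupport f) (j : Fin 3) : HasCompactSupport (pd f j) :=
  hf.fderiv_apply ℝ _

lemma pd_eq_zero_of_notMem (h : x ∉ tsupport f) : pd f j x = 0 := by
  have : f =ᶠ[nhds x] fun _ => 0 := notMem_tsupport_iff_eventuallyEq.mp h
  rw [pd_congr this, pd_const]

lemma tsupport_pd_subset : tsupport (pd f j) ⊆ tsupport f := by
  refine closure_minimal (fun y hy => ?_) (isClosed_tsupport f)
  by_contra h
  exact hy (pd_eq_zero_of_notMem h)

lemma integral_pd_mul (hf : ContDiff ℝ ∞ f) (hg : ContDiff ℝ ∞ g) (hc : HasCompactSupport g)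
    (j : Fin 3) : ∫ x, f x * pd g j x = - ∫ x, pd f j x * g x := by
  refine integral_mul_fderiv_eq_neg_fderiv_mul_of_integrable ?_ ?_ ?_
    (fun _ _ => hf.diffAt) (fun _ _ => hg.diffAt)
  · exact ((continuous_pd hf j).mul hg.continuous).integrable_of_hasCompactSupport hc.mul_left
  · exact (hf.continuous.mul (continuous_pd hg j)).integrable_of_hasCompactSupport
      (hasCompactSupport_pd hc j).mul_left
  · exact (hf.continuous.mul hg.continuous).integrable_of_hasCompactSupport hc.mul_left

lemma integral_pd (hg : ContDiff ℝ ∞ g) (hc : HasCompactSupport g) (j : Fin 3) :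
    ∫ x, pd g j x = 0 := by
  have := integral_pd_mul (f := fun _ => 1) contDiff_const hg hc j
  simpa [pd_const] using this

lemma pd_comp_sub_left (hf : ContDiff ℝ ∞ f) (a : E3) (j : Fin 3) (x : E3) :
    pd (fun y => f (a - y)) j x = - pd f j (a - x) := by
  have h : HasFDerivAt (fun y : E3 => a - y) (-ContinuousLinearMap.id ℝ E3) x :=
    (hasFDerivAt_id x).const_sub a
  have h3 : fderiv ℝ (fun y => f (a - y)) x = _ :=
    ((hf.diffAt (x := a - x)).hasFDerivAt.comp x h).fderiv
  simp [pd, h3]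

lemma pd_comp_smul (f : E3 → ℝ) (hf : ContDiff ℝ ∞ f) (c : ℝ) (j : Fin 3) (x : E3) :
    pd (fun y => f (c • y)) j x = c * pd f j (c • x) := by
  have h : HasFDerivAt (fun y : E3 => c • y) (c • ContinuousLinearMap.id ℝ E3) x :=
    (hasFDerivAt_id x).const_smul c
  have h2 := (hf.diffAt (x := c • x)).hasFDerivAt.comp x h
  have h3 : fderiv ℝ (fun y => f (c • y)) x = _ := h2.fderiv
  simp [pd, h3]

end PartialDerivatives

section RadialFunctions

lemma pd_comp_norm_sq {G : ℝ → ℝ} {G' : ℝ} {x : E3} (hG : HasDerivAt G G' (‖x‖ ^ 2)) (j : Fin 3) :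
    pd (fun y => G (‖y‖ ^ 2)) j x = 2 * x j * G' := by
  have h := hG.comp_hasFDerivAt x (hasStrictFDerivAt_norm_sq x).hasFDerivAt
  have h3 : fderiv ℝ (fun y : E3 => G (‖y‖ ^ 2)) x = _ := h.fderiv
  simp [pd, h3, EuclideanSpace.inner_single_right]
  ring

lemma pd_coord (j : Fin 3) (x : E3) : pd (fun y => y j) j x = 1 := by
  have h : HasFDerivAt (fun y : E3 => y j) (EuclideanSpace.proj (𝕜 := ℝ) j : E3 →L[ℝ] ℝ) x :=
    (EuclideanSpace.proj (𝕜 := ℝ) j : E3 →L[ℝ] ℝ).hasFDerivAt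
  simp [pd, h.fderiv]

lemma contDiff_coord (j : Fin 3) : ContDiff ℝ ∞ (fun y : E3 => y j) :=
  (EuclideanSpace.proj (𝕜 := ℝ) j : E3 →L[ℝ] ℝ).contDiff

lemma laplacian_comp_norm_sq {G G' : ℝ → ℝ} (hG : ∀ s, HasDerivAt G (G' s) s) {x : E3} {G'' : ℝ}
    (hG' : HasDerivAt G' G'' (‖x‖ ^ 2)) :
    ∑ j, pd (pd (fun y => G (‖y‖ ^ 2)) j) j x = 6 * G' (‖x‖ ^ 2) + 4 * ‖x‖ ^ 2 * G'' := by
  have h1 : ∀ j, pd (pd (fun y => G (‖y‖ ^ 2)) j) j x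
      = 2 * G' (‖x‖ ^ 2) + 4 * (x j) ^ 2 * G'' := by
    intro j
    have e : pd (fun y => G (‖y‖ ^ 2)) j = fun y => 2 * (y j * G' (‖y‖ ^ 2)) := by
      funext y; rw [pd_comp_norm_sq (hG _)]; ring
    have hd : DifferentiableAt ℝ (fun y : E3 => G' (‖y‖ ^ 2)) x :=
      (hG'.comp_hasFDerivAt x (hasStrictFDerivAt_norm_sq x).hasFDerivAt).differentiableAt
    rw [e, pd_const_mul, pd_mul, pd_coord, pd_comp_norm_sq hG']
    · ring
    · exact (contDiff_coord j).diffAt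
    · exact hd
    · exact (contDiff_coord j).diffAt.mul hd
  simp_rw [h1, Finset.sum_add_distrib]
  rw [EuclideanSpace.real_norm_sq_eq]
  simp [Fin.sum_univ_three]; ring

/-- A smooth function on the line which equals `s ^ (-3/2) / 2` for `s ≥ 1` and vanishes near
`s ≤ 0`. -/
def kerSlope (s : ℝ) : ℝ := (2 * (s * √s))⁻¹ * Real.smoothTransition (2 * s - 1 / 2)

lemma contDiff_kerSlope : ContDiff ℝ ∞ kerSlope := by
  rw [contDiff_iff_contDiffAt]
  intro s
  rcases lt_or_ge s (1 / 4) with h | h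
  · have : kerSlope =ᶠ[nhds s] fun _ => 0 := by
      filter_upwards [Iio_mem_nhds h] with y hy
      rw [kerSlope, Real.smoothTransition.zero_of_nonpos, mul_zero]
      have : y < 1 / 4 := hy
      linarith
    exact contDiffAt_const.congr_of_eventuallyEq this
  · have hs : 0 < s := by linarith
    have h1 : ContDiffAt ℝ ∞ (fun s : ℝ => (2 * (s * √s))⁻¹) s :=
      (contDiffAt_const.mul (contDiffAt_id.mul (contDiffAt_id.sqrt hs.ne'))).inv (by positivity)
    exact h1.mul (Real.smoothTransition.contDiff.contDiffAt.comp s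
      ((contDiffAt_const.mul contDiffAt_id).sub contDiffAt_const))

lemma kerSlope_laplacian {s : ℝ} (hs : 0 < s) :
    6 * kerSlope s + 4 * s * deriv kerSlope s
      = 2 / √s * deriv (fun s => Real.smoothTransition (2 * s - 1 / 2)) s := by
  have hq : 0 < √s := Real.sqrt_pos.2 hs
  have e : (fun s => Real.smoothTransition (2 * s - 1 / 2))
      =ᶠ[nhds s] fun s => 2 * (s * √s) * kerSlope s := by
    filter_upwards [Ioi_mem_nhds hs] with y hy
    have hy0 : 0 < y := hy
    have : 0 < √y := Real.sqrt_pos.2 hy0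
    rw [kerSlope]; field_simp
  have hk : HasDerivAt kerSlope (deriv kerSlope s) s :=
    ((contDiff_kerSlope.differentiable (by simp)) s).hasDerivAt
  have h1 : HasDerivAt (fun s : ℝ => 2 * (s * √s)) (2 * (1 * √s + s * (1 / (2 * √s)))) s :=
    ((hasDerivAt_id s).mul (Real.hasDerivAt_sqrt hs.ne')).const_mul 2
  have h4 : deriv (fun s => 2 * (s * √s) * kerSlope s) s = _ := (h1.mul hk).deriv
  rw [e.deriv_eq, h4]
  have h2 : √s ^ 2 = s := Real.sq_sqrt hs.le
  field_simp
  rw [h2]; ring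

/-- A smooth function on the line whose derivative is `kerSlope`. -/
def kerProfile (s : ℝ) : ℝ := -1 + ∫ y in (1 : ℝ)..s, kerSlope y

lemma hasDerivAt_kerProfile (s : ℝ) : HasDerivAt kerProfile (kerSlope s) s := by
  have h := intervalIntegral.integral_hasDerivAt_right
    (contDiff_kerSlope.continuous.intervalIntegrable 1 s)
    (contDiff_kerSlope.continuous.stronglyMeasurableAtFilter _ _)
    contDiff_kerSlope.continuous.continuousAt
  exact h.const_add (-1)

lemma contDiff_kerProfile : ContDiff ℝ ∞ kerProfile := by
  rw [contDiff_infty_iff_deriv]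
  refine ⟨fun s => (hasDerivAt_kerProfile s).differentiableAt, ?_⟩
  rw [show deriv kerProfile = kerSlope from funext fun s => (hasDerivAt_kerProfile s).deriv]
  exact contDiff_kerSlope

lemma kerProfile_of_one_le {s : ℝ} (hs : 1 ≤ s) : kerProfile s = - (√s)⁻¹ := by
  have hd : ∀ y ∈ uIcc 1 s, HasDerivAt (fun y => - (√y)⁻¹) (kerSlope y) y := by
    intro y hy
    rw [uIcc_of_le hs] at hy
    have hy0 : 0 < y := by linarith [hy.1]
    have hq : 0 < √y := Real.sqrt_pos.2 hy0
    refine HasDerivAt.congr_deriv ((Real.hasDerivAt_sqrt hy0.ne').inv hq.ne').neg ?_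
    have h1 : kerSlope y = (2 * (y * √y))⁻¹ * Real.smoothTransition (2 * y - 1 / 2) := rfl
    rw [h1, Real.smoothTransition.one_of_one_le (by linarith [hy.1]), Real.sq_sqrt hy0.le]
    field_simp
  have := intervalIntegral.integral_eq_sub_of_hasDerivAt hd
    (contDiff_kerSlope.continuous.intervalIntegrable 1 s)
  rw [kerProfile, this]; simp

/-- Existence of a smooth even regularisation `Φ` of the Newtonian kernel whose Laplacian is a
nonnegative mollifier supported in the unit ball. -/
lemma exists_newtonian_regularisation : ∃ (Φ ψ : E3 → ℝ) (c : ℝ), ContDiff ℝ ∞ Φ ∧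
    (∀ x, ∑ j, pd (pd Φ j) j x = ψ x) ∧ (∀ x, 0 ≤ ψ x) ∧ ∫ x, ψ x = 1 ∧
    (∀ x, 1 ≤ ‖x‖ → ψ x = 0) ∧ (∀ x, 1 ≤ ‖x‖ → Φ x = c / ‖x‖) ∧ ∀ x, Φ (-x) = Φ x := by
  set Φ₀ : E3 → ℝ := fun x => kerProfile (‖x‖ ^ 2) with hΦ₀
  have hΦ₀s : ContDiff ℝ ∞ Φ₀ := contDiff_kerProfile.comp (contDiff_norm_sq ℝ)
  set ψ₀ : E3 → ℝ := fun x => ∑ j, pd (pd Φ₀ j) j x with hψ₀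
  have hψc : Continuous ψ₀ :=
    continuous_finsetSum _ fun j _ => continuous_pd (contDiff_pd hΦ₀s j) j
  set m : ℝ → ℝ := fun s => Real.smoothTransition (2 * s - 1 / 2) with hm
  have hmm : Monotone m := fun a b h => Real.smoothTransition.monotone (by linarith)
  have hmd : Differentiable ℝ m := by
    have : ContDiff ℝ ∞ m := Real.smoothTransition.contDiff.comp
      ((contDiff_const.mul contDiff_id).sub contDiff_const)
    exact this.differentiable (by simp)
  have hform : ∀ x, ψ₀ x = 6 * kerSlope (‖x‖ ^ 2) + 4 * ‖x‖ ^ 2 * deriv kerSlope (‖x‖ ^ 2) :=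
    fun x => laplacian_comp_norm_sq hasDerivAt_kerProfile
      ((contDiff_kerSlope.differentiable (by simp)) _).hasDerivAt
  have hform' : ∀ x, x ≠ 0 → ψ₀ x = 2 / ‖x‖ * deriv m (‖x‖ ^ 2) := by
    intro x hx
    have h0 : 0 < ‖x‖ := norm_pos_iff.2 hx
    rw [hform, kerSlope_laplacian (by positivity), Real.sqrt_sq h0.le]
  have hψ0 : ∀ x, 0 ≤ ψ₀ x := by
    intro x
    by_cases hx : x = 0
    · rw [hform, hx]
      simp [kerSlope]
    · rw [hform' x hx]
      exact mul_nonneg (by positivity) hmm.deriv_nonneg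
  have hψsupp : ∀ x, 1 ≤ ‖x‖ → ψ₀ x = 0 := by
    intro x hx
    rw [hform' x (norm_pos_iff.1 (by linarith))]
    have : m =ᶠ[nhds (‖x‖ ^ 2)] fun _ => 1 := by
      filter_upwards [Ioi_mem_nhds (show (3 / 4 : ℝ) < ‖x‖ ^ 2 by nlinarith)] with y hy
      have : (3 / 4 : ℝ) < y := hy
      exact Real.smoothTransition.one_of_one_le (by linarith)
    rw [this.deriv_eq]; simp
  have hcs : HasCompactSupport ψ₀ :=
    HasCompactSupport.intro (isCompact_closedBall (0 : E3) 1) fun x hx => hψsupp x (by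
      simp at hx; exact hx.le)
  have hpos : 0 < ∫ x, ψ₀ x := by
    refine lt_of_le_of_ne (integral_nonneg hψ0) fun h => ?_
    have hz : ψ₀ =ᵐ[volume] 0 :=
      (integral_eq_zero_iff_of_nonneg hψ0 (hψc.integrable_of_hasCompactSupport hcs)).1 h.symm
    have hz' : ψ₀ = 0 := (Continuous.ae_eq_iff_eq volume hψc continuous_const).1 hz
    have hder : ∀ s ∈ Ioi (0 : ℝ), deriv m s = 0 := by
      intro s hs
      have hs0 : 0 < s := hs
      have hq : 0 < √s := Real.sqrt_pos.2 hs0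
      have hn : ‖(EuclideanSpace.single 0 (√s) : E3)‖ = √s := by
        simp [abs_of_pos hq]
      have h1 := hform' (EuclideanSpace.single 0 (√s)) (norm_pos_iff.1 (by rw [hn]; exact hq))
      rw [hz', hn, Real.sq_sqrt hs0.le] at h1
      have h2 : 2 / √s ≠ 0 := by positivity
      simpa [h2, hq.ne'] using h1.symm
    have hconst := (convex_Ioi (0 : ℝ)).is_const_of_fderivWithin_eq_zero (𝕜 := ℝ) (f := m)
      hmd.differentiableOn (fun s hs => by
        rw [fderivWithin_of_isOpen isOpen_Ioi hs]
        ext; simpa using hder s hs) (show (1 / 4 : ℝ) ∈ Ioi (0 : ℝ) by simp)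
      (show (1 : ℝ) ∈ Ioi (0 : ℝ) by simp)
    simp only [hm] at hconst
    rw [Real.smoothTransition.zero_of_nonpos (by norm_num),
      Real.smoothTransition.one_of_one_le (by norm_num)] at hconst
    exact zero_ne_one hconst
  set I := ∫ x, ψ₀ x
  refine ⟨fun x => I⁻¹ * Φ₀ x, fun x => I⁻¹ * ψ₀ x, -I⁻¹, contDiff_const.mul hΦ₀s, ?_, ?_, ?_, ?_,
    ?_, ?_⟩
  · intro x
    simp only [hψ₀, Finset.mul_sum]
    refine Finset.sum_congr rfl fun j _ => ?_
    have : pd (fun x => I⁻¹ * Φ₀ x) j = fun x => I⁻¹ * pd Φ₀ j x :=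
      funext fun y => pd_const_mul _ hΦ₀s.diffAt
    rw [this, pd_const_mul _ (contDiff_pd hΦ₀s j).diffAt]
  · exact fun x => mul_nonneg (inv_nonneg.2 hpos.le) (hψ0 x)
  · rw [integral_const_mul]; exact inv_mul_cancel₀ hpos.ne'
  · intro x hx; simp [hψsupp x hx]
  · intro x hx
    simp only [hΦ₀]
    rw [kerProfile_of_one_le (by nlinarith), Real.sqrt_sq (by linarith)]
    ring
  · intro x; simp [hΦ₀]

end RadialFunctions

section ConvolutionEstimates

/-- The Cauchy–Schwarz inequality for real integrals. -/
lemma sq_integral_mul_le {α : Type*} [MeasurableSpace α] {μ : Measure α} {f g : α → ℝ}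
    (hf : Integrable (fun x => f x ^ 2) μ) (hg : Integrable (fun x => g x ^ 2) μ)
    (hfg : Integrable (fun x => f x * g x) μ) :
    (∫ x, f x * g x ∂μ) ^ 2 ≤ (∫ x, f x ^ 2 ∂μ) * ∫ x, g x ^ 2 ∂μ := by
  have key : ∀ t : ℝ, 0 ≤ (∫ x, g x ^ 2 ∂μ) * (t * t) + (2 * ∫ x, f x * g x ∂μ) * t
      + ∫ x, f x ^ 2 ∂μ := by
    intro t
    have h1 : 0 ≤ ∫ x, (f x + t * g x) ^ 2 ∂μ := integral_nonneg fun x => sq_nonneg _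
    have h2 : ∫ x, (f x + t * g x) ^ 2 ∂μ
        = ∫ x, (f x ^ 2 + (2 * t) * (f x * g x)) + t ^ 2 * g x ^ 2 ∂μ := by
      congr 1; funext x; ring
    have i1 : Integrable (fun x => f x ^ 2 + (2 * t) * (f x * g x)) μ := hf.add (hfg.const_mul _)
    rw [h2, integral_add i1 (hg.const_mul _), integral_add hf (hfg.const_mul _),
      integral_const_mul, integral_const_mul] at h1
    linarith
  have := discrim_le_zero key
  rw [discrim] at this
  linarith

/-- The convolution of two real functions on `ℝ³`. -/
def conv (K f : E3 → ℝ) (x : E3) : ℝ := ∫ y, K (x - y) * f y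

lemma conv_eq (K f : E3 → ℝ) : conv K f = K ⋆[ContinuousLinearMap.mul ℝ ℝ, volume] f := by
  funext x
  rw [convolution_eq_swap]
  rfl

variable {K f : E3 → ℝ}

lemma contDiff_conv (hK : ContDiff ℝ ∞ K) (hc : HasCompactSupport K)
    (hf : LocallyIntegrable f) : ContDiff ℝ ∞ (conv K f) := by
  rw [conv_eq]
  exact hc.contDiff_convolution_left _ hK hf

lemma pd_conv (hK : ContDiff ℝ ∞ K) (hc : HasCompactSupport K)
    (hf : LocallyIntegrable f) (j : Fin 3) : pd (conv K f) j = conv (pd K j) f := by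
  funext x
  have h := hc.hasFDerivAt_convolution_left (ContinuousLinearMap.mul ℝ ℝ)
    (hK.of_le (by exact_mod_cast le_top)) hf x
  rw [pd, conv_eq, h.fderiv, conv_eq]
  have h_intg : ConvolutionExistsAt (fderiv ℝ K) f x
      ((ContinuousLinearMap.mul ℝ ℝ).precompL E3) volume :=
    (hc.fderiv ℝ).convolutionExists_left _ (hK.continuous_fderiv (by simp)) hf x
  rw [convolution, convolution, ContinuousLinearMap.integral_apply h_intg]
  rfl

lemma hasCompactSupport_conv (hc : HasCompactSupport K) (hf : HasCompactSupport f) :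
    HasCompactSupport (conv K f) := by
  rw [conv_eq]; exact HasCompactSupport.convolution _ hc hf

lemma integrable_conv_integrand (hK : Continuous K) (hc : HasCompactSupport K)
    (hf : LocallyIntegrable f) (x : E3) : Integrable (fun y => K (x - y) * f y) := by
  have h : ConvolutionExistsAt K f x (ContinuousLinearMap.mul ℝ ℝ) volume :=
    hc.convolutionExists_left _ hK hf x
  exact (convolutionExistsAt_iff_integrable_swap).1 h

lemma integral_comp_sub_left (K : E3 → ℝ) (x : E3) : ∫ y, K (x - y) = ∫ y, K y :=
  integral_sub_left_eq_self K volume x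

/-- Convolution with a probability density is a contraction in `L²`. -/
lemma integral_conv_sq_le (hK : Continuous K) (hc : HasCompactSupport K) (h0 : ∀ x, 0 ≤ K x)
    (h1 : ∫ x, K x = 1) (hf : Continuous f) (hfc : HasCompactSupport f) :
    ∫ x, conv K f x ^ 2 ≤ ∫ x, f x ^ 2 := by
  have hf2 : Continuous fun x => f x ^ 2 := hf.pow 2
  have hf2c : HasCompactSupport fun x => f x ^ 2 :=
    hfc.comp_left (g := fun y : ℝ => y ^ 2) (by simp)
  have hcv : ∀ {g : E3 → ℝ}, Continuous g → HasCompactSupport g → Integrable (conv K g) := by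
    intro g hg hgc
    refine Continuous.integrable_of_hasCompactSupport ?_ (hasCompactSupport_conv hc hgc)
    rw [conv_eq]
    exact hc.continuous_convolution_left _ hK hg.locallyIntegrable
  have hpt : ∀ x, conv K f x ^ 2 ≤ conv K (fun y => f y ^ 2) x := by
    intro x
    set m := conv K f x with hm
    have i1 := integrable_conv_integrand hK hc hf.locallyIntegrable x
    have i2 := integrable_conv_integrand hK hc hf2.locallyIntegrable x
    have i3 : Integrable (fun y => K (x - y)) := by
      simpa using integrable_conv_integrand hK hc (f := fun _ => 1)
        continuous_const.locallyIntegrable x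
    have h : 0 ≤ ∫ y, K (x - y) * (f y - m) ^ 2 :=
      integral_nonneg fun y => mul_nonneg (h0 _) (sq_nonneg _)
    have e : ∫ y, K (x - y) * (f y - m) ^ 2
        = ∫ y, (K (x - y) * f y ^ 2 - (2 * m) * (K (x - y) * f y)) + m ^ 2 * K (x - y) := by
      congr 1; funext y; ring
    have i4 : Integrable (fun y => K (x - y) * f y ^ 2 - (2 * m) * (K (x - y) * f y)) :=
      i2.sub (i1.const_mul _)
    rw [e, integral_add i4 (i3.const_mul _),
      integral_sub i2 (i1.const_mul _), integral_const_mul, integral_const_mul,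
      integral_comp_sub_left, h1] at h
    have e1 : ∫ y, K (x - y) * f y = m := rfl
    have e2 : ∫ y, K (x - y) * f y ^ 2 = conv K (fun y => f y ^ 2) x := rfl
    rw [e1, e2] at h
    nlinarith
  have hsq : Integrable fun x => conv K f x ^ 2 := by
    refine Continuous.integrable_of_hasCompactSupport ?_ ?_
    · rw [conv_eq]
      exact (hc.continuous_convolution_left _ hK hf.locallyIntegrable).pow 2
    · exact (hasCompactSupport_conv hc hfc).comp_left (g := fun y : ℝ => y ^ 2) (by simp)
  calc ∫ x, conv K f x ^ 2 ≤ ∫ x, conv K (fun y => f y ^ 2) x :=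
        integral_mono hsq (hcv hf2 hf2c) hpt
    _ = ∫ x, f x ^ 2 := by
        have := integral_convolution (μ := (volume : Measure E3)) (ν := (volume : Measure E3))
          (ContinuousLinearMap.mul ℝ ℝ) (hK.integrable_of_hasCompactSupport hc)
          (hf2.integrable_of_hasCompactSupport hf2c)
        rw [conv_eq, this, h1]; simp

/-- Second derivatives are controlled in `L²` by the Laplacian. -/
lemma integral_pd_pd_sq_le {W : E3 → ℝ} (hW : ContDiff ℝ ∞ W) (hc : HasCompactSupport W)
    (i j : Fin 3) : ∫ x, pd (pd W i) j x ^ 2 ≤ ∫ x, (∑ k, pd (pd W k) k x) ^ 2 := by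
  have hs : ∀ a b, ContDiff ℝ ∞ (pd (pd W a) b) := fun a b => contDiff_pd (contDiff_pd hW a) b
  have hcs : ∀ a b, HasCompactSupport (pd (pd W a) b) :=
    fun a b => hasCompactSupport_pd (hasCompactSupport_pd hc a) b
  have h_intg : ∀ a b a' b', Integrable fun x => pd (pd W a) b x * pd (pd W a') b' x :=
    fun a b a' b' => ((hs a b).continuous.mul (hs a' b').continuous).integrable_of_hasCompactSupport
      (hcs a' b').mul_left
  have e : ∀ a b, ∫ x, pd (pd W a) a x * pd (pd W b) b x = ∫ x, pd (pd W a) b x ^ 2 := by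
    intro a b
    have s1 := integral_pd_mul (hs a a) (contDiff_pd hW b) (hasCompactSupport_pd hc b) b
    have s2 := integral_pd_mul (hs a b) (contDiff_pd hW b) (hasCompactSupport_pd hc b) a
    have c1 : pd (pd (pd W a) a) b = pd (pd (pd W a) b) a :=
      funext fun x => pd_comm (contDiff_pd hW a) a b x
    rw [s1, c1, ← s2]
    congr 1; funext x
    rw [pd_comm hW b a x]; ring
  have tot : ∫ x, (∑ k, pd (pd W k) k x) ^ 2 = ∑ a, ∑ b, ∫ x, pd (pd W a) b x ^ 2 := by
    simp_rw [pow_two (∑ k, pd (pd W k) k _), Finset.sum_mul_sum]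
    rw [integral_finsetSum _ fun a _ => integrable_finsetSum _ fun b _ => h_intg a a b b]
    refine Finset.sum_congr rfl fun a _ => ?_
    rw [integral_finsetSum _ fun b _ => h_intg a a b b]
    exact Finset.sum_congr rfl fun b _ => e a b
  rw [tot]
  have nn : ∀ a b, 0 ≤ ∫ x, pd (pd W a) b x ^ 2 := fun a b => integral_nonneg fun x => sq_nonneg _
  calc ∫ x, pd (pd W i) j x ^ 2 ≤ ∑ b, ∫ x, pd (pd W i) b x ^ 2 :=
        Finset.single_le_sum (f := fun b => ∫ x, pd (pd W i) b x ^ 2) (fun b _ => nn i b)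
          (Finset.mem_univ j)
    _ ≤ _ := Finset.single_le_sum (f := fun a => ∑ b, ∫ x, pd (pd W a) b x ^ 2)
        (fun a _ => Finset.sum_nonneg fun b _ => nn a b) (Finset.mem_univ i)

lemma integral_mul_conv_comm {k w : E3 → ℝ} (hk : Continuous k) (hkc : HasCompactSupport k)
    (hke : ∀ x, k (-x) = k x) (hw : Integrable w) (hf : Integrable f) :
    ∫ x, w x * conv k f x = ∫ y, f y * conv k w y := by
  obtain ⟨C, hC⟩ := hk.bounded_above_of_compact_support hkc
  have hi : Integrable (fun z : E3 × E3 => w z.1 * (k (z.1 - z.2) * f z.2))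
      ((volume : Measure E3).prod volume) := by
    have h1 := (hw.mul_prod hf).bdd_mul (c := C) (f := fun z : E3 × E3 => k (z.1 - z.2))
      (by exact (hk.comp (continuous_fst.sub continuous_snd)).aestronglyMeasurable)
      (Filter.Eventually.of_forall fun z => hC _)
    refine h1.congr (Filter.Eventually.of_forall fun z => ?_)
    simp only; ring
  calc ∫ x, w x * conv k f x = ∫ x, ∫ y, w x * (k (x - y) * f y) := by
        congr 1; funext x; rw [conv, ← integral_const_mul]
    _ = ∫ y, ∫ x, w x * (k (x - y) * f y) := integral_integral_swap hi
    _ = ∫ y, f y * conv k w y := by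
        congr 1; funext y; rw [conv, ← integral_const_mul]
        congr 1; funext x; rw [← hke (x - y), neg_sub]; ring

end ConvolutionEstimates

section NewtonianKernel

/-- A smooth function on `ℝ³` equal to a multiple of `1 / ‖x‖` outside the unit ball, whose
Laplacian is a probability density supported in the unit ball. -/
def newtonProfile : E3 → ℝ := exists_newtonian_regularisation.choose

/-- The Laplacian of `newtonProfile`. -/
def bumpProfile : E3 → ℝ := exists_newtonian_regularisation.choose_spec.choose

lemma newtonProfile_spec : ∃ c : ℝ, ContDiff ℝ ∞ newtonProfile ∧
    (∀ x, ∑ j, pd (pd newtonProfile j) j x = bumpProfile x) ∧ (∀ x, 0 ≤ bumpProfile x) ∧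
    ∫ x, bumpProfile x = 1 ∧ (∀ x, 1 ≤ ‖x‖ → bumpProfile x = 0) ∧
    (∀ x, 1 ≤ ‖x‖ → newtonProfile x = c / ‖x‖) ∧
    ∀ x, newtonProfile (-x) = newtonProfile x :=
  exists_newtonian_regularisation.choose_spec.choose_spec

/-- The regularised Newtonian kernel at scale `ρ`. -/
def newton (ρ : ℝ) (x : E3) : ℝ := ρ⁻¹ * newtonProfile (ρ⁻¹ • x)

/-- The mollifier at scale `ρ`. -/
def bump (ρ : ℝ) (x : E3) : ℝ := ρ⁻¹ ^ 3 * bumpProfile (ρ⁻¹ • x)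

lemma contDiff_newton (ρ : ℝ) : ContDiff ℝ ∞ (newton ρ) := by
  obtain ⟨c, h, -⟩ := newtonProfile_spec
  exact contDiff_const.mul (h.comp (contDiff_const_smul _))

lemma pd_newton (ρ : ℝ) (j : Fin 3) :
    pd (newton ρ) j = fun x => ρ⁻¹ ^ 2 * pd newtonProfile j (ρ⁻¹ • x) := by
  obtain ⟨c, h, -⟩ := newtonProfile_spec
  funext x
  have h1 : DifferentiableAt ℝ (fun y => newtonProfile (ρ⁻¹ • y)) x :=
    (h.comp (contDiff_const_smul _)).diffAt
  have e : newton ρ = fun x => ρ⁻¹ * newtonProfile (ρ⁻¹ • x) := rfl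
  rw [e, pd_const_mul _ h1, pd_comp_smul _ h]
  ring

lemma pd_pd_newton (ρ : ℝ) (i j : Fin 3) :
    pd (pd (newton ρ) i) j = fun x => ρ⁻¹ ^ 3 * pd (pd newtonProfile i) j (ρ⁻¹ • x) := by
  obtain ⟨c, h, -⟩ := newtonProfile_spec
  funext x
  have h' := contDiff_pd h i
  have h1 : DifferentiableAt ℝ (fun y => pd newtonProfile i (ρ⁻¹ • y)) x :=
    (h'.comp (contDiff_const_smul _)).diffAt
  rw [pd_newton, pd_const_mul _ h1, pd_comp_smul _ h']
  ring

lemma laplacian_newton (ρ : ℝ) (x : E3) : ∑ j, pd (pd (newton ρ) j) j x = bump ρ x := by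
  obtain ⟨c, -, h, -⟩ := newtonProfile_spec
  simp_rw [pd_pd_newton, ← Finset.mul_sum, h]
  rfl

lemma contDiff_bumpProfile : ContDiff ℝ ∞ bumpProfile := by
  obtain ⟨c, h, h1, -⟩ := newtonProfile_spec
  have : bumpProfile = fun x => ∑ j, pd (pd newtonProfile j) j x := funext fun x => (h1 x).symm
  rw [this]
  exact ContDiff.sum fun j _ => contDiff_pd (contDiff_pd h j) j

lemma contDiff_bump (ρ : ℝ) : ContDiff ℝ ∞ (bump ρ) :=
  contDiff_const.mul (contDiff_bumpProfile.comp (contDiff_const_smul _))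

lemma bump_nonneg {ρ : ℝ} (hρ : 0 < ρ) (x : E3) : 0 ≤ bump ρ x := by
  obtain ⟨c, -, -, h, -⟩ := newtonProfile_spec
  exact mul_nonneg (by positivity) (h _)

lemma one_le_norm_inv_smul {ρ : ℝ} (hρ : 0 < ρ) {x : E3} (hx : ρ ≤ ‖x‖) : 1 ≤ ‖ρ⁻¹ • x‖ := by
  rw [norm_smul, norm_inv, Real.norm_of_nonneg hρ.le, ← div_eq_inv_mul]
  exact (one_le_div hρ).2 hx

lemma bump_eq_zero {ρ : ℝ} (hρ : 0 < ρ) {x : E3} (hx : ρ ≤ ‖x‖) : bump ρ x = 0 := by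
  obtain ⟨c, -, -, -, -, h, -⟩ := newtonProfile_spec
  rw [bump, h _ (one_le_norm_inv_smul hρ hx), mul_zero]

lemma hasCompactSupport_of_norm {f : E3 → ℝ} {ρ : ℝ} (h : ∀ x, ρ ≤ ‖x‖ → f x = 0) :
    HasCompactSupport f :=
  HasCompactSupport.intro (isCompact_closedBall 0 ρ) fun x hx =>
    h x (by simpa using (not_le.1 (by simpa using hx)).le)

lemma hasCompactSupport_bump {ρ : ℝ} (hρ : 0 < ρ) : HasCompactSupport (bump ρ) :=
  hasCompactSupport_of_norm fun _ => bump_eq_zero hρ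

lemma integral_bump {ρ : ℝ} (hρ : 0 < ρ) : ∫ x, bump ρ x = 1 := by
  obtain ⟨c, -, -, -, h, -⟩ := newtonProfile_spec
  simp_rw [bump]
  rw [integral_const_mul, Measure.integral_comp_inv_smul, h, smul_eq_mul,
    abs_of_nonneg (by positivity)]
  simp only [finrank_euclideanSpace, Fintype.card_fin]
  field_simp

/-- The difference of two regularised Newtonian kernels. -/
def newtonDiff (ε ρ : ℝ) (x : E3) : ℝ := newton ε x - newton ρ x

lemma contDiff_newtonDiff (ε ρ : ℝ) : ContDiff ℝ ∞ (newtonDiff ε ρ) :=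
  (contDiff_newton ε).sub (contDiff_newton ρ)

lemma newton_of_le {ρ : ℝ} (hρ : 0 < ρ) : ∃ c : ℝ, ∀ ε : ℝ, 0 < ε → ε ≤ ρ → ∀ x : E3, ρ ≤ ‖x‖ →
    newton ε x = c / ‖x‖ := by
  obtain ⟨c, -, -, -, -, -, h, -⟩ := newtonProfile_spec
  refine ⟨c, fun ε hε hερ x hx => ?_⟩
  have hx0 : 0 < ‖x‖ := hρ.trans_le hx
  rw [newton, h _ (one_le_norm_inv_smul hε (hερ.trans hx)), norm_smul, norm_inv,
    Real.norm_of_nonneg hε.le]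
  field_simp

lemma newtonDiff_eq_zero {ε ρ : ℝ} (hε : 0 < ε) (hερ : ε ≤ ρ) {x : E3} (hx : ρ ≤ ‖x‖) :
    newtonDiff ε ρ x = 0 := by
  obtain ⟨c, h⟩ := newton_of_le (hε.trans_le hερ)
  rw [newtonDiff, h ε hε hερ x hx, h ρ (hε.trans_le hερ) le_rfl x hx, sub_self]

lemma newtonDiff_neg (ε ρ : ℝ) (x : E3) : newtonDiff ε ρ (-x) = newtonDiff ε ρ x := by
  obtain ⟨c, -, -, -, -, -, -, h⟩ := newtonProfile_spec
  simp [newtonDiff, newton, smul_neg, h]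

lemma pd_pd_newtonDiff (ε ρ : ℝ) (i j : Fin 3) (x : E3) :
    pd (pd (newtonDiff ε ρ) i) j x = pd (pd (newton ε) i) j x - pd (pd (newton ρ) i) j x := by
  have h1 : pd (newtonDiff ε ρ) i = fun y => pd (newton ε) i y - pd (newton ρ) i y :=
    funext fun y => pd_sub (contDiff_newton ε).diffAt (contDiff_newton ρ).diffAt
  rw [h1, pd_sub (contDiff_pd (contDiff_newton ε) i).diffAt
    (contDiff_pd (contDiff_newton ρ) i).diffAt]

lemma laplacian_newtonDiff (ε ρ : ℝ) (x : E3) :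
    ∑ j, pd (pd (newtonDiff ε ρ) j) j x = bump ε x - bump ρ x := by
  simp_rw [pd_pd_newtonDiff, Finset.sum_sub_distrib, laplacian_newton]

lemma pd_pd_neg {f : E3 → ℝ} (hf : ContDiff ℝ ∞ f) (he : ∀ x, f (-x) = f x) (i j : Fin 3)
    (x : E3) : pd (pd f i) j (-x) = pd (pd f i) j x := by
  have h0 : f = fun y => f (0 - y) := by funext y; rw [zero_sub, he]
  have h1 : ∀ y, pd f i y = -pd f i (0 - y) := fun y => by
    conv_lhs => rw [h0]
    exact pd_comp_sub_left hf 0 i y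
  have h2 : pd f i = fun y => (-1 : ℝ) * pd f i (0 - y) := by
    funext y; rw [h1 y]; ring
  have h3 : DifferentiableAt ℝ (fun y => pd f i (0 - y)) x :=
    ((contDiff_pd hf i).comp (contDiff_const.sub contDiff_id)).diffAt
  conv_rhs => rw [h2]
  rw [pd_const_mul _ h3, pd_comp_sub_left (contDiff_pd hf i), zero_sub]
  ring

lemma pd_eq_zero_of_norm {f : E3 → ℝ} {ρ : ℝ} (h : ∀ x, ρ ≤ ‖x‖ → f x = 0) (j : Fin 3) (x : E3)
    (hx : ρ < ‖x‖) : pd f j x = 0 := by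
  have : f =ᶠ[nhds x] fun _ => 0 := by
    filter_upwards [continuous_norm.continuousAt.eventually (lt_mem_nhds hx)] with y hy
    exact h y hy.le
  rw [pd_congr this, pd_const]

lemma pd_pd_newtonDiff_eq_zero {ε ρ : ℝ} (hε : 0 < ε) (hερ : ε ≤ ρ) (i j : Fin 3) {x : E3}
    (hx : ρ < ‖x‖) : pd (pd (newtonDiff ε ρ) i) j x = 0 := by
  have : pd (newtonDiff ε ρ) i =ᶠ[nhds x] fun _ => 0 := by
    filter_upwards [continuous_norm.continuousAt.eventually (lt_mem_nhds hx)] with y hy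
    exact pd_eq_zero_of_norm (fun x => newtonDiff_eq_zero hε hερ) i y hy
  rw [pd_congr this, pd_const]

lemma hasCompactSupport_newtonDiff {ε ρ : ℝ} (hε : 0 < ε) (hερ : ε ≤ ρ) :
    HasCompactSupport (newtonDiff ε ρ) :=
  hasCompactSupport_of_norm fun _ => newtonDiff_eq_zero hε hερ

end NewtonianKernel

section PressureNear

/-- `ΔP = -∑ ∂ᵢ∂ⱼ Fᵢⱼ` on the ball of radius `1/2`, in the sense of distributions. -/
def IsWeakPressure (P : E3 → ℝ) (F : Fin 3 → Fin 3 → E3 → ℝ) : Prop :=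
  ∀ g : E3 → ℝ, ContDiff ℝ ∞ g → tsupport g ⊆ closedBall 0 (1 / 2) →
    ∫ x, P x * ∑ j, pd (pd g j) j x = -∑ i, ∑ j, ∫ x, F i j x * pd (pd g i) j x

variable {P : E3 → ℝ} {F : Fin 3 → Fin 3 → E3 → ℝ} {S : E3 → ℝ}

lemma IsWeakPressure.conv_laplacian (h : IsWeakPressure P F) {K : E3 → ℝ} {ρ : ℝ}
    (hK : ContDiff ℝ ∞ K) (hK0 : ∀ x, ρ ≤ ‖x‖ → K x = 0) {x : E3} (hx : ‖x‖ + ρ ≤ 1 / 2) :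
    conv (fun z => ∑ j, pd (pd K j) j z) P x
      = -∑ i, ∑ j, conv (pd (pd K i) j) (F i j) x := by
  have h1 : ∀ i y, pd (fun y => K (x - y)) i y = -1 * pd K i (x - y) := fun i y => by
    rw [pd_comp_sub_left hK]; ring
  have h2 : ∀ i j y, pd (pd (fun y => K (x - y)) i) j y = pd (pd K i) j (x - y) := fun i j y => by
    rw [show pd (fun y => K (x - y)) i = fun y => -1 * pd K i (x - y) from funext (h1 i),
      pd_const_mul (f := fun y => pd K i (x - y)) _
        ((contDiff_pd hK i).comp (contDiff_const.sub contDiff_id)).diffAt,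
        pd_comp_sub_left (contDiff_pd hK i)]
    ring
  have hs : tsupport (fun y => K (x - y)) ⊆ closedBall 0 (1 / 2) := by
    refine closure_minimal (fun y hy => ?_) isClosed_closedBall
    have h3 : ‖x - y‖ < ρ := by
      by_contra hc
      exact hy (hK0 _ (not_lt.1 hc))
    have h4 : ‖y‖ ≤ ‖x‖ + ‖x - y‖ := by
      calc ‖y‖ = ‖x - (x - y)‖ := by rw [sub_sub_cancel]
        _ ≤ _ := norm_sub_le _ _
    rw [mem_closedBall_zero_iff]; linarith
  have := h (fun y => K (x - y)) (hK.comp (contDiff_const.sub contDiff_id)) hs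
  simp only [h2] at this
  simp only [conv]
  simp only [mul_comm (P _), mul_comm (F _ _ _)] at this
  exact this

lemma abs_conv_bump_sub_le {ε : ℝ} (hε : 0 < ε) {f : E3 → ℝ} (hf : Continuous f) {x : E3} {a δ : ℝ}
    (h : ∀ y ∈ closedBall x ε, |f y - a| ≤ δ) : |conv (bump ε) f x - a| ≤ δ := by
  have hb := (contDiff_bump ε).continuous
  have hbc := hasCompactSupport_bump hε
  have i1 := integrable_conv_integrand hb hbc hf.locallyIntegrable x
  have i2 : Integrable fun y => bump ε (x - y) := by
    simpa using integrable_conv_integrand hb hbc (f := fun _ => 1)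
      continuous_const.locallyIntegrable x
  have e : conv (bump ε) f x - a = ∫ y, bump ε (x - y) * (f y - a) := by
    simp_rw [mul_sub]
    rw [integral_sub i1 (i2.mul_const _), integral_mul_const, integral_comp_sub_left,
      integral_bump hε, one_mul]
    rfl
  rw [e]
  calc ‖∫ y, bump ε (x - y) * (f y - a)‖ ≤ ∫ y, bump ε (x - y) * δ := by
        refine norm_integral_le_of_norm_le (i2.mul_const _) (Filter.Eventually.of_forall fun y => ?_)
        rw [norm_mul, Real.norm_of_nonneg (bump_nonneg hε _)]
        by_cases hy : ‖x - y‖ < ε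
        · refine mul_le_mul_of_nonneg_left (h y ?_) (bump_nonneg hε _)
          rw [mem_closedBall', dist_eq_norm]; exact hy.le
        · rw [bump_eq_zero hε (not_lt.1 hy)]; simp
    _ = δ := by rw [integral_mul_const, integral_comp_sub_left, integral_bump hε, one_mul]

lemma hasCompactSupport_sum {ι : Type*} (s : Finset ι) {f : ι → E3 → ℝ}
    (h : ∀ i ∈ s, HasCompactSupport (f i)) : HasCompactSupport fun x => ∑ i ∈ s, f i x := by
  classical
  induction s using Finset.induction_on with
  | empty => simp only [Finset.sum_empty]; exact HasCompactSupport.zero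
  | insert a s ha ih =>
    simp_rw [Finset.sum_insert ha]
    exact (h a (Finset.mem_insert_self a s)).add
      (ih fun i hi => h i (Finset.mem_insert_of_mem hi))

lemma hasCompactSupport_sq {f : E3 → ℝ} (h : HasCompactSupport f) :
    HasCompactSupport fun x => f x ^ 2 :=
  h.comp_left (g := fun y : ℝ => y ^ 2) (by simp)

/-- The Hessian of `newtonDiff`. -/
def newtonHess (ε ρ : ℝ) (i j : Fin 3) : E3 → ℝ := pd (pd (newtonDiff ε ρ) i) j

lemma contDiff_newtonHess (ε ρ : ℝ) (i j : Fin 3) : ContDiff ℝ ∞ (newtonHess ε ρ i j) :=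
  contDiff_pd (contDiff_pd (contDiff_newtonDiff ε ρ) i) j

lemma hasCompactSupport_newtonHess {ε ρ : ℝ} (hε : 0 < ε) (hερ : ε ≤ ρ) (i j : Fin 3) :
    HasCompactSupport (newtonHess ε ρ i j) :=
  hasCompactSupport_pd (hasCompactSupport_pd (hasCompactSupport_newtonDiff hε hερ) i) j

lemma conv_newtonHess {ε ρ : ℝ} (hε : 0 < ε) (hερ : ε ≤ ρ) {w : E3 → ℝ}
    (hw : LocallyIntegrable w) (i j : Fin 3) :
    conv (newtonHess ε ρ i j) w = pd (pd (conv (newtonDiff ε ρ) w) i) j := by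
  have Ks := contDiff_newtonDiff ε ρ
  have Kc := hasCompactSupport_newtonDiff hε hερ
  rw [pd_conv Ks Kc hw, pd_conv (contDiff_pd Ks i) (hasCompactSupport_pd Kc i) hw]
  rfl

lemma laplacian_conv_newtonDiff {ε ρ : ℝ} (hε : 0 < ε) (hερ : ε ≤ ρ) {w : E3 → ℝ}
    (hw : LocallyIntegrable w) (x : E3) :
    ∑ k, pd (pd (conv (newtonDiff ε ρ) w) k) k x = conv (bump ε) w x - conv (bump ρ) w x := by
  simp_rw [← conv_newtonHess hε hερ hw, conv]
  rw [← integral_finsetSum _ fun i _ =>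
    integrable_conv_integrand (contDiff_newtonHess ε ρ i i).continuous
      (hasCompactSupport_newtonHess hε hερ i i) hw x,
    ← integral_sub
    (integrable_conv_integrand (contDiff_bump ε).continuous (hasCompactSupport_bump hε) hw x)
    (integrable_conv_integrand (contDiff_bump ρ).continuous
      (hasCompactSupport_bump (hε.trans_le hερ)) hw x)]
  congr 1; funext y
  rw [← Finset.sum_mul, ← sub_mul, ← laplacian_newtonDiff]
  rfl

lemma integral_laplacian_sq_le {ε ρ : ℝ} (hε : 0 < ε) (hερ : ε ≤ ρ) {w : E3 → ℝ}
    (hw : Continuous w) (hwc : HasCompactSupport w) :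
    ∫ x, (∑ k, pd (pd (conv (newtonDiff ε ρ) w) k) k x) ^ 2 ≤ 4 * ∫ x, w x ^ 2 := by
  have hρ : 0 < ρ := hε.trans_le hερ
  have b : ∀ {r : ℝ}, 0 < r → ∫ x, conv (bump r) w x ^ 2 ≤ ∫ x, w x ^ 2 := fun {r} hr =>
    integral_conv_sq_le (contDiff_bump r).continuous (hasCompactSupport_bump hr)
      (bump_nonneg hr) (integral_bump hr) hw hwc
  have hsq : ∀ {r : ℝ}, 0 < r → Integrable fun x => conv (bump r) w x ^ 2 := fun {r} hr =>
    ((contDiff_conv (contDiff_bump r) (hasCompactSupport_bump hr)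
      hw.locallyIntegrable).continuous.pow 2).integrable_of_hasCompactSupport
      (hasCompactSupport_sq (hasCompactSupport_conv (hasCompactSupport_bump hr) hwc))
  simp_rw [laplacian_conv_newtonDiff hε hερ hw.locallyIntegrable]
  calc ∫ x, (conv (bump ε) w x - conv (bump ρ) w x) ^ 2
      ≤ ∫ x, (2 * conv (bump ε) w x ^ 2 + 2 * conv (bump ρ) w x ^ 2) := by
        refine integral_mono_of_nonneg (Filter.Eventually.of_forall fun x => sq_nonneg _)
          (((hsq hε).const_mul 2).add ((hsq hρ).const_mul 2))
          (Filter.Eventually.of_forall fun x => ?_)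
        simp only
        nlinarith [sq_nonneg (conv (bump ε) w x + conv (bump ρ) w x)]
    _ ≤ 4 * ∫ x, w x ^ 2 := by
        rw [integral_add ((hsq hε).const_mul 2) ((hsq hρ).const_mul 2), integral_const_mul,
          integral_const_mul]
        linarith [b hε, b hρ]

lemma sum_sum_sq_le (a : Fin 3 → Fin 3 → ℝ) {A : ℝ} (h : ∀ i j, a i j ^ 2 ≤ A) :
    (∑ i, ∑ j, a i j) ^ 2 ≤ 81 * A := by
  have q1 := sq_sum_le_card_mul_sum_sq (s := (Finset.univ : Finset (Fin 3)))
    (f := fun i => ∑ j, a i j)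
  have q2 : ∀ i, (∑ j, a i j) ^ 2 ≤ 3 * ∑ j, a i j ^ 2 := fun i => by
    simpa using sq_sum_le_card_mul_sum_sq (s := (Finset.univ : Finset (Fin 3))) (f := a i)
  simp only [Finset.card_univ, Fintype.card_fin, Nat.cast_ofNat, Fin.sum_univ_three] at q1 q2 ⊢
  linarith [q2 0, q2 1, q2 2, h 0 0, h 0 1, h 0 2, h 1 0, h 1 1, h 1 2, h 2 0, h 2 1, h 2 2]

/-- A Calderón–Zygmund estimate in `L²` for the truncated double Riesz transforms. -/
lemma integral_sum_conv_newtonHess_sq_le {ε ρ I : ℝ} (hε : 0 < ε) (hερ : ε ≤ ρ)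
    {f : Fin 3 → Fin 3 → E3 → ℝ} (fi : ∀ i j, Integrable (f i j))
    (fc : ∀ i j, HasCompactSupport (f i j)) (hfsq : ∀ i j, Integrable fun x => f i j x ^ 2)
    (hfI : ∀ i j, ∫ x, f i j x ^ 2 ≤ I) :
    Integrable (fun x => (∑ i, ∑ j, conv (newtonHess ε ρ i j) (f i j) x) ^ 2) ∧
    ∫ x, (∑ i, ∑ j, conv (newtonHess ε ρ i j) (f i j) x) ^ 2 ≤ 324 * I := by
  have hI0 : 0 ≤ I := le_trans (integral_nonneg fun x => sq_nonneg _) (hfI 0 0)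
  have Dc := hasCompactSupport_newtonHess hε hερ
  have cs : ∀ i j, ContDiff ℝ ∞ (conv (newtonHess ε ρ i j) (f i j)) := fun i j =>
    contDiff_conv (contDiff_newtonHess ε ρ i j) (Dc i j) (fi i j).locallyIntegrable
  obtain ⟨w, hw⟩ : ∃ w : E3 → ℝ, ∀ x, w x = ∑ i, ∑ j, conv (newtonHess ε ρ i j) (f i j) x :=
    ⟨_, fun x => rfl⟩
  have hw' : w = fun x => ∑ i, ∑ j, conv (newtonHess ε ρ i j) (f i j) x := funext hw
  have ws : ContDiff ℝ ∞ w := by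
    rw [hw']; exact ContDiff.sum fun i _ => ContDiff.sum fun j _ => cs i j
  have wc : HasCompactSupport w := by
    rw [hw']
    exact hasCompactSupport_sum _ fun i _ => hasCompactSupport_sum _ fun j _ =>
      hasCompactSupport_conv (Dc i j) (fc i j)
  simp_rw [← hw]
  have wi : Integrable w := ws.continuous.integrable_of_hasCompactSupport wc
  refine ⟨(ws.continuous.pow 2).integrable_of_hasCompactSupport (hasCompactSupport_sq wc), ?_⟩
  have hX0 : 0 ≤ ∫ x, w x ^ 2 := integral_nonneg fun x => sq_nonneg _
  have hLap := integral_laplacian_sq_le hε hερ ws.continuous wc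
  have hDW := fun i j => conv_newtonHess hε hερ wi.locallyIntegrable i j
  have Ws : ContDiff ℝ ∞ (conv (newtonDiff ε ρ) w) := contDiff_conv (contDiff_newtonDiff ε ρ)
    (hasCompactSupport_newtonDiff hε hερ) wi.locallyIntegrable
  have Wc : HasCompactSupport (conv (newtonDiff ε ρ) w) :=
    hasCompactSupport_conv (hasCompactSupport_newtonDiff hε hερ) wc
  generalize conv (newtonDiff ε ρ) w = W at hLap hDW Ws Wc
  have ha2 : ∀ i j, (∫ x, f i j x * pd (pd W i) j x) ^ 2 ≤ 4 * (∫ x, w x ^ 2) * I := fun i j => by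
    have Wij : ContDiff ℝ ∞ (pd (pd W i) j) := contDiff_pd (contDiff_pd Ws i) j
    have Wijc : HasCompactSupport (pd (pd W i) j) :=
      hasCompactSupport_pd (hasCompactSupport_pd Wc i) j
    obtain ⟨C, hC⟩ := Wij.continuous.bounded_above_of_compact_support Wijc
    have i3 : Integrable fun x => f i j x * pd (pd W i) j x :=
      (fi i j).mul_bdd (c := C) Wij.continuous.aestronglyMeasurable
        (Filter.Eventually.of_forall hC)
    have i2 : Integrable fun x => pd (pd W i) j x ^ 2 :=
      (Wij.continuous.pow 2).integrable_of_hasCompactSupport (hasCompactSupport_sq Wijc)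
    have c1 := sq_integral_mul_le (hfsq i j) i2 i3
    have c2 := (integral_pd_pd_sq_le Ws Wc i j).trans hLap
    calc (∫ x, f i j x * pd (pd W i) j x) ^ 2 ≤ _ := c1
      _ ≤ I * (4 * ∫ x, w x ^ 2) :=
        mul_le_mul (hfI i j) c2 (integral_nonneg fun x => sq_nonneg _) hI0
      _ = _ := by ring
  have hXa : ∫ x, w x ^ 2 = ∑ i, ∑ j, ∫ x, f i j x * pd (pd W i) j x := by
    have wci : ∀ i j, Integrable fun x => w x * conv (newtonHess ε ρ i j) (f i j) x := fun i j =>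
      (ws.continuous.mul (cs i j).continuous).integrable_of_hasCompactSupport wc.mul_right
    have e : ∀ x, w x ^ 2 = ∑ i, ∑ j, w x * conv (newtonHess ε ρ i j) (f i j) x := fun x => by
      simp_rw [← Finset.mul_sum, pow_two]
      rw [← hw]
    simp_rw [e]
    rw [integral_finsetSum _ fun i _ => integrable_finsetSum _ fun j _ => wci i j]
    refine Finset.sum_congr rfl fun i _ => ?_
    rw [integral_finsetSum _ fun j _ => wci i j]
    refine Finset.sum_congr rfl fun j _ => ?_
    rw [integral_mul_conv_comm (contDiff_newtonHess ε ρ i j).continuous (Dc i j)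
      (pd_pd_neg (contDiff_newtonDiff ε ρ) (newtonDiff_neg ε ρ) i j) wi (fi i j), hDW]
  have hXX := sum_sum_sq_le _ ha2
  rw [← hXa] at hXX
  rcases hX0.eq_or_lt with h0 | h0
  · rw [← h0]; positivity
  · nlinarith

/-- The Calderón–Zygmund estimate for the mollified near part of the pressure. -/
lemma IsWeakPressure.integral_bump_sub_sq_le (h : IsWeakPressure P F)
    (hP : Continuous P) (hF : ∀ i j, Continuous (F i j)) (hS : Continuous S)
    (hFS : ∀ i j x, |F i j x| ≤ S x) {ε ρ : ℝ} (hε : 0 < ε) (hερ : ε ≤ ρ) (hρ : 2 * ρ ≤ 1 / 2) :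
    ∫ x in closedBall 0 ρ, (conv (bump ε) P x - conv (bump ρ) P x) ^ 2
      ≤ 324 * ∫ x in closedBall 0 (2 * ρ), S x ^ 2 := by
  have hρ0 : 0 < ρ := hε.trans_le hερ
  have hBm : MeasurableSet (closedBall (0 : E3) (2 * ρ)) := isClosed_closedBall.measurableSet
  have hBc : IsCompact (closedBall (0 : E3) (2 * ρ)) := isCompact_closedBall 0 _
  have hsq : ∀ i j, (fun x => (closedBall (0 : E3) (2 * ρ)).indicator (F i j) x ^ 2)
      = (closedBall (0 : E3) (2 * ρ)).indicator fun x => F i j x ^ 2 := fun i j => by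
    funext x
    by_cases hx : x ∈ closedBall (0 : E3) (2 * ρ)
    · simp only [indicator_of_mem hx]
    · simp only [indicator_of_notMem hx]; norm_num
  obtain ⟨hi, hcz⟩ := integral_sum_conv_newtonHess_sq_le
    (f := fun i j => (closedBall (0 : E3) (2 * ρ)).indicator (F i j))
    (I := ∫ x in closedBall 0 (2 * ρ), S x ^ 2) hε hερ
    (fun i j => ((hF i j).continuousOn.integrableOn_compact hBc).integrable_indicator hBm)
    (fun i j => HasCompactSupport.intro hBc fun x hx => indicator_of_notMem hx _)
    (fun i j => by
      rw [hsq]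
      exact (((hF i j).pow 2).continuousOn.integrableOn_compact hBc).integrable_indicator hBm)
    (fun i j => by
      rw [hsq, integral_indicator hBm]
      refine setIntegral_mono (((hF i j).pow 2).continuousOn.integrableOn_compact hBc)
        ((hS.pow 2).continuousOn.integrableOn_compact hBc) fun x => ?_
      exact sq_le_sq.2 ((hFS i j x).trans (le_abs_self _)))
  have hpt : ∀ x ∈ closedBall (0 : E3) ρ, conv (bump ε) P x - conv (bump ρ) P x
      = - ∑ i, ∑ j, conv (newtonHess ε ρ i j)
        ((closedBall (0 : E3) (2 * ρ)).indicator (F i j)) x := by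
    intro x hx
    rw [mem_closedBall_zero_iff] at hx
    have h1 := h.conv_laplacian (contDiff_newtonDiff ε ρ)
      (fun x => newtonDiff_eq_zero hε hερ) (x := x) (ρ := ρ) (by linarith)
    have h2 : conv (fun z => ∑ j, pd (pd (newtonDiff ε ρ) j) j z) P x
        = conv (bump ε) P x - conv (bump ρ) P x := by
      simp_rw [laplacian_newtonDiff, conv, sub_mul]
      exact integral_sub
        (integrable_conv_integrand (contDiff_bump ε).continuous (hasCompactSupport_bump hε)
          hP.locallyIntegrable x)
        (integrable_conv_integrand (contDiff_bump ρ).continuous (hasCompactSupport_bump hρ0)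
          hP.locallyIntegrable x)
    rw [← h2, h1]
    congr 1
    refine Finset.sum_congr rfl fun i _ => Finset.sum_congr rfl fun j _ => ?_
    refine integral_congr_ae (Filter.Eventually.of_forall fun y => ?_)
    by_cases hy : y ∈ closedBall (0 : E3) (2 * ρ)
    · simp only [indicator_of_mem hy, newtonHess]
    · have : ρ < ‖x - y‖ := by
        rw [mem_closedBall_zero_iff, not_le] at hy
        have := norm_sub_norm_le y x
        rw [norm_sub_rev] at this
        linarith
      simp only [newtonHess, pd_pd_newtonDiff_eq_zero hε hερ i j this, zero_mul]
  rw [setIntegral_congr_fun isClosed_closedBall.measurableSet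
    fun x hx => by rw [hpt x hx, neg_sq]]
  exact (setIntegral_le_integral hi (Filter.Eventually.of_forall fun x => sq_nonneg _)).trans hcz

end PressureNear

section PressureDecomposition

variable {P : E3 → ℝ} {F : Fin 3 → Fin 3 → E3 → ℝ} {S : E3 → ℝ}

lemma IsWeakPressure.integral_sub_bump_sq_le (h : IsWeakPressure P F)
    (hP : Continuous P) (hF : ∀ i j, Continuous (F i j)) (hS : Continuous S)
    (hFS : ∀ i j x, |F i j x| ≤ S x) {ρ : ℝ} (hρ0 : 0 < ρ) (hρ : 2 * ρ ≤ 1 / 2) :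
    ∫ x in closedBall 0 ρ, (P x - conv (bump ρ) P x) ^ 2
      ≤ 648 * ∫ x in closedBall 0 (2 * ρ), S x ^ 2 := by
  have hBc : IsCompact (closedBall (0 : E3) ρ) := isCompact_closedBall 0 _
  have hQ : ∀ {r : ℝ}, 0 < r → Continuous (conv (bump r) P) := fun {r} hr =>
    (contDiff_conv (contDiff_bump r) (hasCompactSupport_bump hr) hP.locallyIntegrable).continuous
  have hu := (isCompact_closedBall (0 : E3) 1).uniformContinuousOn_of_continuous hP.continuousOn
  rw [Metric.uniformContinuousOn_iff_le] at hu
  set V := volume.real (closedBall (0 : E3) ρ) with hV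
  have hV0 : 0 ≤ V := measureReal_nonneg
  refine le_of_forall_pos_le_add fun e he => ?_
  obtain ⟨δ, hδ, hδe⟩ : ∃ δ > 0, 2 * δ ^ 2 * V ≤ e := by
    refine ⟨Real.sqrt (e / (2 * (V + 1))), by positivity, ?_⟩
    rw [Real.sq_sqrt (by positivity)]
    rw [show 2 * (e / (2 * (V + 1))) * V = e * (V / (V + 1)) by field_simp]
    exact mul_le_of_le_one_right he.le (by rw [div_le_one (by positivity)]; linarith)
  obtain ⟨d, hd, hd'⟩ := hu δ hδ
  have hε : 0 < min d ρ := lt_min hd hρ0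
  have h1 : ∀ x ∈ closedBall (0 : E3) ρ, |conv (bump (min d ρ)) P x - P x| ≤ δ := fun x hx => by
    refine abs_conv_bump_sub_le hε hP fun y hy => ?_
    rw [mem_closedBall] at hy
    rw [mem_closedBall_zero_iff] at hx
    refine hd' y ?_ x ?_ (hy.trans (min_le_left _ _))
    · rw [mem_closedBall_zero_iff]
      have h2 : dist y x ≤ ρ := hy.trans (min_le_right _ _)
      rw [dist_eq_norm] at h2
      have := norm_sub_norm_le y x
      linarith
    · rw [mem_closedBall_zero_iff]; linarith
  have h2 := h.integral_bump_sub_sq_le hP hF hS hFS hε (min_le_right _ _) hρ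
  have ic : ∀ {g : E3 → ℝ}, Continuous g → IntegrableOn g (closedBall 0 ρ) := fun hg =>
    hg.continuousOn.integrableOn_compact hBc
  have i1 : IntegrableOn (fun x => 2 * (conv (bump (min d ρ)) P x - conv (bump ρ) P x) ^ 2)
      (closedBall 0 ρ) := ic (continuous_const.mul (((hQ hε).sub (hQ hρ0)).pow 2))
  have i2 : IntegrableOn (fun _ : E3 => 2 * δ ^ 2) (closedBall 0 ρ) := ic continuous_const
  calc ∫ x in closedBall 0 ρ, (P x - conv (bump ρ) P x) ^ 2
      ≤ ∫ x in closedBall 0 ρ, (2 * (conv (bump (min d ρ)) P x - conv (bump ρ) P x) ^ 2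
          + 2 * δ ^ 2) := by
        refine setIntegral_mono_on (ic ((hP.sub (hQ hρ0)).pow 2)) (i1.add i2)
          isClosed_closedBall.measurableSet fun x hx => ?_
        have h3 := sq_le_sq' (by linarith [(abs_le.1 (h1 x hx)).1]) (abs_le.1 (h1 x hx)).2
        nlinarith [sq_nonneg ((conv (bump (min d ρ)) P x - conv (bump ρ) P x)
          + (conv (bump (min d ρ)) P x - P x))]
    _ ≤ 648 * (∫ x in closedBall 0 (2 * ρ), S x ^ 2) + e := by
        rw [integral_add i1 i2, integral_const_mul, setIntegral_const, smul_eq_mul]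
        linarith

lemma abs_conv_sub_le {k f : E3 → ℝ} {L : ℝ} {a b : ℝ} (hkn : Continuous k)
    (hk : ∀ x y, |k x - k y| ≤ L * ‖x - y‖) (hkc : HasCompactSupport k)
    (hk0 : ∀ z, a < ‖z‖ → k z = 0) (hf : Continuous f) {x : E3} (hx : ‖x‖ + a ≤ b) :
    |conv k f x - conv k f 0| ≤ L * ‖x‖ * ∫ y in closedBall 0 b, |f y| := by
  have i := fun x => integrable_conv_integrand hkn hkc hf.locallyIntegrable x
  have e : conv k f x - conv k f 0
      = ∫ y in closedBall 0 b, (k (x - y) - k (0 - y)) * f y := by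
    rw [setIntegral_eq_integral_of_forall_compl_eq_zero]
    · simp_rw [sub_mul]
      exact (integral_sub (i x) (i 0)).symm
    · intro y hy
      rw [mem_closedBall_zero_iff, not_le] at hy
      have h1 := norm_sub_norm_le y x
      rw [norm_sub_rev] at h1
      have h2 := norm_nonneg x
      rw [hk0 (x - y) (by linarith), hk0 (0 - y) (by rw [zero_sub, norm_neg]; linarith)]
      ring
  rw [e, ← integral_const_mul, ← Real.norm_eq_abs]
  refine norm_integral_le_of_norm_le (μ := volume.restrict (closedBall 0 b))
    ((continuous_const.mul hf.abs).continuousOn.integrableOn_compact (isCompact_closedBall 0 b))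
    (Filter.Eventually.of_forall fun y => ?_)
  rw [norm_mul]
  have := hk (x - y) (0 - y)
  rw [show x - y - (0 - y) = x by abel] at this
  exact mul_le_mul_of_nonneg_right this (norm_nonneg _)

lemma newtonHess_scale {ρ : ℝ} (i j : Fin 3) (x : E3) :
    newtonHess ρ (2 * ρ) i j x = ρ⁻¹ ^ 3 * newtonHess 1 2 i j (ρ⁻¹ • x) := by
  simp only [newtonHess, pd_pd_newtonDiff, pd_pd_newton, smul_smul, mul_inv]
  simp only [inv_one, one_mul]
  ring

lemma exists_lipschitz {f : E3 → ℝ} (hf : ContDiff ℝ ∞ f) (hc : HasCompactSupport f) :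
    ∃ L : ℝ, 0 ≤ L ∧ ∀ x y, |f x - f y| ≤ L * ‖x - y‖ := by
  obtain ⟨L, hL⟩ := (hf.of_le (by exact_mod_cast le_top)
      : ContDiff ℝ 1 f).lipschitzWith_of_hasCompactSupport hc one_ne_zero
  refine ⟨L, L.2, fun x y => ?_⟩
  have := hL.dist_le_mul x y
  rwa [dist_eq_norm, dist_eq_norm, Real.norm_eq_abs] at this

lemma exists_lipschitz_newtonHess : ∃ L : ℝ, 0 ≤ L ∧ ∀ ρ : ℝ, 0 < ρ → ∀ i j x y,
    |newtonHess ρ (2 * ρ) i j x - newtonHess ρ (2 * ρ) i j y| ≤ L * ρ⁻¹ ^ 4 * ‖x - y‖ := by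
  have h := fun i j => exists_lipschitz (contDiff_newtonHess 1 2 i j)
    (hasCompactSupport_newtonHess one_pos one_le_two i j)
  choose L hL0 hL using h
  refine ⟨∑ i, ∑ j, L i j, Finset.sum_nonneg fun i _ => Finset.sum_nonneg fun j _ => hL0 i j,
    fun ρ hρ i j x y => ?_⟩
  have hle : L i j ≤ ∑ i, ∑ j, L i j :=
    (Finset.single_le_sum (f := fun j => L i j) (fun j _ => hL0 i j) (Finset.mem_univ j)).trans
      (Finset.single_le_sum (f := fun i => ∑ j, L i j)
        (fun i _ => Finset.sum_nonneg fun j _ => hL0 i j) (Finset.mem_univ i))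
  have h1 := hL i j (ρ⁻¹ • x) (ρ⁻¹ • y)
  have hρ' : 0 ≤ ρ⁻¹ := by positivity
  rw [← smul_sub, norm_smul, Real.norm_of_nonneg hρ'] at h1
  have h2 : 0 ≤ ρ⁻¹ * ‖x - y‖ := by positivity
  rw [newtonHess_scale, newtonHess_scale, ← mul_sub, abs_mul,
    abs_of_nonneg (show 0 ≤ ρ⁻¹ ^ 3 by positivity)]
  calc ρ⁻¹ ^ 3 * |newtonHess 1 2 i j (ρ⁻¹ • x) - newtonHess 1 2 i j (ρ⁻¹ • y)|
      ≤ ρ⁻¹ ^ 3 * ((∑ i, ∑ j, L i j) * (ρ⁻¹ * ‖x - y‖)) :=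
        mul_le_mul_of_nonneg_left (h1.trans (mul_le_mul_of_nonneg_right hle h2)) (by positivity)
    _ = _ := by ring

lemma exists_abs_conv_bump_sub_le : ∃ C : ℝ, 0 ≤ C ∧ ∀ (P : E3 → ℝ) (F : Fin 3 → Fin 3 → E3 → ℝ)
    (S : E3 → ℝ), IsWeakPressure P F → Continuous P → (∀ i j, Continuous (F i j)) →
    Continuous S → (∀ i j x, |F i j x| ≤ S x) → ∀ ρ : ℝ, 0 < ρ → ρ ≤ 1 / 8 →
    ∀ x : E3, ‖x‖ ≤ ρ → |(conv (bump ρ) P x - conv (bump (2 * ρ)) P x)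
        - (conv (bump ρ) P 0 - conv (bump (2 * ρ)) P 0)|
      ≤ C * ‖x‖ * (ρ⁻¹ ^ 4 * ∫ y in closedBall 0 (4 * ρ), S y) := by
  obtain ⟨L, hL0, hL⟩ := exists_lipschitz_newtonHess
  refine ⟨9 * L, by positivity, fun P F S h hP hF hS hFS ρ hρ0 hρ x hx => ?_⟩
  have hερ : ρ ≤ 2 * ρ := by linarith
  have e : ∀ x : E3, ‖x‖ ≤ ρ → conv (bump ρ) P x - conv (bump (2 * ρ)) P x
      = -∑ i, ∑ j, conv (newtonHess ρ (2 * ρ) i j) (F i j) x := fun x hx => by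
    have h1 := h.conv_laplacian (contDiff_newtonDiff ρ (2 * ρ))
      (fun x => newtonDiff_eq_zero hρ0 hερ) (x := x) (ρ := 2 * ρ) (by linarith)
    have h2 : conv (fun z => ∑ j, pd (pd (newtonDiff ρ (2 * ρ)) j) j z) P x
        = conv (bump ρ) P x - conv (bump (2 * ρ)) P x := by
      simp_rw [laplacian_newtonDiff, conv, sub_mul]
      exact integral_sub
        (integrable_conv_integrand (contDiff_bump ρ).continuous (hasCompactSupport_bump hρ0)
          hP.locallyIntegrable x)
        (integrable_conv_integrand (contDiff_bump _).continuous
          (hasCompactSupport_bump (by linarith)) hP.locallyIntegrable x)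
    rw [← h2, h1]
    rfl
  rw [e x hx, e 0 (by simpa using hρ0.le)]
  have hd : ∀ i j, |conv (newtonHess ρ (2 * ρ) i j) (F i j) x
      - conv (newtonHess ρ (2 * ρ) i j) (F i j) 0|
      ≤ L * ‖x‖ * (ρ⁻¹ ^ 4 * ∫ y in closedBall 0 (4 * ρ), S y) := fun i j => by
    have h1 := abs_conv_sub_le (contDiff_newtonHess _ _ i j).continuous (hL ρ hρ0 i j)
      (hasCompactSupport_newtonHess hρ0 hερ i j)
      (fun z hz => pd_pd_newtonDiff_eq_zero hρ0 hερ i j hz) (hF i j) (x := x) (b := 4 * ρ)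
      (by linarith)
    refine h1.trans ?_
    have h2 : ∫ y in closedBall 0 (4 * ρ), |F i j y| ≤ ∫ y in closedBall 0 (4 * ρ), S y :=
      setIntegral_mono ((hF i j).abs.continuousOn.integrableOn_compact (isCompact_closedBall 0 _))
        (hS.continuousOn.integrableOn_compact (isCompact_closedBall 0 _)) fun y => hFS i j y
    calc _ ≤ L * ρ⁻¹ ^ 4 * ‖x‖ * ∫ y in closedBall 0 (4 * ρ), S y :=
          mul_le_mul_of_nonneg_left h2 (by positivity)
      _ = _ := by ring
  have e2 : -(∑ i, ∑ j, conv (newtonHess ρ (2 * ρ) i j) (F i j) x)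
      - -∑ i, ∑ j, conv (newtonHess ρ (2 * ρ) i j) (F i j) 0
      = -∑ i, ∑ j, (conv (newtonHess ρ (2 * ρ) i j) (F i j) x
        - conv (newtonHess ρ (2 * ρ) i j) (F i j) 0) := by
    simp_rw [Finset.sum_sub_distrib]; ring
  rw [e2, abs_neg]
  calc _ ≤ ∑ i : Fin 3, ∑ j : Fin 3, (L * ‖x‖ * (ρ⁻¹ ^ 4 * ∫ y in closedBall 0 (4 * ρ), S y)) :=
        (Finset.abs_sum_le_sum_abs _ _).trans (Finset.sum_le_sum fun i _ =>
          (Finset.abs_sum_le_sum_abs _ _).trans (Finset.sum_le_sum fun j _ => hd i j))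
    _ = _ := by simp; ring

/-- Decomposition of the pressure on a dyadic ball into a part controlled in `L²` by the local
velocity and a part with small oscillation. -/
lemma exists_pressure_decomposition : ∃ C : ℝ, 0 < C ∧
    ∀ (P : E3 → ℝ) (F : Fin 3 → Fin 3 → E3 → ℝ)
    (S : E3 → ℝ), IsWeakPressure P F → Continuous P → (∀ i j, Continuous (F i j)) →
    Continuous S → (∀ i j x, |F i j x| ≤ S x) → ∀ k : ℕ, 3 ≤ k →
    ∃ (Q : E3 → ℝ) (c : ℝ), Continuous Q ∧
      ∫ x in closedBall 0 ((1 / 2) ^ k), (P x - Q x) ^ 2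
        ≤ C * ∫ x in closedBall 0 (2 * (1 / 2) ^ k), S x ^ 2 ∧
      ∀ x ∈ closedBall (0 : E3) ((1 / 2) ^ k), |Q x - c| ≤ C * (1 / 2) ^ k *
        ((∑ j ∈ Finset.Icc 3 k, 16 ^ j * ∫ y in closedBall 0 (4 * (1 / 2) ^ j), S y)
          + ∫ y in closedBall 0 1, |P y|) := by
  obtain ⟨C, hC0, hC⟩ := exists_abs_conv_bump_sub_le
  obtain ⟨L, hL0, hL⟩ := exists_lipschitz (contDiff_bump (1 / 4))
    (hasCompactSupport_bump (by norm_num))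
  refine ⟨648 + C + L, by positivity, fun P F S h hP hF hS hFS k hk => ?_⟩
  have hk3 : ((1 : ℝ) / 2) ^ k ≤ 1 / 8 := by
    calc ((1 : ℝ) / 2) ^ k ≤ (1 / 2) ^ 3 := pow_le_pow_of_le_one (by norm_num) (by norm_num) hk
      _ = 1 / 8 := by norm_num
  have hk0 : 0 < ((1 : ℝ) / 2) ^ k := by positivity
  have hS0 : ∀ x, 0 ≤ S x := fun x => (abs_nonneg _).trans (hFS 0 0 x)
  refine ⟨conv (bump ((1 / 2) ^ k)) P, conv (bump ((1 / 2) ^ k)) P 0,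
    (contDiff_conv (contDiff_bump _) (hasCompactSupport_bump hk0)
      hP.locallyIntegrable).continuous, ?_, fun x hx => ?_⟩
  · refine (h.integral_sub_bump_sq_le hP hF hS hFS hk0 (by linarith)).trans ?_
    refine mul_le_mul_of_nonneg_right (by linarith) (integral_nonneg fun x => sq_nonneg _)
  · rw [mem_closedBall_zero_iff] at hx
    have key : ∀ m, 2 ≤ m → m ≤ k →
        |conv (bump ((1 / 2) ^ m)) P x - conv (bump ((1 / 2) ^ m)) P 0| ≤ (648 + C + L) * ‖x‖ *
        ((∑ j ∈ Finset.Icc 3 m, 16 ^ j * ∫ y in closedBall 0 (4 * (1 / 2) ^ j), S y)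
          + ∫ y in closedBall 0 1, |P y|) := by
      intro m hm
      induction m, hm using Nat.le_induction with
      | base =>
        intro _
        have e : ((1 : ℝ) / 2) ^ 2 = 1 / 4 := by norm_num
        rw [e]
        have h1 := abs_conv_sub_le (contDiff_bump _).continuous hL
          (hasCompactSupport_bump (by norm_num))
          (fun z hz => bump_eq_zero (by norm_num) hz.le) hP (x := x) (b := 1) (by linarith)
        refine h1.trans ?_
        simp only [Finset.Icc_eq_empty_of_lt (show 2 < 3 by norm_num), Finset.sum_empty, zero_add]
        refine mul_le_mul_of_nonneg_right (mul_le_mul_of_nonneg_right (by linarith)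
          (norm_nonneg _)) (integral_nonneg fun x => abs_nonneg _)
      | succ m hm ih =>
        intro hmk
        have ih := ih (by omega)
        have hm8 : ((1 : ℝ) / 2) ^ (m + 1) ≤ 1 / 8 := by
          calc ((1 : ℝ) / 2) ^ (m + 1) ≤ (1 / 2) ^ 3 :=
                pow_le_pow_of_le_one (by norm_num) (by norm_num) (by omega)
            _ = 1 / 8 := by norm_num
        have h1 := hC P F S h hP hF hS hFS ((1 / 2) ^ (m + 1)) (by positivity) hm8 x
          (hx.trans (pow_le_pow_of_le_one (by norm_num) (by norm_num) hmk))
        rw [show (2 : ℝ) * (1 / 2) ^ (m + 1) = (1 / 2) ^ m by ring,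
          show (((1 : ℝ) / 2) ^ (m + 1))⁻¹ ^ 4 = 16 ^ (m + 1) by
            rw [← inv_pow, ← pow_mul, mul_comm, pow_mul]; norm_num] at h1
        rw [Finset.sum_Icc_succ_top (by omega)]
        set I := 16 ^ (m + 1) * ∫ y in closedBall (0 : E3) (4 * (1 / 2) ^ (m + 1)), S y with hI
        have hI0 : 0 ≤ I := mul_nonneg (by positivity) (integral_nonneg hS0)
        have h2 : C * ‖x‖ * I ≤ (648 + C + L) * ‖x‖ * I :=
          mul_le_mul_of_nonneg_right (mul_le_mul_of_nonneg_right (by linarith) (norm_nonneg _)) hI0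
        rw [abs_le] at *
        constructor <;> nlinarith
    refine (key k (by omega) le_rfl).trans ?_
    refine mul_le_mul_of_nonneg_right (mul_le_mul_of_nonneg_left hx (by positivity)) ?_
    exact add_nonneg (Finset.sum_nonneg fun j _ => mul_nonneg (by positivity)
      (integral_nonneg hS0)) (integral_nonneg fun x => abs_nonneg _)

end PressureDecomposition

section Cutoff

/-- A smooth cutoff function, equal to `1` on the ball of radius `1/2` and vanishing outside the
unit ball. -/
def cutoffProfile : E3 → ℝ :=
  ((⟨1 / 2, 1, by norm_num, by norm_num⟩ : ContDiffBump (0 : E3)) : E3 → ℝ)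

/-- The cutoff function at scale `r`. -/
def cutoff (r : ℝ) (x : E3) : ℝ := cutoffProfile (r⁻¹ • x)

lemma contDiff_cutoffProfile : ContDiff ℝ ∞ cutoffProfile := ContDiffBump.contDiff _

lemma contDiff_cutoff (r : ℝ) : ContDiff ℝ ∞ (cutoff r) :=
  contDiff_cutoffProfile.comp (contDiff_const_smul _)

lemma cutoff_nonneg (r : ℝ) (x : E3) : 0 ≤ cutoff r x := ContDiffBump.nonneg _

lemma cutoff_le_one (r : ℝ) (x : E3) : cutoff r x ≤ 1 := ContDiffBump.le_one _

lemma cutoff_eq_one {r : ℝ} (hr : 0 < r) {x : E3} (hx : ‖x‖ ≤ r / 2) : cutoff r x = 1 := by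
  refine ContDiffBump.one_of_mem_closedBall _ ?_
  rw [mem_closedBall_zero_iff, norm_smul, norm_inv, Real.norm_of_nonneg hr.le]
  rw [inv_mul_le_iff₀ hr]
  simp only; linarith

lemma cutoff_eq_zero {r : ℝ} (hr : 0 < r) {x : E3} (hx : r ≤ ‖x‖) : cutoff r x = 0 := by
  refine ContDiffBump.zero_of_le_dist _ ?_
  rw [dist_zero_right]
  exact one_le_norm_inv_smul hr hx

lemma hasCompactSupport_cutoff {r : ℝ} (hr : 0 < r) : HasCompactSupport (cutoff r) :=
  hasCompactSupport_of_norm fun _ => cutoff_eq_zero hr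

lemma pd_cutoff (r : ℝ) (j : Fin 3) :
    pd (cutoff r) j = fun x => r⁻¹ * pd cutoffProfile j (r⁻¹ • x) :=
  funext fun _ => pd_comp_smul _ contDiff_cutoffProfile _ _ _

lemma pd_pd_cutoff (r : ℝ) (i j : Fin 3) :
    pd (pd (cutoff r) i) j = fun x => r⁻¹ ^ 2 * pd (pd cutoffProfile i) j (r⁻¹ • x) := by
  funext x
  have h := contDiff_pd contDiff_cutoffProfile i
  have h1 : DifferentiableAt ℝ (fun y => pd cutoffProfile i (r⁻¹ • y)) x :=
    (h.comp (contDiff_const_smul _)).diffAt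
  rw [pd_cutoff, pd_const_mul _ h1, pd_comp_smul _ h]
  ring

lemma hasCompactSupport_cutoffProfile : HasCompactSupport cutoffProfile :=
  ContDiffBump.hasCompactSupport _

lemma exists_cutoff_bounds : ∃ C : ℝ, 0 < C ∧ ∀ r : ℝ, 0 < r → ∀ i j x,
    |pd (cutoff r) j x| ≤ C * r⁻¹ ∧ |pd (pd (cutoff r) i) j x| ≤ C * r⁻¹ ^ 2 := by
  have h1 : ∀ j, ∃ C, ∀ x, ‖pd cutoffProfile j x‖ ≤ C := fun j =>
    (continuous_pd contDiff_cutoffProfile j).bounded_above_of_compact_support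
      (hasCompactSupport_pd hasCompactSupport_cutoffProfile j)
  have h2 : ∀ i j, ∃ C, ∀ x, ‖pd (pd cutoffProfile i) j x‖ ≤ C := fun i j =>
    (continuous_pd (contDiff_pd contDiff_cutoffProfile i) j).bounded_above_of_compact_support
      (hasCompactSupport_pd (hasCompactSupport_pd hasCompactSupport_cutoffProfile i) j)
  choose C hC using h1
  choose D hD using h2
  have hC0 : ∀ j, 0 ≤ C j := fun j => (norm_nonneg _).trans (hC j 0)
  have hD0 : ∀ i j, 0 ≤ D i j := fun i j => (norm_nonneg _).trans (hD i j 0)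
  have sC : ∀ j, C j ≤ ∑ j, C j := fun j =>
    Finset.single_le_sum (f := C) (fun j _ => hC0 j) (Finset.mem_univ j)
  have sD : ∀ i j, D i j ≤ ∑ i, ∑ j, D i j := fun i j =>
    (Finset.single_le_sum (f := fun j => D i j) (fun j _ => hD0 i j) (Finset.mem_univ j)).trans
      (Finset.single_le_sum (f := fun i => ∑ j, D i j)
        (fun i _ => Finset.sum_nonneg fun j _ => hD0 i j) (Finset.mem_univ i))
  have tC : 0 ≤ ∑ j, C j := Finset.sum_nonneg fun j _ => hC0 j
  have tD : 0 ≤ ∑ i, ∑ j, D i j := Finset.sum_nonneg fun i _ => Finset.sum_nonneg fun j _ => hD0 i j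
  refine ⟨1 + ∑ j, C j + ∑ i, ∑ j, D i j, by positivity, fun r hr i j x => ⟨?_, ?_⟩⟩
  · rw [pd_cutoff, abs_mul, abs_of_nonneg (by positivity), mul_comm]
    exact mul_le_mul_of_nonneg_right (((hC j _).trans (sC j)).trans (by linarith)) (by positivity)
  · rw [pd_pd_cutoff, abs_mul, abs_of_nonneg (by positivity), mul_comm]
    exact mul_le_mul_of_nonneg_right (((hD i j _).trans (sD i j)).trans (by linarith))
      (by positivity)

end Cutoff

section Sobolev

lemma norm_sq_fderiv_le (f : E3 → ℝ) (x : E3) : ‖fderiv ℝ f x‖ ^ 2 ≤ ∑ j, pd f j x ^ 2 := by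
  have h : ‖fderiv ℝ f x‖ ≤ Real.sqrt (∑ j, pd f j x ^ 2) := by
    refine ContinuousLinearMap.opNorm_le_bound _ (Real.sqrt_nonneg _) fun y => ?_
    have e : fderiv ℝ f x y = ∑ j, y j * pd f j x := by
      have hy : y = ∑ j, y j • (EuclideanSpace.single j (1 : ℝ) : E3) := by
        simpa using ((EuclideanSpace.basisFun (Fin 3) ℝ).sum_repr y).symm
      conv_lhs => rw [hy]
      rw [map_sum]
      simp only [map_smul, smul_eq_mul]
      rfl
    rw [e, EuclideanSpace.norm_eq, mul_comm, ← Real.sqrt_mul (by positivity), Real.norm_eq_abs]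
    refine Real.abs_le_sqrt ?_
    simp only [Real.norm_eq_abs, sq_abs]
    exact Finset.sum_mul_sq_le_sq_mul_sq _ _ _
  calc _ ≤ Real.sqrt (∑ j, pd f j x ^ 2) ^ 2 := by gcongr
    _ = _ := Real.sq_sqrt (Finset.sum_nonneg fun j _ => sq_nonneg _)

/-- The Sobolev inequality `‖g‖₆ ≤ C ‖∇g‖₂` on `ℝ³`. -/
lemma exists_sobolev : ∃ C : ℝ, 0 < C ∧ ∀ g : E3 → ℝ, ContDiff ℝ ∞ g → HasCompactSupport g →
    ∫ x, g x ^ 6 ≤ C * (∫ x, ∑ j, pd g j x ^ 2) ^ 3 := by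
  set C : ℝ≥0 := SNormLESNormFDerivOfEqConst ℝ (volume : Measure E3) ((2 : ℝ≥0) : ℝ) with hC
  refine ⟨C ^ 6 + 1, by positivity, fun g hg hc => ?_⟩
  have hg1 : ContDiff ℝ 1 g := hg.of_le (by exact_mod_cast le_top)
  have h := eLpNorm_le_eLpNorm_fderiv_of_eq (volume : Measure E3) hg1 hc (p := 2) (p' := 6)
    (by norm_num) (by simp) (by simp; norm_num)
  have hfc : Continuous (fderiv ℝ g) := hg.continuous_fderiv (by simp)
  have m1 : MemLp g (6 : ℝ≥0) := hg.continuous.memLp_of_hasCompactSupport hc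
  have m2 : MemLp (fderiv ℝ g) (2 : ℝ≥0) := hfc.memLp_of_hasCompactSupport (hc.fderiv ℝ)
  have hCe : (C : ℝ≥0∞) = ENNReal.ofReal C := ENNReal.ofReal_coe_nnreal.symm
  rw [m1.eLpNorm_eq_integral_rpow_norm (by simp) (by simp),
    m2.eLpNorm_eq_integral_rpow_norm (by simp) (by simp), ← hC, hCe,
    ← ENNReal.ofReal_mul C.coe_nonneg, ENNReal.ofReal_le_ofReal_iff (by positivity)] at h
  simp only [ENNReal.coe_toReal, NNReal.coe_ofNat, Real.rpow_ofNat] at h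
  have e6 : ∀ x, ‖g x‖ ^ 6 = g x ^ 6 := fun x => by
    rw [Real.norm_eq_abs, Even.pow_abs (by decide)]
  simp only [e6] at h
  set A := ∫ x, g x ^ 6 with hA
  set D := ∫ x, ‖fderiv ℝ g x‖ ^ 2 with hD
  have hA0 : 0 ≤ A := integral_nonneg fun x => by positivity
  have hD0 : 0 ≤ D := integral_nonneg fun x => by positivity
  have hDle : D ≤ ∫ x, ∑ j, pd g j x ^ 2 := by
    refine integral_mono_of_nonneg (Filter.Eventually.of_forall fun x => sq_nonneg _) ?_
      (Filter.Eventually.of_forall fun x => norm_sq_fderiv_le g x)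
    exact integrable_finsetSum _ fun j _ =>
      ((continuous_pd hg j).pow 2).integrable_of_hasCompactSupport
        (hasCompactSupport_sq (hasCompactSupport_pd hc j))
  have h6 := pow_le_pow_left₀ (by positivity) h 6
  have ea : (A ^ (6 : ℝ)⁻¹) ^ 6 = A := by
    rw [← Real.rpow_natCast, ← Real.rpow_mul hA0]; norm_num
  have ed : (D ^ (2 : ℝ)⁻¹) ^ 6 = D ^ 3 := by
    rw [← Real.rpow_natCast, ← Real.rpow_mul hD0, ← Real.rpow_natCast]; norm_num
  rw [ea, mul_pow, ed] at h6
  refine h6.trans (mul_le_mul (by linarith) (pow_le_pow_left₀ hD0 hDle 3) (by positivity)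
    (by positivity))

/-- A local `L⁴` estimate on a ball of radius `r`. -/
lemma exists_integral_pow_four_le : ∃ C : ℝ, 0 < C ∧ ∀ f : E3 → ℝ, ContDiff ℝ ∞ f →
    ∀ r : ℝ, 0 < r → r ^ 3 * ∫ x in closedBall 0 r, f x ^ 4
      ≤ C * ((∫ x in closedBall 0 (2 * r), f x ^ 2)
        + r ^ 2 * ∫ x in closedBall 0 (2 * r), ∑ j, pd f j x ^ 2) ^ 2 := by
  obtain ⟨C₁, hC₁, hsob⟩ := exists_sobolev
  obtain ⟨C₂, hC₂, hcut⟩ := exists_cutoff_bounds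
  refine ⟨1 + C₁ * (2 + 6 * C₂ ^ 2) ^ 3, by positivity, fun f hf r hr => ?_⟩
  have h2r : 0 < 2 * r := by linarith
  obtain ⟨ζ, hζ⟩ : ∃ ζ, ζ = cutoff (2 * r) := ⟨_, rfl⟩
  have ζs : ContDiff ℝ ∞ ζ := hζ ▸ contDiff_cutoff _
  have ζc : HasCompactSupport ζ := hζ ▸ hasCompactSupport_cutoff h2r
  have ζ0 : ∀ x, 0 ≤ ζ x := fun x => hζ ▸ cutoff_nonneg _ x
  have ζ1 : ∀ x, ζ x ≤ 1 := fun x => hζ ▸ cutoff_le_one _ x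
  have ζe : ∀ x ∈ closedBall (0 : E3) r, ζ x = 1 := fun x hx => hζ ▸ cutoff_eq_one h2r (by
    rw [mem_closedBall_zero_iff] at hx; linarith)
  have ζz : ∀ x ∉ closedBall (0 : E3) (2 * r), ζ x = 0 := fun x hx => hζ ▸ cutoff_eq_zero h2r (by
    rw [mem_closedBall_zero_iff] at hx; linarith)
  have ζd : ∀ j x, |pd ζ j x| ≤ C₂ * r⁻¹ := fun j x => by
    refine (hζ ▸ (hcut (2 * r) h2r j j x).1).trans (mul_le_mul_of_nonneg_left ?_ hC₂.le)
    gcongr; linarith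
  have ζdz : ∀ j, ∀ x ∉ closedBall (0 : E3) (2 * r), pd ζ j x = 0 := fun j x hx =>
    hζ ▸ pd_eq_zero_of_norm (fun x => cutoff_eq_zero h2r) j x (by
      rw [mem_closedBall_zero_iff] at hx; linarith)
  clear hζ hcut
  have hBc : IsCompact (closedBall (0 : E3) (2 * r)) := isCompact_closedBall 0 _
  have hBm : MeasurableSet (closedBall (0 : E3) (2 * r)) := isClosed_closedBall.measurableSet
  have ic : ∀ {g : E3 → ℝ}, Continuous g → IntegrableOn g (closedBall 0 (2 * r)) := fun hg =>
    hg.continuousOn.integrableOn_compact hBc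
  set g : E3 → ℝ := fun x => ζ x * f x with hg
  have gs : ContDiff ℝ ∞ g := ζs.mul hf
  have gc : HasCompactSupport g := ζc.mul_right
  set A := ∫ x in closedBall 0 (2 * r), f x ^ 2 with hA
  set D := ∫ x in closedBall 0 (2 * r), ∑ j, pd f j x ^ 2 with hD
  have hA0 : 0 ≤ A := integral_nonneg fun x => sq_nonneg _
  have hD0 : 0 ≤ D := integral_nonneg fun x => Finset.sum_nonneg fun j _ => sq_nonneg _
  set Y := A + r ^ 2 * D with hY
  have hY0 : 0 ≤ Y := by positivity
  have fcont := hf.continuous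
  have dcont := fun j => continuous_pd hf j
  have g2 : ∫ x, g x ^ 2 ≤ A := by
    rw [← setIntegral_eq_integral_of_forall_compl_eq_zero (s := closedBall 0 (2 * r))
      fun x hx => by simp [hg, ζz x hx]]
    refine setIntegral_mono (ic (gs.continuous.pow 2)) (ic (fcont.pow 2)) fun x => ?_
    simp only [hg, mul_pow]
    exact mul_le_of_le_one_left (sq_nonneg _) (pow_le_one₀ (ζ0 x) (ζ1 x))
  have gd : ∫ x, ∑ j, pd g j x ^ 2 ≤ (2 + 6 * C₂ ^ 2) * (r⁻¹ ^ 2 * Y) := by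
    have e : ∀ j x, pd g j x = pd ζ j x * f x + ζ x * pd f j x := fun j x =>
      pd_mul ζs.diffAt hf.diffAt
    rw [← setIntegral_eq_integral_of_forall_compl_eq_zero (s := closedBall 0 (2 * r))
      fun x hx => by simp [e, ζz x hx, ζdz _ x hx]]
    have hpt : ∀ x, ∑ j, pd g j x ^ 2
        ≤ (6 * C₂ ^ 2 * r⁻¹ ^ 2) * f x ^ 2 + 2 * ∑ j, pd f j x ^ 2 := fun x => by
      have hj : ∀ j, pd g j x ^ 2 ≤ (2 * C₂ ^ 2 * r⁻¹ ^ 2) * f x ^ 2 + 2 * pd f j x ^ 2 := by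
        intro j
        have h1 : (pd ζ j x) ^ 2 ≤ (C₂ * r⁻¹) ^ 2 := sq_le_sq.2 ((ζd j x).trans (le_abs_self _))
        have h2 : ζ x ^ 2 ≤ 1 := pow_le_one₀ (ζ0 x) (ζ1 x)
        have h3 := mul_le_mul_of_nonneg_right h1 (sq_nonneg (f x))
        have h4 := mul_le_mul_of_nonneg_right h2 (sq_nonneg (pd f j x))
        rw [e]
        nlinarith [sq_nonneg (pd ζ j x * f x - ζ x * pd f j x)]
      simp only [Fin.sum_univ_three]
      linarith [hj 0, hj 1, hj 2]
    have i1 : IntegrableOn (fun x => (6 * C₂ ^ 2 * r⁻¹ ^ 2) * f x ^ 2) (closedBall 0 (2 * r)) :=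
      ic (by fun_prop)
    have i2 : IntegrableOn (fun x => 2 * ∑ j, pd f j x ^ 2) (closedBall 0 (2 * r)) :=
      ic (by fun_prop)
    calc ∫ x in closedBall 0 (2 * r), ∑ j, pd g j x ^ 2
        ≤ ∫ x in closedBall 0 (2 * r),
          ((6 * C₂ ^ 2 * r⁻¹ ^ 2) * f x ^ 2 + 2 * ∑ j, pd f j x ^ 2) :=
          setIntegral_mono (ic (continuous_finsetSum _ fun j _ => (continuous_pd gs j).pow 2))
            (i1.add i2) hpt
      _ = (6 * C₂ ^ 2) * (r⁻¹ ^ 2 * A) + 2 * D := by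
          rw [integral_add i1 i2, integral_const_mul, integral_const_mul]; ring
      _ ≤ (2 + 6 * C₂ ^ 2) * (r⁻¹ ^ 2 * Y) := by
          have e : r⁻¹ ^ 2 * Y = r⁻¹ ^ 2 * A + D := by
            rw [hY]; field_simp
          rw [e]
          nlinarith [mul_nonneg (sq_nonneg r⁻¹) hA0, mul_nonneg (sq_nonneg C₂) hD0]
  have g6 : ∫ x, g x ^ 6 ≤ C₁ * ((2 + 6 * C₂ ^ 2) * (r⁻¹ ^ 2 * Y)) ^ 3 :=
    (hsob g gs gc).trans (mul_le_mul_of_nonneg_left (pow_le_pow_left₀ (integral_nonneg fun x =>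
      Finset.sum_nonneg fun j _ => sq_nonneg _) gd 3) hC₁.le)
  have ig : ∀ n : ℕ, n ≠ 0 → Integrable fun x => g x ^ n := fun n hn =>
    (gs.continuous.pow n).integrable_of_hasCompactSupport
      (gc.comp_left (g := fun y : ℝ => y ^ n) (by simp [hn]))
  have cs := sq_integral_mul_le (f := g) (g := fun x => g x ^ 3) (μ := volume) (ig 2 (by norm_num))
    (by simpa only [← pow_mul] using ig 6 (by norm_num))
    (by simpa only [← pow_succ'] using ig 4 (by norm_num))
  simp only [← pow_mul, ← pow_succ'] at cs
  norm_num at cs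
  have f4 : ∫ x in closedBall 0 r, f x ^ 4 ≤ ∫ x, g x ^ 4 := by
    rw [setIntegral_congr_fun (g := fun x => g x ^ 4) isClosed_closedBall.measurableSet
      fun x hx => by simp [hg, ζe x hx]]
    exact setIntegral_le_integral (ig 4 (by norm_num))
      (Filter.Eventually.of_forall fun x => by positivity)
  have hg40 : 0 ≤ ∫ x, g x ^ 4 := integral_nonneg fun x => by positivity
  have hg60 : 0 ≤ ∫ x, g x ^ 6 := integral_nonneg fun x => by positivity
  have hAY : A ≤ Y := le_add_of_nonneg_right (by positivity)
  set κ := C₁ * (2 + 6 * C₂ ^ 2) ^ 3 with hκ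
  have hκ0 : 0 ≤ κ := by positivity
  have fin : (r ^ 3 * ∫ x, g x ^ 4) ^ 2 ≤ ((1 + κ) * Y ^ 2) ^ 2 := by
    calc (r ^ 3 * ∫ x, g x ^ 4) ^ 2 = r ^ 6 * (∫ x, g x ^ 4) ^ 2 := by ring
      _ ≤ r ^ 6 * (Y * (C₁ * ((2 + 6 * C₂ ^ 2) * (r⁻¹ ^ 2 * Y)) ^ 3)) :=
          mul_le_mul_of_nonneg_left (cs.trans (mul_le_mul (g2.trans hAY) g6 hg60 hY0))
            (by positivity)
      _ = κ * Y ^ 4 := by rw [hκ]; field_simp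
      _ ≤ ((1 + κ) * Y ^ 2) ^ 2 := by
          have : 0 ≤ Y ^ 4 := by positivity
          nlinarith
  have := abs_le_of_sq_le_sq' fin (by positivity)
  exact (mul_le_mul_of_nonneg_left f4 (by positivity)).trans this.2

end Sobolev

section FixedTime

/-- `|v|²` for a vector field given by its components. -/
def vsq (v : Fin 3 → E3 → ℝ) (x : E3) : ℝ := ∑ i, v i x ^ 2

/-- `|∇v|²` for a vector field given by its components. -/
def gsq (v : Fin 3 → E3 → ℝ) (x : E3) : ℝ := ∑ i, ∑ j, pd (v i) j x ^ 2

lemma vsq_nonneg (v : Fin 3 → E3 → ℝ) (x : E3) : 0 ≤ vsq v x :=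
  Finset.sum_nonneg fun _ _ => sq_nonneg _

lemma gsq_nonneg (v : Fin 3 → E3 → ℝ) (x : E3) : 0 ≤ gsq v x :=
  Finset.sum_nonneg fun _ _ => Finset.sum_nonneg fun _ _ => sq_nonneg _

lemma continuous_vsq {v : Fin 3 → E3 → ℝ} (hv : ∀ i, ContDiff ℝ ∞ (v i)) : Continuous (vsq v) :=
  continuous_finsetSum _ fun i _ => (hv i).continuous.pow 2

lemma continuous_gsq {v : Fin 3 → E3 → ℝ} (hv : ∀ i, ContDiff ℝ ∞ (v i)) : Continuous (gsq v) :=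
  continuous_finsetSum _ fun i _ => continuous_finsetSum _ fun j _ => (continuous_pd (hv i) j).pow 2

lemma integrableOn_closedBall {f : E3 → ℝ} (hf : Continuous f) (r : ℝ) :
    IntegrableOn f (closedBall 0 r) :=
  hf.continuousOn.integrableOn_compact (isCompact_closedBall 0 r)

lemma setIntegral_closedBall_mono {f : E3 → ℝ} (hf : Continuous f) (h0 : ∀ x, 0 ≤ f x) {r s : ℝ}
    (hrs : r ≤ s) : ∫ x in closedBall 0 r, f x ≤ ∫ x in closedBall 0 s, f x :=
  setIntegral_mono_set (integrableOn_closedBall hf s) (Filter.Eventually.of_forall h0)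
    (closedBall_subset_closedBall hrs).eventuallyLE

lemma setIntegral_mul_le {f g : E3 → ℝ} (hf : Continuous f) (hg : Continuous g) {r α β c : ℝ}
    (hα : ∫ x in closedBall 0 r, f x ^ 2 ≤ α) (hβ : ∫ x in closedBall 0 r, g x ^ 2 ≤ β)
    (hc : 0 ≤ c) (h : α * β ≤ c ^ 2) : ∫ x in closedBall 0 r, f x * g x ≤ c := by
  have h1 := sq_integral_mul_le (integrableOn_closedBall (hf.pow 2) r)
    (integrableOn_closedBall (hg.pow 2) r) (integrableOn_closedBall (hf.mul hg) r)
  have h2 : (0 : ℝ) ≤ ∫ x in closedBall 0 r, f x ^ 2 := integral_nonneg fun x => sq_nonneg _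
  have h3 : (0 : ℝ) ≤ ∫ x in closedBall 0 r, g x ^ 2 := integral_nonneg fun x => sq_nonneg _
  exact (abs_le_of_sq_le_sq' ((h1.trans (mul_le_mul hα hβ h3 (h2.trans hα))).trans h) hc).2

lemma exists_integral_vsq_sq_le : ∃ C : ℝ, 0 < C ∧ ∀ v : Fin 3 → E3 → ℝ,
    (∀ i, ContDiff ℝ ∞ (v i)) → ∀ r : ℝ, 0 < r → r ^ 3 * ∫ x in closedBall 0 r, vsq v x ^ 2
      ≤ C * ((∫ x in closedBall 0 (2 * r), vsq v x)
        + r ^ 2 * ∫ x in closedBall 0 (2 * r), gsq v x) ^ 2 := by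
  obtain ⟨C, hC, h⟩ := exists_integral_pow_four_le
  refine ⟨9 * C, by positivity, fun v hv r hr => ?_⟩
  have cv := fun i => (hv i).continuous
  have cd := fun i j => continuous_pd (hv i) j
  have i4 : ∀ i, IntegrableOn (fun x => v i x ^ 4) (closedBall 0 r) := fun i =>
    integrableOn_closedBall ((cv i).pow 4) r
  have h1 : ∫ x in closedBall 0 r, vsq v x ^ 2 ≤ 3 * ∑ i, ∫ x in closedBall 0 r, v i x ^ 4 := by
    rw [← integral_finsetSum _ fun i _ => i4 i, ← integral_const_mul]
    refine setIntegral_mono (integrableOn_closedBall ((continuous_vsq hv).pow 2) r)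
      ((integrable_finsetSum _ fun i _ => i4 i).const_mul 3) fun x => ?_
    have := sq_sum_le_card_mul_sum_sq (s := (Finset.univ : Finset (Fin 3)))
      (f := fun i => v i x ^ 2)
    simp only [Finset.card_univ, Fintype.card_fin, Nat.cast_ofNat, ← pow_mul] at this
    exact this
  have h2 : ∀ i, r ^ 3 * ∫ x in closedBall 0 r, v i x ^ 4
      ≤ C * ((∫ x in closedBall 0 (2 * r), vsq v x)
        + r ^ 2 * ∫ x in closedBall 0 (2 * r), gsq v x) ^ 2 := fun i => by
    refine (h (v i) (hv i) r hr).trans (mul_le_mul_of_nonneg_left ?_ hC.le)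
    have a1 : ∫ x in closedBall 0 (2 * r), v i x ^ 2 ≤ ∫ x in closedBall 0 (2 * r), vsq v x :=
      setIntegral_mono (integrableOn_closedBall ((cv i).pow 2) _)
        (integrableOn_closedBall (continuous_vsq hv) _) fun x =>
          Finset.single_le_sum (f := fun i => v i x ^ 2) (fun i _ => sq_nonneg _)
            (Finset.mem_univ i)
    have a2 : ∫ x in closedBall 0 (2 * r), ∑ j, pd (v i) j x ^ 2
        ≤ ∫ x in closedBall 0 (2 * r), gsq v x :=
      setIntegral_mono (integrableOn_closedBall
          (continuous_finsetSum _ fun j _ => (cd i j).pow 2) _)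
        (integrableOn_closedBall (continuous_gsq hv) _) fun x =>
          Finset.single_le_sum (f := fun i => ∑ j, pd (v i) j x ^ 2)
            (fun i _ => Finset.sum_nonneg fun j _ => sq_nonneg _) (Finset.mem_univ i)
    have a3 : (0 : ℝ) ≤ ∫ x in closedBall 0 (2 * r), v i x ^ 2 :=
      integral_nonneg fun x => sq_nonneg _
    have a4 : (0 : ℝ) ≤ ∫ x in closedBall 0 (2 * r), ∑ j, pd (v i) j x ^ 2 :=
      integral_nonneg fun x => Finset.sum_nonneg fun j _ => sq_nonneg _
    gcongr
  have h3 := mul_le_mul_of_nonneg_left h1 (show 0 ≤ r ^ 3 by positivity)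
  refine h3.trans ?_
  rw [Fin.sum_univ_three]
  linarith [h2 0, h2 1, h2 2]

lemma volume_real_closedBall {r : ℝ} (hr : 0 ≤ r) :
    volume.real (closedBall (0 : E3) r) = r ^ 3 * volume.real (closedBall (0 : E3) 1) := by
  rw [Measure.addHaar_real_closedBall _ _ hr, Measure.addHaar_real_closedBall _ _ zero_le_one]
  simp

lemma mul_sq_le {a b : ℝ} (h : a ≤ b ^ 2) (x : ℝ) : a * x ^ 2 ≤ (b * x) ^ 2 := by
  rw [mul_pow]
  exact mul_le_mul_of_nonneg_right h (sq_nonneg x)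

set_option maxHeartbeats 1000000 in
/-- Bound of the cubic and pressure terms of the local energy balance at one dyadic scale. -/
lemma exists_flux_bound : ∃ C : ℝ, 0 < C ∧ ∀ (v : Fin 3 → E3 → ℝ) (P ψ : E3 → ℝ) (M D : ℝ) (k : ℕ),
    (∀ i, ContDiff ℝ ∞ (v i)) → Continuous P → IsWeakPressure P (fun i j x => v i x * v j x) →
    (∀ x ∈ closedBall (0 : E3) (1 / 2), ∑ i, pd (v i) i x = 0) → 3 ≤ k → 0 ≤ M →
    (∀ j, 1 ≤ j → j ≤ k → ∫ x in closedBall 0 ((1 / 2) ^ j), vsq v x ≤ M ^ 2 * (1 / 8) ^ j) →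
    ContDiff ℝ ∞ ψ → (∀ x, (1 / 2) ^ k ≤ ‖x‖ → ψ x = 0) → 0 ≤ D →
    (∀ j x, |pd ψ j x| ≤ D * 16 ^ k) →
    |∫ x, (vsq v x + 2 * P x) * ∑ j, v j x * pd ψ j x|
      ≤ C * D * M * (M ^ 2 * 2 ^ k + 4 ^ k * (∫ x in closedBall 0 (4 * (1 / 2) ^ k), gsq v x)
        + ∫ x in closedBall 0 1, |P x|) := by
  obtain ⟨C₁, hC₁, hpress⟩ := exists_pressure_decomposition
  obtain ⟨C₂, hC₂, hsob⟩ := exists_integral_vsq_sq_le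
  set V := volume.real (closedBall (0 : E3) 1) with hV
  have hV0 : 0 ≤ V := measureReal_nonneg
  refine ⟨3 * (64 * (C₂ + 1) * (2 * C₁ + 3) + 256 * C₁ * (V + 1)), by positivity,
    fun v P ψ M D k hv hP hw hdiv hk hM hA hψ hψ0 hD hψd => ?_⟩
  have hvs := continuous_vsq hv
  obtain ⟨Q, c, hQ, hPQ, hQc⟩ := hpress P (fun i j x => v i x * v j x) (vsq v) hw hP
    (fun i j => (hv i).continuous.mul (hv j).continuous) hvs (fun i j x => by
      have h1 : v i x ^ 2 ≤ vsq v x := Finset.single_le_sum (f := fun i => v i x ^ 2)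
        (fun i _ => sq_nonneg _) (Finset.mem_univ i)
      have h2 : v j x ^ 2 ≤ vsq v x := Finset.single_le_sum (f := fun i => v i x ^ 2)
        (fun i _ => sq_nonneg _) (Finset.mem_univ j)
      rw [abs_le]
      constructor <;> nlinarith [sq_nonneg (v i x + v j x), sq_nonneg (v i x - v j x)]) k hk
  obtain ⟨ρ, hρ⟩ : ∃ ρ : ℝ, ρ = (1 / 2) ^ k := ⟨_, rfl⟩
  have hρ0 : 0 < ρ := hρ ▸ by positivity
  have e2 : (2 : ℝ) ^ k = ρ⁻¹ := by rw [hρ, ← inv_pow]; norm_num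
  have e4 : (4 : ℝ) ^ k = ρ⁻¹ ^ 2 := by rw [← e2, ← pow_mul, mul_comm, pow_mul]; norm_num
  have e16 : (16 : ℝ) ^ k = ρ⁻¹ ^ 4 := by rw [← e2, ← pow_mul, mul_comm, pow_mul]; norm_num
  have e8 : ((1 : ℝ) / 8) ^ k = ρ ^ 3 := by
    rw [hρ, ← pow_mul, mul_comm, pow_mul]; norm_num
  have hAk := hA k (by omega) le_rfl
  have hA4 : ∀ j, 3 ≤ j → j ≤ k →
      ∫ x in closedBall 0 (4 * (1 / 2) ^ j), vsq v x ≤ 64 * M ^ 2 * (1 / 8) ^ j := by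
    intro j hj hjk
    obtain ⟨i, rfl⟩ : ∃ i, j = i + 2 := ⟨j - 2, by omega⟩
    have := hA i (by omega) (by omega)
    rw [show (4 : ℝ) * (1 / 2) ^ (i + 2) = (1 / 2) ^ i by ring]
    refine this.trans (le_of_eq (by ring))
  have hA4k := hA4 k hk le_rfl
  rw [e8] at hAk hA4k
  have hsum : (∑ j ∈ Finset.Icc 3 k, 16 ^ j * ∫ y in closedBall 0 (4 * (1 / 2) ^ j), vsq v y)
      ≤ 128 * M ^ 2 * ρ⁻¹ := by
    have hg : ∀ m, ∑ j ∈ Finset.Icc 3 m, (2 : ℝ) ^ j ≤ 2 * 2 ^ m := fun m => by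
      induction m with
      | zero => simp
      | succ m ih =>
        by_cases hm : 3 ≤ m + 1
        · rw [Finset.sum_Icc_succ_top hm, pow_succ]; linarith
        · rw [Finset.Icc_eq_empty (by omega)]; simp
    calc _ ≤ ∑ j ∈ Finset.Icc 3 k, 64 * M ^ 2 * 2 ^ j := by
          refine Finset.sum_le_sum fun j hj => ?_
          rw [Finset.mem_Icc] at hj
          calc (16 : ℝ) ^ j * _ ≤ 16 ^ j * (64 * M ^ 2 * (1 / 8) ^ j) :=
                mul_le_mul_of_nonneg_left (hA4 j hj.1 hj.2) (by positivity)
            _ = 64 * M ^ 2 * (16 * (1 / 8)) ^ j := by rw [mul_pow]; ring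
            _ = _ := by norm_num
      _ ≤ 64 * M ^ 2 * (2 * 2 ^ k) := by
          rw [← Finset.mul_sum]
          exact mul_le_mul_of_nonneg_left (hg k) (by positivity)
      _ = _ := by rw [e2]; ring
  rw [← hρ] at hAk hA4k hPQ hQc hψ0
  rw [e16] at hψd
  rw [e2, e4, ← hρ]
  have hρ2 : ρ ≤ 1 / 8 := by
    rw [hρ]
    calc ((1 : ℝ) / 2) ^ k ≤ (1 / 2) ^ 3 := pow_le_pow_of_le_one (by norm_num) (by norm_num) hk
      _ = 1 / 8 := by norm_num
  clear hA hA4 hρ e2 e4 e16 e8 hw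
  set π := ∫ x in closedBall (0 : E3) 1, |P x| with hπ
  have hπ0 : 0 ≤ π := integral_nonneg fun x => abs_nonneg _
  set G := ∫ x in closedBall 0 (4 * ρ), gsq v x with hG
  have hG0 : 0 ≤ G := integral_nonneg fun x => gsq_nonneg v x
  have hψc : HasCompactSupport ψ := hasCompactSupport_of_norm hψ0
  have cψ := fun j => continuous_pd hψ j
  have cv := fun j => (hv j).continuous
  have cF : Continuous fun x => ∑ j, v j x * pd ψ j x :=
    continuous_finsetSum _ fun j _ => (cv j).mul (cψ j)
  have cFs : HasCompactSupport fun x => ∑ j, v j x * pd ψ j x :=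
    hasCompactSupport_sum _ fun j _ => (hasCompactSupport_pd hψc j).mul_left
  have hzero : ∫ x, ∑ j, v j x * pd ψ j x = 0 := by
    have ii : ∀ j ∈ (Finset.univ : Finset (Fin 3)), Integrable (fun x => v j x * pd ψ j x) :=
      fun j _ => ((cv j).mul (cψ j)).integrable_of_hasCompactSupport
        (hasCompactSupport_pd hψc j).mul_left
    have ij : ∀ j ∈ (Finset.univ : Finset (Fin 3)), Integrable (fun x => pd (v j) j x * ψ x) :=
      fun j _ => ((continuous_pd (hv j) j).mul hψ.continuous).integrable_of_hasCompactSupport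
        hψc.mul_left
    rw [integral_finsetSum _ ii, Finset.sum_congr rfl fun j _ => integral_pd_mul (hv j) hψ hψc j,
      Finset.sum_neg_distrib, ← integral_finsetSum _ ij, neg_eq_zero]
    refine integral_eq_zero_of_ae (Filter.Eventually.of_forall fun x => ?_)
    simp only [← Finset.sum_mul, Pi.zero_apply]
    by_cases hx : ‖x‖ ≤ 1 / 2
    · rw [hdiv x (by simpa using hx), zero_mul]
    · rw [hψ0 x (by linarith), mul_zero]
  have hshift : ∫ x, (vsq v x + 2 * P x) * ∑ j, v j x * pd ψ j x
      = ∫ x in closedBall 0 ρ, (vsq v x + 2 * P x - 2 * c) * ∑ j, v j x * pd ψ j x := by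
    rw [setIntegral_eq_integral_of_forall_compl_eq_zero]
    · have e : ∀ x, (vsq v x + 2 * P x - 2 * c) * ∑ j, v j x * pd ψ j x
          = (vsq v x + 2 * P x) * (∑ j, v j x * pd ψ j x)
            - 2 * c * ∑ j, v j x * pd ψ j x := fun x => by ring
      simp only [e]
      rw [integral_sub, integral_const_mul (2 * c), hzero, mul_zero, sub_zero]
      · exact ((hvs.add (hP.const_mul 2)).mul cF).integrable_of_hasCompactSupport cFs.mul_left
      · exact (cF.integrable_of_hasCompactSupport cFs).const_mul (2 * c)
    · intro x hx
      have hx' : ρ < ‖x‖ := by simpa using hx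
      rw [Finset.sum_eq_zero fun j _ => by rw [pd_eq_zero_of_norm hψ0 j x hx', mul_zero], mul_zero]
  set s : E3 → ℝ := fun x => Real.sqrt (vsq v x) with hs
  have cs : Continuous s := Real.continuous_sqrt.comp hvs
  have hs2 : ∀ x, s x ^ 2 = vsq v x := fun x => Real.sq_sqrt (vsq_nonneg v x)
  have hs0 : ∀ x, 0 ≤ s x := fun x => Real.sqrt_nonneg _
  have hvj : ∀ j x, |v j x| ≤ s x := fun j x => Real.abs_le_sqrt
    (Finset.single_le_sum (f := fun i => v i x ^ 2) (fun i _ => sq_nonneg _) (Finset.mem_univ j))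
  obtain ⟨R, hR⟩ : ∃ R, R = C₁ * ρ * (128 * M ^ 2 * ρ⁻¹ + π) := ⟨_, rfl⟩
  have hR0 : 0 ≤ R := hR ▸ by positivity
  have hQR : ∀ x ∈ closedBall (0 : E3) ρ, |Q x - c| ≤ R := fun x hx => (hQc x hx).trans
    (hR ▸ mul_le_mul_of_nonneg_left (add_le_add_left hsum π) (by positivity))
  have hpt : ∀ x ∈ closedBall (0 : E3) ρ,
      ‖(vsq v x + 2 * P x - 2 * c) * ∑ j, v j x * pd ψ j x‖
        ≤ 3 * D * ρ⁻¹ ^ 4 * (vsq v x * s x + 2 * (|P x - Q x| * s x) + 2 * R * s x) := by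
    intro x hx
    have h1 : |∑ j, v j x * pd ψ j x| ≤ 3 * (s x * (D * ρ⁻¹ ^ 4)) := by
      refine (Finset.abs_sum_le_sum_abs _ _).trans ?_
      refine (Finset.sum_le_sum fun j _ => ?_).trans_eq
        (b := ∑ j : Fin 3, s x * (D * ρ⁻¹ ^ 4)) (by simp)
      rw [abs_mul]
      exact mul_le_mul (hvj j x) (hψd j x) (abs_nonneg _) (hs0 x)
    have h2 : |vsq v x + 2 * P x - 2 * c| ≤ vsq v x + 2 * |P x - Q x| + 2 * R := by
      have := hQR x hx
      have h3 := vsq_nonneg v x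
      rw [abs_le] at this ⊢
      have h4 := neg_abs_le (P x - Q x)
      have h5 := le_abs_self (P x - Q x)
      constructor <;> linarith
    rw [Real.norm_eq_abs, abs_mul]
    refine (mul_le_mul h2 h1 (abs_nonneg _) ((abs_nonneg _).trans h2)).trans_eq ?_
    ring
  obtain ⟨Y, hY⟩ : ∃ Y, Y = 64 * M ^ 2 * ρ ^ 3 + 4 * ρ ^ 2 * G := ⟨_, rfl⟩
  have hY0 : 0 ≤ Y := hY ▸ by positivity
  have hβ : ∫ x in closedBall 0 ρ, s x ^ 2 ≤ M ^ 2 * ρ ^ 3 := by simp only [hs2]; exact hAk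
  have hα2 : ∫ x in closedBall 0 (2 * ρ), vsq v x ^ 2 ≤ C₂ * Y ^ 2 / (8 * ρ ^ 3) := by
    have h := hsob v hv (2 * ρ) (by positivity)
    rw [show 2 * (2 * ρ) = 4 * ρ by ring, ← hG] at h
    rw [le_div_iff₀ (by positivity)]
    have h0 : (0 : ℝ) ≤ ∫ x in closedBall 0 (4 * ρ), vsq v x :=
      integral_nonneg fun x => vsq_nonneg v x
    have h1 : (∫ x in closedBall 0 (4 * ρ), vsq v x) + (2 * ρ) ^ 2 * G ≤ Y := by
      rw [hY]; linarith
    have h2 := mul_le_mul_of_nonneg_left (pow_le_pow_left₀ (by positivity) h1 2) hC₂.le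
    linarith
  have hα : ∫ x in closedBall 0 ρ, vsq v x ^ 2 ≤ C₂ * Y ^ 2 / (8 * ρ ^ 3) :=
    (setIntegral_closedBall_mono (hvs.pow 2) (fun x => sq_nonneg _) (by linarith)).trans hα2
  have ha : ∫ x in closedBall 0 ρ, vsq v x * s x ≤ (C₂ + 1) * Y * M := by
    refine setIntegral_mul_le hvs cs hα hβ (by positivity) ?_
    rw [show C₂ * Y ^ 2 / (8 * ρ ^ 3) * (M ^ 2 * ρ ^ 3) = C₂ / 8 * (Y * M) ^ 2 by field_simp,
      mul_assoc (C₂ + 1)]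
    exact mul_sq_le (by nlinarith) _
  have hb : ∫ x in closedBall 0 ρ, |P x - Q x| * s x ≤ (C₁ + 1) * (C₂ + 1) * Y * M := by
    refine setIntegral_mul_le (hP.sub hQ).abs cs (α := C₁ * (C₂ * Y ^ 2 / (8 * ρ ^ 3))) ?_ hβ
      (by positivity) ?_
    · simp only [sq_abs]
      exact hPQ.trans (mul_le_mul_of_nonneg_left hα2 hC₁.le)
    · rw [show C₁ * (C₂ * Y ^ 2 / (8 * ρ ^ 3)) * (M ^ 2 * ρ ^ 3) = C₁ * C₂ / 8 * (Y * M) ^ 2 by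
        field_simp, mul_assoc _ Y]
      refine mul_sq_le ?_ _
      have h1 : 0 < C₁ * C₂ := by positivity
      have h2 : C₁ * C₂ + 1 ≤ (C₁ + 1) * (C₂ + 1) := by nlinarith
      nlinarith
  have hc : ∫ x in closedBall 0 ρ, s x ≤ (V + 1) * M * ρ ^ 3 := by
    have := setIntegral_mul_le continuous_const cs (f := fun _ => (1 : ℝ)) (α := ρ ^ 3 * V)
      (c := (V + 1) * M * ρ ^ 3) (by simp [volume_real_closedBall hρ0.le, hV]) hβ (by positivity)
      (by
        rw [show ρ ^ 3 * V * (M ^ 2 * ρ ^ 3) = V * (M * ρ ^ 3) ^ 2 by ring, mul_assoc (V + 1)]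
        exact mul_sq_le (by nlinarith) _)
    simpa using this
  have i1 : IntegrableOn (fun x => vsq v x * s x) (closedBall 0 ρ) :=
    integrableOn_closedBall (hvs.mul cs) ρ
  have i2 : IntegrableOn (fun x => 2 * (|P x - Q x| * s x)) (closedBall 0 ρ) :=
    integrableOn_closedBall (((hP.sub hQ).abs.mul cs).const_mul 2) ρ
  have i12 : IntegrableOn (fun x => vsq v x * s x + 2 * (|P x - Q x| * s x)) (closedBall 0 ρ) :=
    i1.add i2
  have i3 : IntegrableOn (fun x => 2 * R * s x) (closedBall 0 ρ) :=
    integrableOn_closedBall (cs.const_mul (2 * R)) ρ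
  have hfin := norm_integral_le_of_norm_le ((i12.add i3).const_mul (3 * D * ρ⁻¹ ^ 4))
    ((ae_restrict_iff' isClosed_closedBall.measurableSet).2 (Filter.Eventually.of_forall hpt))
  rw [integral_const_mul] at hfin
  simp only [Pi.add_apply] at hfin
  rw [integral_add i12 i3, integral_add i1 i2, integral_const_mul, integral_const_mul] at hfin
  rw [hshift]
  refine hfin.trans ?_
  have hsc : 2 * R * ∫ x in closedBall 0 ρ, s x ≤ 2 * R * ((V + 1) * M * ρ ^ 3) :=
    mul_le_mul_of_nonneg_left hc (by positivity)
  have hD3 : 0 ≤ 3 * D * ρ⁻¹ ^ 4 := by positivity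
  refine (mul_le_mul_of_nonneg_left (add_le_add (add_le_add ha
    (mul_le_mul_of_nonneg_left hb zero_le_two)) hsc) hD3).trans ?_
  have key : 3 * D * ρ⁻¹ ^ 4 * ((C₂ + 1) * Y * M + 2 * ((C₁ + 1) * (C₂ + 1) * Y * M)
        + 2 * R * ((V + 1) * M * ρ ^ 3))
      = 3 * D * M * (64 * (C₂ + 1) * (2 * C₁ + 3) * (M ^ 2 * ρ⁻¹ + ρ⁻¹ ^ 2 * G / 16)
        + 256 * C₁ * (V + 1) * (M ^ 2 * ρ⁻¹ + π / 128)) := by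
    rw [hY, hR]
    field_simp
    ring
  rw [key]
  have hM2 : 0 ≤ M ^ 2 * ρ⁻¹ := by positivity
  have hG2 : 0 ≤ ρ⁻¹ ^ 2 * G := by positivity
  have k1 : 64 * (C₂ + 1) * (2 * C₁ + 3) * (M ^ 2 * ρ⁻¹ + ρ⁻¹ ^ 2 * G / 16)
      ≤ 64 * (C₂ + 1) * (2 * C₁ + 3) * (M ^ 2 * ρ⁻¹ + ρ⁻¹ ^ 2 * G + π) :=
    mul_le_mul_of_nonneg_left (by linarith) (by positivity)
  have k2 : 256 * C₁ * (V + 1) * (M ^ 2 * ρ⁻¹ + π / 128)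
      ≤ 256 * C₁ * (V + 1) * (M ^ 2 * ρ⁻¹ + ρ⁻¹ ^ 2 * G + π) :=
    mul_le_mul_of_nonneg_left (by linarith) (by positivity)
  refine (mul_le_mul_of_nonneg_left (add_le_add k1 k2)
    (show 0 ≤ 3 * D * M by positivity)).trans_eq ?_
  ring

end FixedTime

section Heat

/-- The Gaussian with width `b⁻¹`, normalised (up to a constant) to have integral one. -/
def gauss (b : ℝ) (x : E3) : ℝ := b ^ 3 * Real.exp (-(b ^ 2 / 4 * ‖x‖ ^ 2))

lemma gauss_nonneg {b : ℝ} (hb : 0 ≤ b) (x : E3) : 0 ≤ gauss b x := by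
  unfold gauss; positivity

lemma contDiff_gauss (b : ℝ) : ContDiff ℝ ∞ (gauss b) :=
  contDiff_const.mul (contDiff_const.mul (contDiff_norm_sq ℝ)).neg.exp

lemma hasDerivAt_gauss_profile (b q : ℝ) :
    HasDerivAt (fun q => b ^ 3 * Real.exp (-(b ^ 2 / 4 * q)))
      (-(b ^ 2 / 4) * (b ^ 3 * Real.exp (-(b ^ 2 / 4 * q)))) q := by
  have h := ((((hasDerivAt_id q).const_mul (b ^ 2 / 4)).fun_neg).exp).const_mul (b ^ 3)
  refine h.congr_deriv ?_
  simp only [id]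
  ring

lemma pd_gauss (b : ℝ) (j : Fin 3) (x : E3) :
    pd (gauss b) j x = -(b ^ 2 / 2 * x j) * gauss b x := by
  have := pd_comp_norm_sq (x := x) (hasDerivAt_gauss_profile b (‖x‖ ^ 2)) j
  refine this.trans ?_
  unfold gauss
  ring

lemma laplacian_gauss (b : ℝ) (x : E3) :
    ∑ j, pd (pd (gauss b) j) j x = (b ^ 4 / 4 * ‖x‖ ^ 2 - 3 / 2 * b ^ 2) * gauss b x := by
  have h : ∀ j, pd (pd (gauss b) j) j x = (b ^ 4 / 4 * x j ^ 2 - b ^ 2 / 2) * gauss b x := by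
    intro j
    have e : pd (gauss b) j = fun x => (-(b ^ 2 / 2) * x j) * gauss b x := by
      funext x; rw [pd_gauss]; ring
    have hc : DifferentiableAt ℝ (fun x : E3 => x j) x := (contDiff_coord j).diffAt
    rw [e, pd_mul (hc.const_mul _) (contDiff_gauss b).diffAt, pd_const_mul _ hc, pd_gauss, pd_coord]
    ring
  simp only [h]
  rw [EuclideanSpace.real_norm_sq_eq, Fin.sum_univ_three, Fin.sum_univ_three]
  ring

lemma pow_mul_exp_le {y : ℝ} (hy : 0 ≤ y) {m : ℕ} (hm : m ≤ 6) :
    y ^ m * Real.exp (-(y ^ 2 / 4)) ≤ 385 := by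
  have h1 : y ^ m ≤ 1 + y ^ 6 := by
    rcases le_total y 1 with h | h
    · exact (pow_le_one₀ hy h).trans (by linarith [pow_nonneg hy 6])
    · exact (pow_le_pow_right₀ h hm).trans (by linarith)
  have h2 := Real.pow_div_factorial_le_exp (y ^ 2 / 4) (by positivity) 3
  have h3 := Real.one_le_exp (show 0 ≤ y ^ 2 / 4 by positivity)
  rw [Real.exp_neg, ← div_eq_mul_inv, div_le_iff₀ (Real.exp_pos _)]
  norm_num [Nat.factorial] at h2
  nlinarith

lemma pow_mul_gauss_le {b ρ : ℝ} (hb : 0 ≤ b) (hρ : 0 < ρ) {x : E3} (h : ρ * b ≤ 4 ∨ ρ ≤ 4 * ‖x‖)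
    {m l : ℕ} (hml : m + l ≤ 6) :
    b ^ m * (‖x‖ * b) ^ l * Real.exp (-(b ^ 2 / 4 * ‖x‖ ^ 2)) ≤ 385 * 4 ^ m * ρ⁻¹ ^ m := by
  have hy : 0 ≤ ‖x‖ * b := by positivity
  have e : Real.exp (-(b ^ 2 / 4 * ‖x‖ ^ 2)) = Real.exp (-((‖x‖ * b) ^ 2 / 4)) := by
    congr 1; ring
  rw [e]
  rcases h with h | h
  · have h1 : b ^ m ≤ 4 ^ m * ρ⁻¹ ^ m := by
      rw [← mul_pow]
      refine pow_le_pow_left₀ hb ?_ m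
      rw [← div_eq_mul_inv, le_div_iff₀ hρ]; linarith
    have h2 := pow_mul_exp_le hy (m := l) (by omega)
    calc _ = b ^ m * ((‖x‖ * b) ^ l * Real.exp (-((‖x‖ * b) ^ 2 / 4))) := by ring
      _ ≤ (4 ^ m * ρ⁻¹ ^ m) * 385 := by gcongr
      _ = _ := by ring
  · have hx : 0 < ‖x‖ := by linarith
    have h1 : ‖x‖⁻¹ ^ m ≤ 4 ^ m * ρ⁻¹ ^ m := by
      rw [← mul_pow]
      refine pow_le_pow_left₀ (by positivity) ?_ m
      rw [inv_le_comm₀ hx (by positivity), mul_inv, inv_inv]; linarith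
    have h2 := pow_mul_exp_le hy hml
    calc _ = ‖x‖⁻¹ ^ m * ((‖x‖ * b) ^ (m + l) * Real.exp (-((‖x‖ * b) ^ 2 / 4))) := by
          rw [pow_add, mul_pow _ _ m]
          have : ‖x‖⁻¹ ^ m * ‖x‖ ^ m = 1 := by rw [← mul_pow, inv_mul_cancel₀ hx.ne', one_pow]
          linear_combination (-(b ^ m * (‖x‖ * b) ^ l * Real.exp (-((‖x‖ * b) ^ 2 / 4)))) * this
      _ ≤ (4 ^ m * ρ⁻¹ ^ m) * 385 := by gcongr
      _ = _ := by ring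

lemma gauss_le {b ρ : ℝ} (hb : 0 ≤ b) (hρ : 0 < ρ) {x : E3} (h : ρ * b ≤ 4 ∨ ρ ≤ 4 * ‖x‖) :
    gauss b x ≤ 24640 * ρ⁻¹ ^ 3 := by
  have := pow_mul_gauss_le hb hρ h (m := 3) (l := 0) (by norm_num)
  unfold gauss
  norm_num at this ⊢
  linarith

lemma abs_pd_gauss_le {b ρ : ℝ} (hb : 0 ≤ b) (hρ : 0 < ρ) {x : E3}
    (h : ρ * b ≤ 4 ∨ ρ ≤ 4 * ‖x‖) (j : Fin 3) : |pd (gauss b) j x| ≤ 49280 * ρ⁻¹ ^ 4 := by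
  have := pow_mul_gauss_le hb hρ h (m := 4) (l := 1) (by norm_num)
  rw [pd_gauss, abs_mul, abs_neg, abs_of_nonneg (gauss_nonneg hb x), abs_mul,
    abs_of_nonneg (show 0 ≤ b ^ 2 / 2 by positivity)]
  have hx : |x j| ≤ ‖x‖ := by simpa using PiLp.norm_apply_le x j
  have h1 : b ^ 2 / 2 * |x j| * gauss b x ≤ b ^ 2 / 2 * ‖x‖ * gauss b x := by
    have := gauss_nonneg hb x
    gcongr
  refine h1.trans ?_
  unfold gauss
  norm_num at this ⊢
  linarith

end Heat

section FluxSum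

/-- The weight in the local energy balance at a fixed time. -/
def weight (b : ℝ) (x : E3) : ℝ := gauss b x * cutoff ((1 / 2) ^ 3) x

lemma contDiff_gauss_mul {χ : E3 → ℝ} (hχ : ContDiff ℝ ∞ χ) (b : ℝ) :
    ContDiff ℝ ∞ fun x => gauss b x * χ x :=
  (contDiff_gauss b).mul hχ

lemma abs_pd_gauss_mul_le {χ : E3 → ℝ} (hχ : ContDiff ℝ ∞ χ) {b ρ C : ℝ} (hb : 0 ≤ b) (hρ : 0 < ρ)
    (h1 : ∀ x, |χ x| ≤ 1) (j : Fin 3) (h2 : ∀ x, |pd χ j x| ≤ C * ρ⁻¹)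
    (h : ρ * b ≤ 4 ∨ ∀ x, ‖x‖ ≤ ρ / 4 → χ x = 0) (x : E3) :
    |pd (fun y => gauss b y * χ y) j x| ≤ (49280 + 24640 * C) * ρ⁻¹ ^ 4 := by
  have hC : 0 ≤ C * ρ⁻¹ := (abs_nonneg _).trans (h2 0)
  have hC' : 0 ≤ C := nonneg_of_mul_nonneg_left hC (inv_pos.2 hρ)
  by_cases hx : ρ * b ≤ 4 ∨ ρ ≤ 4 * ‖x‖
  · rw [pd_mul (contDiff_gauss b).diffAt hχ.diffAt]
    have a1 := abs_pd_gauss_le hb hρ hx j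
    have a2 := gauss_le hb hρ hx
    have a3 := gauss_nonneg hb x
    calc _ ≤ |pd (gauss b) j x| * |χ x| + gauss b x * |pd χ j x| := by
          refine (abs_add_le _ _).trans_eq ?_
          rw [abs_mul, abs_mul, abs_of_nonneg a3]
      _ ≤ 49280 * ρ⁻¹ ^ 4 * 1 + 24640 * ρ⁻¹ ^ 3 * (C * ρ⁻¹) := by
          gcongr
          · exact h1 x
          · exact h2 x
      _ = _ := by ring
  · push Not at hx
    have hz := h.resolve_left (not_le.2 hx.1)
    have : (fun y => gauss b y * χ y) =ᶠ[nhds x] fun _ => 0 := by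
      have hx' : ‖x‖ < ρ / 4 := by linarith [hx.2]
      filter_upwards [continuous_norm.continuousAt.eventually (gt_mem_nhds hx')] with y hy
      rw [hz y hy.le, mul_zero]
    rw [pd_congr this, pd_const, abs_zero]
    positivity

lemma exists_flux_sum_bound : ∃ C : ℝ, 0 < C ∧ ∀ (v : Fin 3 → E3 → ℝ) (P : E3 → ℝ) (M b : ℝ) (K : ℕ),
    (∀ i, ContDiff ℝ ∞ (v i)) → Continuous P → IsWeakPressure P (fun i j x => v i x * v j x) →
    (∀ x ∈ closedBall (0 : E3) (1 / 2), ∑ i, pd (v i) i x = 0) → 3 ≤ K → 0 ≤ M →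
    (∀ j, 1 ≤ j → j ≤ K → ∫ x in closedBall 0 ((1 / 2) ^ j), vsq v x ≤ M ^ 2 * (1 / 8) ^ j) →
    0 ≤ b → (1 / 2) ^ K * b ≤ 4 →
    |∫ x, (vsq v x + 2 * P x) * ∑ j, v j x * pd (weight b) j x|
      ≤ C * M * ∑ k ∈ Finset.Icc 3 K, (M ^ 2 * 2 ^ k
        + 4 ^ k * (∫ x in closedBall 0 (4 * (1 / 2) ^ k), gsq v x)
        + ∫ x in closedBall 0 1, |P x|) := by
  obtain ⟨C₁, hC₁, hflux⟩ := exists_flux_bound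
  obtain ⟨C₂, hC₂, hcut⟩ := exists_cutoff_bounds
  set D : ℝ := 49280 + 24640 * (3 * C₂) with hD
  have hD0 : 0 < D := by positivity
  refine ⟨C₁ * D, by positivity, fun v P M b K hv hP hw hdiv hK hM hA hb hKb => ?_⟩
  obtain ⟨ζ, hζ⟩ : ∃ ζ : ℕ → E3 → ℝ, ζ = fun k => cutoff ((1 / 2) ^ k) := ⟨_, rfl⟩
  have cζ : ∀ k, ContDiff ℝ ∞ (ζ k) := fun k => hζ ▸ contDiff_cutoff _
  have r0 : ∀ k : ℕ, (0 : ℝ) < (1 / 2) ^ k := fun k => by positivity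
  have hpow : ∀ k : ℕ, (((1 : ℝ) / 2) ^ k)⁻¹ ^ 4 = 16 ^ k := fun k => by
    rw [← inv_pow, ← pow_mul, mul_comm, pow_mul]; norm_num
  have b0 : ∀ k x, 0 ≤ ζ k x := fun k x => hζ ▸ cutoff_nonneg _ x
  have b1 : ∀ k x, ζ k x ≤ 1 := fun k x => hζ ▸ cutoff_le_one _ x
  have z0 : ∀ k x, (1 / 2) ^ k ≤ ‖x‖ → ζ k x = 0 := fun k x hx => hζ ▸ cutoff_eq_zero (r0 k) hx
  have z1 : ∀ k x, ‖x‖ ≤ (1 / 2) ^ k / 2 → ζ k x = 1 := fun k x hx =>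
    hζ ▸ cutoff_eq_one (r0 k) hx
  have d1 : ∀ k j x, |pd (ζ k) j x| ≤ C₂ * ((1 / 2) ^ k)⁻¹ := fun k j x => by
    rw [hζ]; exact (hcut _ (r0 k) 0 j x).1
  obtain ⟨F, hF⟩ : ∃ F : (E3 → ℝ) → ℝ, F = fun χ =>
    ∫ x, (vsq v x + 2 * P x) * ∑ j, v j x * pd (fun y => gauss b y * χ y) j x := ⟨_, rfl⟩
  have hbd : ∀ k χ, 3 ≤ k → k ≤ K → ContDiff ℝ ∞ χ → (∀ x, |χ x| ≤ 1) →
      (∀ j x, |pd χ j x| ≤ 3 * C₂ * ((1 / 2) ^ k)⁻¹) → (∀ x, (1 / 2) ^ k ≤ ‖x‖ → χ x = 0) →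
      ((1 / 2) ^ k * b ≤ 4 ∨ ∀ x, ‖x‖ ≤ (1 / 2) ^ k / 4 → χ x = 0) →
      |F χ| ≤ C₁ * D * M * (M ^ 2 * 2 ^ k
        + 4 ^ k * (∫ x in closedBall 0 (4 * (1 / 2) ^ k), gsq v x)
        + ∫ x in closedBall 0 1, |P x|) := by
    intro k χ hk hkK hχ h1 h2 h3 h4
    rw [hF]
    refine hflux v P _ M D k hv hP hw hdiv hk hM (fun j hj hjk => hA j hj (hjk.trans hkK))
      (contDiff_gauss_mul hχ b) (fun x hx => by rw [h3 x hx, mul_zero]) hD0.le fun j x => ?_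
    rw [← hpow]
    exact abs_pd_gauss_mul_le hχ hb (r0 k) h1 j (h2 j) h4 x
  have hsub : ∀ k, F (ζ k) = F (fun x => ζ k x - ζ (k + 1) x) + F (ζ (k + 1)) := by
    intro k
    have hi : ∀ χ : E3 → ℝ, ContDiff ℝ ∞ χ → HasCompactSupport χ → Integrable fun x =>
        (vsq v x + 2 * P x) * ∑ j, v j x * pd (fun y => gauss b y * χ y) j x := by
      intro χ hχ hc
      refine Continuous.integrable_of_hasCompactSupport ?_ ?_
      · exact ((continuous_vsq hv).add (hP.const_mul 2)).mul (continuous_finsetSum _ fun j _ =>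
          (hv j).continuous.mul (continuous_pd (contDiff_gauss_mul hχ b) j))
      · exact (hasCompactSupport_sum _ fun j _ =>
          (hasCompactSupport_pd hc.mul_left j).mul_left).mul_left
    have hcζ : ∀ k, HasCompactSupport (ζ k) := fun k => hasCompactSupport_of_norm (z0 k)
    rw [hF]
    simp only
    rw [← integral_add (hi _ ((cζ k).sub (cζ (k + 1))) ((hcζ k).sub (hcζ (k + 1))))
      (hi _ (cζ (k + 1)) (hcζ (k + 1)))]
    refine integral_congr_ae (Filter.Eventually.of_forall fun x => ?_)
    simp only
    rw [← mul_add, ← Finset.sum_add_distrib]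
    congr 1
    refine Finset.sum_congr rfl fun j _ => ?_
    have e := pd_sub (contDiff_gauss_mul (cζ k) b).diffAt (j := j) (x := x)
      (contDiff_gauss_mul (cζ (k + 1)) b).diffAt
    simp only [← mul_sub] at e
    rw [e]; ring
  have htel : ∀ m, 3 ≤ m → F (ζ 3) = ∑ k ∈ Finset.Ico 3 m, F (fun x => ζ k x - ζ (k + 1) x)
      + F (ζ m) := by
    intro m hm
    induction m, hm using Nat.le_induction with
    | base => simp
    | succ m hm ih => rw [Finset.sum_Ico_succ_top hm, ih, hsub m]; ring
  have hwF : ∫ x, (vsq v x + 2 * P x) * ∑ j, v j x * pd (weight b) j x = F (ζ 3) := by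
    rw [hF, hζ]; rfl
  rw [hwF, htel K hK, ← Finset.Ico_add_one_right_eq_Icc, Finset.sum_Ico_succ_top hK, mul_add,
    Finset.mul_sum]
  refine (abs_add_le _ _).trans (add_le_add ((Finset.abs_sum_le_sum_abs _ _).trans
    (Finset.sum_le_sum fun k hk => ?_)) ?_)
  · rw [Finset.mem_Ico] at hk
    have hr : ((1 : ℝ) / 2) ^ (k + 1) = (1 / 2) ^ k / 2 := by rw [pow_succ]; ring
    refine hbd k _ hk.1 hk.2.le ((cζ k).sub (cζ (k + 1))) (fun x => ?_) (fun j x => ?_)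
      (fun x hx => ?_) (Or.inr fun x hx => ?_)
    · rw [abs_le]; constructor <;> linarith [b0 k x, b1 k x, b0 (k + 1) x, b1 (k + 1) x]
    · rw [pd_sub (cζ k).diffAt (cζ (k + 1)).diffAt]
      refine (abs_sub _ _).trans ?_
      have h1 := d1 k j x
      have h2 := d1 (k + 1) j x
      rw [hr, inv_div] at h2
      linarith [show C₂ * (2 / (1 / 2) ^ k) = 2 * (C₂ * ((1 / 2) ^ k)⁻¹) by ring]
    · rw [z0 k x hx, z0 (k + 1) x (by rw [hr]; linarith [r0 k]), sub_zero]
    · rw [z1 k x (by linarith [r0 k]), z1 (k + 1) x (by rw [hr]; linarith), sub_self]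
  · refine hbd K _ hK le_rfl (cζ K) (fun x => ?_) (fun j x => ?_) (z0 K) (Or.inl hKb)
    · rw [abs_le]; constructor <;> linarith [b0 K x, b1 K x]
    · have := d1 K j x
      have h0 : 0 ≤ C₂ * ((1 / 2) ^ K)⁻¹ := by positivity
      linarith

end FluxSum

section EnergyIdentity

lemma pd_vsq {v : Fin 3 → E3 → ℝ} (hv : ∀ i, ContDiff ℝ ∞ (v i)) (j : Fin 3) (x : E3) :
    pd (vsq v) j x = ∑ i, 2 * (v i x * pd (v i) j x) := by
  have e : vsq v = fun x => ∑ i, v i x * v i x := by funext x; simp only [vsq, sq]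
  rw [e, pd_sum _ fun i _ => (hv i).diffAt.fun_mul (hv i).diffAt]
  refine Finset.sum_congr rfl fun i _ => ?_
  rw [pd_mul (hv i).diffAt (hv i).diffAt]; ring

lemma contDiff_vsq {v : Fin 3 → E3 → ℝ} (hv : ∀ i, ContDiff ℝ ∞ (v i)) : ContDiff ℝ ∞ (vsq v) :=
  ContDiff.sum fun i _ => (hv i).pow 2

/-- The pointwise form of the local energy balance. -/
lemma energy_identity_pointwise {v w : Fin 3 → E3 → ℝ} {P φ : E3 → ℝ} (hv : ∀ i, ContDiff ℝ ∞ (v i))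
    (hP : ContDiff ℝ ∞ P) (hφ : ContDiff ℝ ∞ φ) {x : E3}
    (hns : φ x = 0 ∨ (∀ i, w i x + (∑ j, v j x * pd (v i) j x) + pd P i x
      - ∑ j, pd (pd (v i) j) j x = 0) ∧ ∑ i, pd (v i) i x = 0) :
    (∑ i, 2 * (v i x * w i x)) * φ x = vsq v x * (∑ j, pd (pd φ j) j x) - 2 * (gsq v x * φ x)
      + (vsq v x + 2 * P x) * (∑ j, v j x * pd φ j x)
      + ∑ j, pd (fun y => φ y * pd (vsq v) j y - vsq v y * pd φ j y
          - (vsq v y + 2 * P y) * v j y * φ y) j x := by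
  have dv : ∀ i, DifferentiableAt ℝ (v i) x := fun i => (hv i).diffAt
  have dφ : DifferentiableAt ℝ φ x := hφ.diffAt
  have dP : DifferentiableAt ℝ P x := hP.diffAt
  have cs := contDiff_vsq hv
  have ds : DifferentiableAt ℝ (vsq v) x := cs.diffAt
  have dps : ∀ j, DifferentiableAt ℝ (pd (vsq v) j) x := fun j => (contDiff_pd cs j).diffAt
  have dpφ : ∀ j, DifferentiableAt ℝ (pd φ j) x := fun j => (contDiff_pd hφ j).diffAt
  have dpv : ∀ i j, DifferentiableAt ℝ (pd (v i) j) x := fun i j => (contDiff_pd (hv i) j).diffAt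
  have e2 : ∀ j, pd (pd (vsq v) j) j x
      = ∑ i, 2 * (pd (v i) j x * pd (v i) j x + v i x * pd (pd (v i) j) j x) := by
    intro j
    have : pd (vsq v) j = fun x => ∑ i, 2 * (v i x * pd (v i) j x) := funext fun x => pd_vsq hv j x
    rw [this, pd_sum _ fun i _ => ((dv i).fun_mul (dpv i j)).const_mul 2]
    refine Finset.sum_congr rfl fun i _ => ?_
    rw [pd_const_mul (f := fun y => v i y * pd (v i) j y) _ ((dv i).fun_mul (dpv i j)),
      pd_mul (dv i) (dpv i j)]
  have dS : DifferentiableAt ℝ (fun y => vsq v y + 2 * P y) x := ds.add (dP.const_mul 2)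
  have dSv : ∀ j, DifferentiableAt ℝ (fun y => (vsq v y + 2 * P y) * v j y) x :=
    fun j => dS.mul (dv j)
  have e1 : ∀ j, pd (fun y => φ y * pd (vsq v) j y - vsq v y * pd φ j y
          - (vsq v y + 2 * P y) * v j y * φ y) j x
      = pd φ j x * pd (vsq v) j x + φ x * pd (pd (vsq v) j) j x
        - (pd (vsq v) j x * pd φ j x + vsq v x * pd (pd φ j) j x)
        - (((pd (vsq v) j x + 2 * pd P j x) * v j x + (vsq v x + 2 * P x) * pd (v j) j x) * φ x
          + (vsq v x + 2 * P x) * v j x * pd φ j x) := by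
    intro j
    rw [pd_sub (f := fun y => φ y * pd (vsq v) j y - vsq v y * pd φ j y)
        ((dφ.fun_mul (dps j)).fun_sub (ds.fun_mul (dpφ j))) ((dSv j).fun_mul dφ),
      pd_sub (dφ.fun_mul (dps j)) (ds.fun_mul (dpφ j)), pd_mul dφ (dps j), pd_mul ds (dpφ j),
      pd_mul (dSv j) dφ, pd_mul dS (dv j), pd_add ds (dP.const_mul 2), pd_const_mul _ dP]
  rw [Finset.sum_congr rfl fun j _ => e1 j]
  simp only [e2, pd_vsq hv]
  rcases hns with h0 | ⟨hn, hd⟩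
  · rw [h0]
    simp only [Fin.sum_univ_three]
    ring
  · have n0 := hn 0
    have n1 := hn 1
    have n2 := hn 2
    simp only [gsq, vsq, Fin.sum_univ_three] at *
    linear_combination (2 * φ x * v 0 x) * n0 + (2 * φ x * v 1 x) * n1 + (2 * φ x * v 2 x) * n2
      + (v 0 x ^ 2 + v 1 x ^ 2 + v 2 x ^ 2 + 2 * P x) * φ x * hd

/-- The local energy balance at a fixed time. -/
lemma energy_identity {v w : Fin 3 → E3 → ℝ} {P φ : E3 → ℝ} (hv : ∀ i, ContDiff ℝ ∞ (v i))
    (hP : ContDiff ℝ ∞ P) (hφ : ContDiff ℝ ∞ φ) (hφ0 : ∀ x, 1 / 2 ≤ ‖x‖ → φ x = 0)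
    (hns : ∀ x ∈ closedBall (0 : E3) (1 / 2), ∀ i, w i x + (∑ j, v j x * pd (v i) j x) + pd P i x
      - ∑ j, pd (pd (v i) j) j x = 0)
    (hdiv : ∀ x ∈ closedBall (0 : E3) (1 / 2), ∑ i, pd (v i) i x = 0) :
    ∫ x, (∑ i, 2 * (v i x * w i x)) * φ x = (∫ x, vsq v x * (∑ j, pd (pd φ j) j x))
      - 2 * (∫ x, gsq v x * φ x) + ∫ x, (vsq v x + 2 * P x) * (∑ j, v j x * pd φ j x) := by
  have hφc : HasCompactSupport φ := hasCompactSupport_of_norm hφ0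
  have cv := fun i => (hv i).continuous
  have cs := contDiff_vsq hv
  have cψ := fun j => continuous_pd hφ j
  have h_intg : ∀ {f : E3 → ℝ}, Continuous f → HasCompactSupport f → Integrable f := fun hf hc =>
    hf.integrable_of_hasCompactSupport hc
  have i1 : Integrable fun x => vsq v x * (∑ j, pd (pd φ j) j x) :=
    h_intg (cs.continuous.mul (continuous_finsetSum _ fun j _ => continuous_pd (contDiff_pd hφ j) j))
      (hasCompactSupport_sum _ fun j _ => hasCompactSupport_pd (hasCompactSupport_pd hφc j) j).mul_left
  have i2 : Integrable fun x => 2 * (gsq v x * φ x) :=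
    h_intg (((continuous_gsq hv).mul hφ.continuous).const_mul 2) hφc.mul_left.mul_left
  have i3 : Integrable fun x => (vsq v x + 2 * P x) * (∑ j, v j x * pd φ j x) :=
    h_intg ((cs.continuous.add (hP.continuous.const_mul 2)).mul
        (continuous_finsetSum _ fun j _ => (cv j).mul (cψ j)))
      (hasCompactSupport_sum _ fun j _ => (hasCompactSupport_pd hφc j).mul_left).mul_left
  have cZ : ∀ j, ContDiff ℝ ∞ fun y => φ y * pd (vsq v) j y - vsq v y * pd φ j y
      - (vsq v y + 2 * P y) * v j y * φ y := fun j =>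
    ((hφ.mul (contDiff_pd cs j)).sub (cs.mul (contDiff_pd hφ j))).sub
      (((cs.add (contDiff_const.mul hP)).mul (hv j)).mul hφ)
  have sZ : ∀ j, HasCompactSupport fun y => φ y * pd (vsq v) j y - vsq v y * pd φ j y
      - (vsq v y + 2 * P y) * v j y * φ y := fun j =>
    (hφc.mul_right.sub (hasCompactSupport_pd hφc j).mul_left).sub hφc.mul_left
  have iZ : ∀ j ∈ (Finset.univ : Finset (Fin 3)), Integrable (pd (fun y => φ y * pd (vsq v) j y
      - vsq v y * pd φ j y - (vsq v y + 2 * P y) * v j y * φ y) j) := fun j _ =>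
    h_intg (continuous_pd (cZ j) j) (hasCompactSupport_pd (sZ j) j)
  have i12 : Integrable fun x => vsq v x * (∑ j, pd (pd φ j) j x) - 2 * (gsq v x * φ x) :=
    i1.sub i2
  have i123 : Integrable fun x => vsq v x * (∑ j, pd (pd φ j) j x) - 2 * (gsq v x * φ x)
      + (vsq v x + 2 * P x) * (∑ j, v j x * pd φ j x) := i12.add i3
  rw [integral_congr_ae (Filter.Eventually.of_forall fun x =>
    energy_identity_pointwise (x := x) (w := w) hv hP hφ ?_),
    integral_add i123 (integrable_finsetSum _ iZ), integral_add i12 i3, integral_sub i1 i2,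
    integral_finsetSum _ iZ, Finset.sum_eq_zero fun j _ => integral_pd (cZ j) (sZ j) j, add_zero,
    integral_const_mul]
  by_cases hx : ‖x‖ ≤ 1 / 2
  · have hx' : x ∈ closedBall (0 : E3) (1 / 2) := by simpa using hx
    exact Or.inr ⟨hns x hx', hdiv x hx'⟩
  · exact Or.inl (hφ0 x (by linarith))

lemma pressure_identity_pointwise {v w : Fin 3 → E3 → ℝ} {P g : E3 → ℝ}
    (hv : ∀ i, ContDiff ℝ ∞ (v i)) (hw : ∀ i, ContDiff ℝ ∞ (w i)) (hP : ContDiff ℝ ∞ P)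
    (hg : ContDiff ℝ ∞ g) {x : E3}
    (hns : (g x = 0 ∧ (∀ i, pd g i x = 0) ∧ ∀ i j, pd (pd g i) j x = 0) ∨
      (∀ i, w i x + (∑ j, v j x * pd (v i) j x) + pd P i x - ∑ j, pd (pd (v i) j) j x = 0) ∧
        ∑ i, pd (v i) i x = 0 ∧ ∑ i, pd (w i) i x = 0) :
    P x * (∑ j, pd (pd g j) j x) + ∑ i, ∑ j, v i x * v j x * pd (pd g i) j x
      = ∑ j, pd (fun y => P y * pd g j y + g y * w j y + ∑ i, (v j y * v i y * pd g i y
          - pd g i y * pd (v i) j y + v i y * pd (pd g i) j y - v j y * pd (pd g i) i y)) j x := by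
  have dv : ∀ i, DifferentiableAt ℝ (v i) x := fun i => (hv i).diffAt
  have dw : ∀ i, DifferentiableAt ℝ (w i) x := fun i => (hw i).diffAt
  have dg : DifferentiableAt ℝ g x := hg.diffAt
  have dP : DifferentiableAt ℝ P x := hP.diffAt
  have dg1 : ∀ j, DifferentiableAt ℝ (pd g j) x := fun j => (contDiff_pd hg j).diffAt
  have dg2 : ∀ i j, DifferentiableAt ℝ (pd (pd g i) j) x := fun i j =>
    (contDiff_pd (contDiff_pd hg i) j).diffAt
  have dpv : ∀ i j, DifferentiableAt ℝ (pd (v i) j) x := fun i j => (contDiff_pd (hv i) j).diffAt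
  have d1 : ∀ j i, DifferentiableAt ℝ (fun y => v j y * v i y * pd g i y) x := fun j i =>
    ((dv j).fun_mul (dv i)).fun_mul (dg1 i)
  have d2 : ∀ j i, DifferentiableAt ℝ (fun y => pd g i y * pd (v i) j y) x := fun j i =>
    (dg1 i).fun_mul (dpv i j)
  have d3 : ∀ j i, DifferentiableAt ℝ (fun y => v i y * pd (pd g i) j y) x := fun j i =>
    (dv i).fun_mul (dg2 i j)
  have d4 : ∀ j i, DifferentiableAt ℝ (fun y => v j y * pd (pd g i) i y) x := fun j i =>
    (dv j).fun_mul (dg2 i i)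
  have d12 := fun j i => (d1 j i).fun_sub (d2 j i)
  have d123 := fun j i => (d12 j i).fun_add (d3 j i)
  have d1234 := fun j i => (d123 j i).fun_sub (d4 j i)
  have e0 : ∀ i j, pd (pd (pd g i) j) j x = pd (pd (pd g j) j) i x := fun i j => by
    rw [show pd (pd g i) j = pd (pd g j) i from funext fun y => pd_comm hg i j y,
      pd_comm (contDiff_pd hg j)]
  have e1 : ∀ j, pd (fun y => P y * pd g j y + g y * w j y + ∑ i, (v j y * v i y * pd g i y
          - pd g i y * pd (v i) j y + v i y * pd (pd g i) j y - v j y * pd (pd g i) i y)) j x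
      = pd P j x * pd g j x + P x * pd (pd g j) j x + (pd g j x * w j x + g x * pd (w j) j x)
        + ∑ i, ((pd (v j) j x * v i x + v j x * pd (v i) j x) * pd g i x
          + v j x * v i x * pd (pd g i) j x
          - (pd (pd g i) j x * pd (v i) j x + pd g i x * pd (pd (v i) j) j x)
          + (pd (v i) j x * pd (pd g i) j x + v i x * pd (pd (pd g j) j) i x)
          - (pd (v j) j x * pd (pd g i) i x + v j x * pd (pd (pd g i) i) j x)) := by
    intro j
    rw [pd_add ((dP.fun_mul (dg1 j)).fun_add (dg.fun_mul (dw j)))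
        (DifferentiableAt.fun_sum fun i _ => d1234 j i),
      pd_add (dP.fun_mul (dg1 j)) (dg.fun_mul (dw j)), pd_mul dP (dg1 j), pd_mul dg (dw j),
      pd_sum _ fun i _ => d1234 j i]
    congr 1
    refine Finset.sum_congr rfl fun i _ => ?_
    rw [pd_sub (d123 j i) (d4 j i), pd_add (d12 j i) (d3 j i), pd_sub (d1 j i) (d2 j i),
      pd_mul ((dv j).fun_mul (dv i)) (dg1 i), pd_mul (dv j) (dv i), pd_mul (dg1 i) (dpv i j),
      pd_mul (dv i) (dg2 i j), pd_mul (dv j) (dg2 i i), e0]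
  rw [Finset.sum_congr rfl fun j _ => e1 j]
  rcases hns with ⟨h0, h1, h2⟩ | ⟨hn, hd, hdw⟩
  · simp only [h0, h1, h2, Fin.sum_univ_three]
    ring
  · have n0 := hn 0
    have n1 := hn 1
    have n2 := hn 2
    simp only [Fin.sum_univ_three] at *
    linear_combination (-pd g 0 x) * n0 - pd g 1 x * n1 - pd g 2 x * n2
      - (v 0 x * pd g 0 x + v 1 x * pd g 1 x + v 2 x * pd g 2 x
        - (pd (pd g 0) 0 x + pd (pd g 1) 1 x + pd (pd g 2) 2 x)) * hd - g x * hdw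

/-- The pressure equation `-ΔP = ∂ᵢ∂ⱼ(vᵢvⱼ)` in weak form. -/
lemma isWeakPressure_of_ns {v w : Fin 3 → E3 → ℝ} {P : E3 → ℝ} (hv : ∀ i, ContDiff ℝ ∞ (v i))
    (hw : ∀ i, ContDiff ℝ ∞ (w i)) (hP : ContDiff ℝ ∞ P)
    (hns : ∀ x ∈ closedBall (0 : E3) (1 / 2), ∀ i, w i x + (∑ j, v j x * pd (v i) j x) + pd P i x
      - ∑ j, pd (pd (v i) j) j x = 0)
    (hdiv : ∀ x ∈ closedBall (0 : E3) (1 / 2), ∑ i, pd (v i) i x = 0)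
    (hdivw : ∀ x ∈ closedBall (0 : E3) (1 / 2), ∑ i, pd (w i) i x = 0) :
    IsWeakPressure P (fun i j x => v i x * v j x) := by
  intro g hg hgs
  have hgc : HasCompactSupport g := (isCompact_closedBall 0 (1 / 2)).of_isClosed_subset
    (isClosed_tsupport g) hgs
  have cv := fun i => (hv i).continuous
  have sg := fun j => hasCompactSupport_pd hgc j
  have sgg := fun i j => hasCompactSupport_pd (sg i) j
  have cg2 := fun i j => continuous_pd (contDiff_pd hg i) j
  have cZ : ∀ j, ContDiff ℝ ∞ fun y => P y * pd g j y + g y * w j y + ∑ i, (v j y * v i y * pd g i y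
      - pd g i y * pd (v i) j y + v i y * pd (pd g i) j y - v j y * pd (pd g i) i y) := fun j =>
    ((hP.mul (contDiff_pd hg j)).add (hg.mul (hw j))).add (ContDiff.sum fun i _ =>
      (((((hv j).mul (hv i)).mul (contDiff_pd hg i)).sub
        ((contDiff_pd hg i).mul (contDiff_pd (hv i) j))).add
          ((hv i).mul (contDiff_pd (contDiff_pd hg i) j))).sub
            ((hv j).mul (contDiff_pd (contDiff_pd hg i) i)))
  have sZ : ∀ j, HasCompactSupport fun y => P y * pd g j y + g y * w j y
      + ∑ i, (v j y * v i y * pd g i y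
      - pd g i y * pd (v i) j y + v i y * pd (pd g i) j y - v j y * pd (pd g i) i y) := fun j =>
    ((sg j).mul_left.add hgc.mul_right).add (hasCompactSupport_sum _ fun i _ =>
      (((sg i).mul_left.sub (sg i).mul_right).add (sgg i j).mul_left).sub (sgg i i).mul_left)
  have iZ : ∀ j ∈ (Finset.univ : Finset (Fin 3)), Integrable (pd (fun y => P y * pd g j y
      + g y * w j y + ∑ i, (v j y * v i y * pd g i y - pd g i y * pd (v i) j y
      + v i y * pd (pd g i) j y - v j y * pd (pd g i) i y)) j) := fun j _ =>
    (continuous_pd (cZ j) j).integrable_of_hasCompactSupport (hasCompactSupport_pd (sZ j) j)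
  have i1 : Integrable fun x => P x * ∑ j, pd (pd g j) j x :=
    (hP.continuous.mul (continuous_finsetSum _ fun j _ => cg2 j j)).integrable_of_hasCompactSupport
      (hasCompactSupport_sum _ fun j _ => sgg j j).mul_left
  have i2 : ∀ i j, Integrable fun x => v i x * v j x * pd (pd g i) j x := fun i j =>
    (((cv i).mul (cv j)).mul (cg2 i j)).integrable_of_hasCompactSupport (sgg i j).mul_left
  have i2' : ∀ i ∈ (Finset.univ : Finset (Fin 3)),
      Integrable fun x => ∑ j, v i x * v j x * pd (pd g i) j x := fun i _ =>
    integrable_finsetSum _ fun j _ => i2 i j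
  have key : ∫ x, (P x * (∑ j, pd (pd g j) j x) + ∑ i, ∑ j, v i x * v j x * pd (pd g i) j x) = 0 := by
    rw [integral_congr_ae (Filter.Eventually.of_forall fun x =>
      pressure_identity_pointwise (x := x) (w := w) hv hw hP hg ?_),
      integral_finsetSum _ iZ, Finset.sum_eq_zero fun j _ => integral_pd (cZ j) (sZ j) j]
    by_cases hx : x ∈ tsupport g
    · exact Or.inr ⟨hns x (hgs hx), hdiv x (hgs hx), hdivw x (hgs hx)⟩
    · refine Or.inl ⟨image_eq_zero_of_notMem_tsupport hx, fun i => pd_eq_zero_of_notMem hx,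
        fun i j => pd_eq_zero_of_notMem fun h => hx (tsupport_pd_subset h)⟩
  rw [integral_add i1 (integrable_finsetSum _ i2'), integral_finsetSum _ i2'] at key
  rw [eq_neg_of_add_eq_zero_left key]
  congr 1
  exact Finset.sum_congr rfl fun i _ => integral_finsetSum _ fun j _ => i2 i j

end EnergyIdentity

section SpaceTime

lemma integral_sub_eq_of_hasDerivAt {F D : ℝ → E3 → ℝ} {a b R : ℝ} (hab : a ≤ b)
    (hD : ContinuousOn D.uncurry (Icc a b ×ˢ univ))
    (hF : ∀ t ∈ Icc a b, ∀ x, HasDerivAt (fun s => F s x) (D t x) t)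
    (hD0 : ∀ t x, R ≤ ‖x‖ → D t x = 0) (ha : Integrable (F a)) (hb : Integrable (F b)) :
    (∫ x, F b x) - ∫ x, F a x = ∫ t in a..b, ∫ x, D t x := by
  have h1 : IntegrableOn D.uncurry (Icc a b ×ˢ closedBall 0 R) (volume.prod volume) :=
    (hD.mono (prod_mono_right (subset_univ _))).integrableOn_compact
      (isCompact_Icc.prod (isCompact_closedBall 0 R))
  have h2 : IntegrableOn D.uncurry (Icc a b ×ˢ univ) (volume.prod volume) := by
    refine h1.of_forall_sdiff_eq_zero (measurableSet_Icc.prod MeasurableSet.univ) fun q hq => ?_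
    have : q.2 ∉ closedBall 0 R := fun h => hq.2 ⟨hq.1.1, h⟩
    exact hD0 q.1 q.2 (le_of_lt (by simpa using this))
  have h3 : Integrable D.uncurry ((volume.restrict (uIoc a b)).prod volume) := by
    have h4 := h2.mono_set (prod_mono_left (t := univ) (uIoc_of_le hab ▸ Ioc_subset_Icc_self))
    rw [IntegrableOn, ← Measure.prod_restrict, Measure.restrict_univ] at h4
    exact h4
  rw [intervalIntegral_integral_swap h3, ← integral_sub hb ha]
  refine integral_congr_ae (Filter.Eventually.of_forall fun x => ?_)
  refine (intervalIntegral.integral_eq_sub_of_hasDerivAt (f := fun t => F t x)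
    (fun t ht => hF t (uIcc_of_le hab ▸ ht) x) ?_).symm
  refine ContinuousOn.intervalIntegrable ?_
  rw [uIcc_of_le hab]
  exact hD.comp (f := fun t => (t, x)) (by fun_prop) fun t ht => ⟨ht, mem_univ x⟩

variable {f : ℝ → E3 → ℝ}

lemma contDiff_slice_space (hf : ContDiff ℝ ∞ f.uncurry) (t : ℝ) : ContDiff ℝ ∞ (f t) :=
  hf.comp (contDiff_const.prodMk contDiff_id)

lemma contDiff_slice_time (hf : ContDiff ℝ ∞ f.uncurry) (x : E3) : ContDiff ℝ ∞ fun s => f s x :=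
  hf.comp (contDiff_id.prodMk contDiff_const)

lemma pd_slice (hf : ContDiff ℝ ∞ f.uncurry) (t : ℝ) (j : Fin 3) (x : E3) :
    pd (f t) j x = fderiv ℝ f.uncurry (t, x) (0, EuclideanSpace.single j 1) := by
  have h1 : HasFDerivAt (fun y : E3 => (t, y)) (ContinuousLinearMap.inr ℝ ℝ E3) x :=
    hasFDerivAt_prodMk_right t x
  have h2 : HasFDerivAt f.uncurry (fderiv ℝ f.uncurry (t, x)) (t, x) :=
    (hf.differentiable (by simp)).differentiableAt.hasFDerivAt
  have h3 : HasFDerivAt (f t) _ x := h2.comp x h1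
  simp [pd, h3.fderiv]

lemma deriv_slice (hf : ContDiff ℝ ∞ f.uncurry) (t : ℝ) (x : E3) :
    deriv (fun s => f s x) t = fderiv ℝ f.uncurry (t, x) (1, 0) := by
  have h1 : HasFDerivAt (fun s : ℝ => (s, x)) (ContinuousLinearMap.inl ℝ ℝ E3) t :=
    hasFDerivAt_prodMk_left t x
  have h2 : HasFDerivAt f.uncurry (fderiv ℝ f.uncurry (t, x)) (t, x) :=
    (hf.differentiable (by simp)).differentiableAt.hasFDerivAt
  have h3 : HasFDerivAt (fun s => f s x)
      (fderiv ℝ f.uncurry (t, x) ∘L ContinuousLinearMap.inl ℝ ℝ E3) t :=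
    HasFDerivAt.comp (g := f.uncurry) t h2 h1
  simpa using h3.hasDerivAt.deriv

lemma contDiff_uncurry_pd (hf : ContDiff ℝ ∞ f.uncurry) (j : Fin 3) :
    ContDiff ℝ ∞ (fun t => pd (f t) j).uncurry := by
  have h : ContDiff ℝ ∞ (fderiv ℝ f.uncurry) := hf.fderiv_right (by simp)
  have e : (fun t => pd (f t) j).uncurry
      = fun q => fderiv ℝ f.uncurry q (0, EuclideanSpace.single j 1) := by
    funext q; exact pd_slice hf q.1 j q.2
  rw [e]
  exact h.clm_apply contDiff_const

lemma contDiff_uncurry_deriv (hf : ContDiff ℝ ∞ f.uncurry) :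
    ContDiff ℝ ∞ (fun t x => deriv (fun s => f s x) t).uncurry := by
  have h : ContDiff ℝ ∞ (fderiv ℝ f.uncurry) := hf.fderiv_right (by simp)
  have e : (fun t x => deriv (fun s => f s x) t).uncurry = fun q => fderiv ℝ f.uncurry q (1, 0) := by
    funext q; exact deriv_slice hf q.1 q.2
  rw [e]
  exact h.clm_apply contDiff_const

lemma deriv_pd_comm (hf : ContDiff ℝ ∞ f.uncurry) (t : ℝ) (j : Fin 3) (x : E3) :
    deriv (fun s => pd (f s) j x) t = pd (fun y => deriv (fun s => f s y) t) j x := by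
  have h : ContDiff ℝ ∞ (fderiv ℝ f.uncurry) := hf.fderiv_right (by simp)
  have hd : DifferentiableAt ℝ (fderiv ℝ f.uncurry) (t, x) :=
    (h.differentiable (by simp)).differentiableAt
  have hs : IsSymmSndFDerivAt ℝ f.uncurry (t, x) :=
    hf.contDiffAt.isSymmSndFDerivAt (by simpa using WithTop.coe_le_coe.2 (le_top (a := (2 : ℕ∞))))
  have e1 : (fun t => pd (f t) j).uncurry
      = fun q => fderiv ℝ f.uncurry q (0, EuclideanSpace.single j 1) := by
    funext q; exact pd_slice hf q.1 j q.2
  have e2 : (fun t x => deriv (fun s => f s x) t).uncurry = fun q => fderiv ℝ f.uncurry q (1, 0) := by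
    funext q; exact deriv_slice hf q.1 q.2
  rw [deriv_slice (f := fun t => pd (f t) j) (contDiff_uncurry_pd hf j),
    pd_slice (f := fun t x => deriv (fun s => f s x) t) (contDiff_uncurry_deriv hf), e1, e2,
    fderiv_clm_apply hd (differentiableAt_const _), fderiv_clm_apply hd (differentiableAt_const _)]
  simp only [fderiv_fun_const, Pi.zero_apply, ContinuousLinearMap.comp_zero, zero_add,
    ContinuousLinearMap.flip_apply]
  exact hs _ _

end SpaceTime

section Weight

lemma contDiff_weight (b : ℝ) : ContDiff ℝ ∞ (weight b) :=
  contDiff_gauss_mul (contDiff_cutoff _) b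

lemma weight_nonneg {b : ℝ} (hb : 0 ≤ b) (x : E3) : 0 ≤ weight b x :=
  mul_nonneg (gauss_nonneg hb x) (cutoff_nonneg _ x)

lemma weight_eq_zero {b : ℝ} {x : E3} (hx : 1 / 2 ≤ ‖x‖) : weight b x = 0 := by
  unfold weight
  rw [cutoff_eq_zero (by norm_num) (le_trans (by norm_num) hx), mul_zero]

lemma weight_le {b : ℝ} (hb : 0 ≤ b) (x : E3) : weight b x ≤ b ^ 3 := by
  unfold weight gauss
  have h1 : Real.exp (-(b ^ 2 / 4 * ‖x‖ ^ 2)) ≤ 1 := Real.exp_le_one_iff.2 (by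
    have : 0 ≤ b ^ 2 / 4 * ‖x‖ ^ 2 := by positivity
    linarith)
  calc _ ≤ b ^ 3 * 1 * 1 := by
        have := cutoff_le_one ((1 / 2) ^ 3) x
        have := cutoff_nonneg ((1 / 2) ^ 3) x
        gcongr
    _ = _ := by ring

lemma hasDerivAt_weight {a t : ℝ} (ht : t < a) (x : E3) :
    HasDerivAt (fun s => weight ((√(a - s))⁻¹) x)
      ((3 / 2 * (√(a - t))⁻¹ ^ 2 - (√(a - t))⁻¹ ^ 4 / 4 * ‖x‖ ^ 2) * weight ((√(a - t))⁻¹) x) t := by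
  have hp : 0 < a - t := by linarith
  have hs : √(a - t) ≠ 0 := (Real.sqrt_pos.2 hp).ne'
  have h1 : HasDerivAt (fun s => (√(a - s))⁻¹) ((√(a - t))⁻¹ ^ 3 / 2) t := by
    refine ((((hasDerivAt_id t).const_sub a).sqrt hp.ne').inv hs).congr_deriv ?_
    simp only [id]
    field_simp
  have h2 : ∀ c, HasDerivAt (fun c => weight c x)
      ((3 * c ^ 2 - c ^ 4 / 2 * ‖x‖ ^ 2) * Real.exp (-(c ^ 2 / 4 * ‖x‖ ^ 2))
        * cutoff ((1 / 2) ^ 3) x) c := by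
    intro c
    refine ((((hasDerivAt_id c).fun_pow 3).mul
      (((((hasDerivAt_id c).fun_pow 2).div_const 4).mul_const (‖x‖ ^ 2)).fun_neg.exp)).mul_const
      (cutoff ((1 / 2) ^ 3) x)).congr_deriv ?_
    simp only [id]
    ring
  refine ((h2 _).comp t h1).congr_deriv ?_
  unfold weight gauss
  ring

lemma continuousOn_weight {a : ℝ} {s : Set ℝ} (hs : ∀ t ∈ s, t < a) :
    ContinuousOn (fun q : ℝ × E3 => weight ((√(a - q.1))⁻¹) q.2) (s ×ˢ univ) := by
  have h1 : ContinuousOn (fun q : ℝ × E3 => (√(a - q.1))⁻¹) (s ×ˢ univ) :=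
    ContinuousOn.inv₀ (by fun_prop) fun q hq =>
      (Real.sqrt_pos.2 (by have := hs q.1 hq.1; linarith)).ne'
  have h2 : Continuous (cutoff ((1 / 2) ^ 3)) := (contDiff_cutoff _).continuous
  unfold weight gauss
  fun_prop

lemma exists_adjoint_heat_bound : ∃ C : ℝ, 0 < C ∧ ∀ b : ℝ, 0 ≤ b → ∀ x,
    |(∑ j, pd (pd (weight b) j) j x) + (3 / 2 * b ^ 2 - b ^ 4 / 4 * ‖x‖ ^ 2) * weight b x| ≤ C := by
  obtain ⟨C, hC, hb⟩ := exists_cutoff_bounds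
  set ζ := cutoff ((1 / 2) ^ 3) with hζ
  have hbd := hb ((1 / 2) ^ 3) (by norm_num)
  refine ⟨∑ j : Fin 3, (2 * (49280 * 256) * (C * 8) + 24640 * 64 * (C * 64)), by positivity,
    fun b hb x => ?_⟩
  have sζ : ContDiff ℝ ∞ ζ := contDiff_cutoff _
  have sg := contDiff_gauss b
  have e : ∀ j, pd (pd (weight b) j) j x = pd (pd (gauss b) j) j x * ζ x
      + (2 * pd (gauss b) j x * pd ζ j x + gauss b x * pd (pd ζ j) j x) := by
    intro j
    have e1 : pd (weight b) j = fun x => pd (gauss b) j x * ζ x + gauss b x * pd ζ j x := by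
      funext y
      exact pd_mul sg.diffAt sζ.diffAt
    have d1 := (contDiff_pd sg j).diffAt (x := x)
    have d2 := (contDiff_pd sζ j).diffAt (x := x)
    rw [e1, pd_add (d1.fun_mul sζ.diffAt) (sg.diffAt.fun_mul d2), pd_mul d1 sζ.diffAt,
      pd_mul sg.diffAt d2]
    ring
  have e2 : (∑ j, pd (pd (weight b) j) j x) + (3 / 2 * b ^ 2 - b ^ 4 / 4 * ‖x‖ ^ 2) * weight b x
      = ∑ j, (2 * pd (gauss b) j x * pd ζ j x + gauss b x * pd (pd ζ j) j x) := by
    simp only [e]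
    rw [Finset.sum_add_distrib, ← Finset.sum_mul, laplacian_gauss]
    unfold weight
    ring
  rw [e2]
  refine (Finset.abs_sum_le_sum_abs _ _).trans (Finset.sum_le_sum fun j _ => ?_)
  rcases lt_or_ge ‖x‖ (1 / 16) with hx | hx
  · have h1 : ζ =ᶠ[nhds x] fun _ => 1 := by
      filter_upwards [continuous_norm.continuousAt.eventually (gt_mem_nhds hx)] with y hy
      exact cutoff_eq_one (by norm_num) (by norm_num; linarith)
    have h2 : pd ζ j =ᶠ[nhds x] fun _ => 0 := by
      filter_upwards [pd_eventuallyEq (j := j) h1] with y hy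
      rw [hy]; exact pd_const _
    have h3 : pd (pd ζ j) j x = 0 := by
      rw [pd_congr h2]; exact pd_const _
    rw [h2.eq_of_nhds, h3]
    simp only [mul_zero, add_zero, abs_zero]
    positivity
  · have hρ : (1 / 4 : ℝ) * b ≤ 4 ∨ 1 / 4 ≤ 4 * ‖x‖ := Or.inr (by linarith)
    have g1 := gauss_le hb (by norm_num) hρ
    have g2 := abs_pd_gauss_le hb (by norm_num) hρ j
    have z1 : |pd ζ j x| ≤ C * 8 := (hbd j j x).1.trans (by norm_num)
    have z2 : |pd (pd ζ j) j x| ≤ C * 64 := (hbd j j x).2.trans (by norm_num)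
    norm_num at g1 g2
    refine (abs_add_le _ _).trans ?_
    rw [abs_mul, abs_mul, abs_mul, abs_of_nonneg (gauss_nonneg hb x), abs_two]
    have := gauss_nonneg hb x
    gcongr
    · linarith
    · linarith

end Weight

section EnergyInequality

/-- Globally smooth fields which solve the Navier–Stokes equations near the closed cylinder
`[-1/4, 0] × closedBall 0 (1/2)`. -/
structure IsLocalNS (v : Fin 3 → ℝ → E3 → ℝ) (P : ℝ → E3 → ℝ) : Prop where
  smooth : ∀ i, ContDiff ℝ ∞ (v i).uncurry
  smooth_pressure : ContDiff ℝ ∞ P.uncurry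
  momentum : ∀ t ∈ Icc (-(1 / 4) : ℝ) 0, ∀ x ∈ closedBall (0 : E3) (1 / 2), ∀ i,
    deriv (fun s => v i s x) t + (∑ j, v j t x * pd (v i t) j x) + pd (P t) i x
      - ∑ j, pd (pd (v i t) j) j x = 0
  div_eq_zero : ∀ t ∈ Icc (-(1 / 4) : ℝ) 0, ∀ x ∈ closedBall (0 : E3) (1 / 2),
    ∀ᶠ s in nhds t, ∑ i, pd (v i s) i x = 0

variable {v : Fin 3 → ℝ → E3 → ℝ} {P : ℝ → E3 → ℝ}

lemma IsLocalNS.slice (h : IsLocalNS v P) (t : ℝ) (i : Fin 3) : ContDiff ℝ ∞ (v i t) :=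
  contDiff_slice_space (h.smooth i) t

lemma IsLocalNS.div (h : IsLocalNS v P) {t : ℝ} (ht : t ∈ Icc (-(1 / 4) : ℝ) 0) {x : E3}
    (hx : x ∈ closedBall (0 : E3) (1 / 2)) : ∑ i, pd (v i t) i x = 0 :=
  (h.div_eq_zero t ht x hx).self_of_nhds

lemma IsLocalNS.div_deriv (h : IsLocalNS v P) {t : ℝ} (ht : t ∈ Icc (-(1 / 4) : ℝ) 0) {x : E3}
    (hx : x ∈ closedBall (0 : E3) (1 / 2)) :
    ∑ i, pd (fun y => deriv (fun s => v i s y) t) i x = 0 := by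
  have h1 : (fun s => ∑ i, pd (v i s) i x) =ᶠ[nhds t] fun _ => 0 := h.div_eq_zero t ht x hx
  have h2 := h1.deriv_eq
  rw [deriv_const, deriv_fun_sum fun i _ =>
    ((contDiff_slice_time (contDiff_uncurry_pd (h.smooth i) i) x).differentiable
      (by simp)).differentiableAt] at h2
  rw [← h2]
  exact Finset.sum_congr rfl fun i _ => (deriv_pd_comm (h.smooth i) t i x).symm

lemma IsLocalNS.isWeakPressure (h : IsLocalNS v P) {t : ℝ} (ht : t ∈ Icc (-(1 / 4) : ℝ) 0) :
    IsWeakPressure (P t) (fun i j x => v i t x * v j t x) :=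
  isWeakPressure_of_ns (h.slice t)
    (fun i => contDiff_slice_space (contDiff_uncurry_deriv (h.smooth i)) t)
    (contDiff_slice_space h.smooth_pressure t) (h.momentum t ht) (fun _ hx => h.div ht hx)
    fun _ hx => h.div_deriv ht hx

lemma continuous_uncurry_vsq (hv : ∀ i, ContDiff ℝ ∞ (v i).uncurry) :
    Continuous (fun t => vsq fun i => v i t).uncurry := by
  have h := fun i => (hv i).continuous
  exact continuous_finsetSum Finset.univ fun i _ => (h i).fun_pow 2

lemma continuous_uncurry_gsq (hv : ∀ i, ContDiff ℝ ∞ (v i).uncurry) :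
    Continuous (fun t => gsq fun i => v i t).uncurry := by
  have h := fun i j => (contDiff_uncurry_pd (hv i) j).continuous
  exact continuous_finsetSum Finset.univ fun i _ =>
    continuous_finsetSum Finset.univ fun j _ => (h i j).fun_pow 2

lemma continuous_energy (hv : ∀ i, ContDiff ℝ ∞ (v i).uncurry) (r : ℝ) :
    Continuous fun t => ∫ x in closedBall 0 r, vsq (fun i => v i t) x :=
  continuous_parametric_integral_of_continuous (continuous_uncurry_vsq hv)
    (isCompact_closedBall 0 r)

lemma continuous_dissipation (hv : ∀ i, ContDiff ℝ ∞ (v i).uncurry) (r : ℝ) :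
    Continuous fun t => ∫ x in closedBall 0 r, gsq (fun i => v i t) x :=
  continuous_parametric_integral_of_continuous (continuous_uncurry_gsq hv)
    (isCompact_closedBall 0 r)

lemma continuous_pressure_mass (hP : ContDiff ℝ ∞ P.uncurry) (r : ℝ) :
    Continuous fun t => ∫ x in closedBall 0 r, |P t x| :=
  continuous_parametric_integral_of_continuous (f := fun t x => |P t x|) hP.continuous.abs
    (isCompact_closedBall 0 r)

/-- The flux of the energy through the weight. -/
def flux (v : Fin 3 → ℝ → E3 → ℝ) (P : ℝ → E3 → ℝ) (b t : ℝ) : ℝ :=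
  ∫ x, (vsq (fun i => v i t) x + 2 * P t x) * ∑ j, v j t x * pd (weight b) j x

lemma exists_deriv_energy_bound : ∃ C : ℝ, 0 < C ∧ ∀ (v : Fin 3 → ℝ → E3 → ℝ) (P : ℝ → E3 → ℝ),
    IsLocalNS v P → ∀ t ∈ Icc (-(1 / 4) : ℝ) 0, ∀ b : ℝ, 0 ≤ b →
    ∫ x, ((∑ i, 2 * (v i t x * deriv (fun s => v i s x) t)) * weight b x
      + vsq (fun i => v i t) x * ((3 / 2 * b ^ 2 - b ^ 4 / 4 * ‖x‖ ^ 2) * weight b x))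
      ≤ C * (∫ x in closedBall 0 (1 / 2), vsq (fun i => v i t) x)
        - 2 * (∫ x, gsq (fun i => v i t) x * weight b x) + flux v P b t := by
  obtain ⟨C, hC, hb⟩ := exists_adjoint_heat_bound
  refine ⟨C, hC, fun v P h t ht b hb0 => ?_⟩
  have hw0 : ∀ x, 1 / 2 ≤ ‖x‖ → weight b x = 0 := fun x hx => weight_eq_zero hx
  have hwc : HasCompactSupport (weight b) := hasCompactSupport_of_norm hw0
  have sw := contDiff_weight b
  have cw := sw.continuous
  have cs := continuous_vsq (h.slice t)
  have cd : ∀ i, Continuous fun x => deriv (fun s => v i s x) t := fun i =>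
    (contDiff_slice_space (contDiff_uncurry_deriv (h.smooth i)) t).continuous
  have cv := fun i => (h.slice t i).continuous
  have clap : Continuous fun x => ∑ j, pd (pd (weight b) j) j x :=
    continuous_finsetSum _ fun j _ => continuous_pd (contDiff_pd sw j) j
  have hid := energy_identity (w := fun i x => deriv (fun s => v i s x) t) (h.slice t)
    (contDiff_slice_space h.smooth_pressure t) sw hw0 (h.momentum t ht) (fun _ hx => h.div ht hx)
  have i1 : Integrable fun x => (∑ i, 2 * (v i t x * deriv (fun s => v i s x) t)) * weight b x :=
    Continuous.integrable_of_hasCompactSupport (by fun_prop) hwc.mul_left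
  have i2 : Integrable fun x => vsq (fun i => v i t) x
      * ((3 / 2 * b ^ 2 - b ^ 4 / 4 * ‖x‖ ^ 2) * weight b x) :=
    Continuous.integrable_of_hasCompactSupport (by fun_prop) hwc.mul_left.mul_left
  have hlapc : HasCompactSupport fun x => ∑ j, pd (pd (weight b) j) j x :=
    hasCompactSupport_sum _ fun j _ => hasCompactSupport_pd (hasCompactSupport_pd hwc j) j
  have i3 : Integrable fun x => vsq (fun i => v i t) x * ∑ j, pd (pd (weight b) j) j x :=
    Continuous.integrable_of_hasCompactSupport (by fun_prop) hlapc.mul_left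
  have key : (∫ x, vsq (fun i => v i t) x * ∑ j, pd (pd (weight b) j) j x)
      + ∫ x, vsq (fun i => v i t) x * ((3 / 2 * b ^ 2 - b ^ 4 / 4 * ‖x‖ ^ 2) * weight b x)
      ≤ C * ∫ x in closedBall 0 (1 / 2), vsq (fun i => v i t) x := by
    rw [← integral_add i3 i2, ← setIntegral_eq_integral_of_forall_compl_eq_zero
      (s := closedBall 0 (1 / 2)), ← integral_const_mul]
    · refine setIntegral_mono_on (i3.add i2).integrableOn
        ((integrableOn_closedBall cs _).const_mul C) measurableSet_closedBall fun x _ => ?_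
      have h1 := (le_abs_self _).trans (hb b hb0 x)
      have h2 := vsq_nonneg (fun i => v i t) x
      rw [← mul_add, mul_comm C]
      exact mul_le_mul_of_nonneg_left h1 h2
    · intro x hx
      have hx' : 1 / 2 < ‖x‖ := by simpa using hx
      have : ∀ j, pd (pd (weight b) j) j x = 0 := fun j => by
        refine pd_eq_zero_of_norm (ρ := 3 / 8) (fun y hy => ?_) j x (by linarith)
        refine pd_eq_zero_of_norm (ρ := 1 / 4) (fun z hz => ?_) j y (by linarith)
        unfold weight
        rw [cutoff_eq_zero (by norm_num) (le_trans (by norm_num) hz), mul_zero]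
      simp [this, hw0 x hx'.le]
  rw [integral_add i1 i2]
  unfold flux
  linarith

lemma continuousOn_weighted_dissipation (hv : ∀ i, ContDiff ℝ ∞ (v i).uncurry) {a : ℝ} {s : Set ℝ}
    (hs : ∀ t ∈ s, t < a) :
    ContinuousOn (fun t => ∫ x, gsq (fun i => v i t) x * weight (√(a - t))⁻¹ x) s :=
  continuousOn_integral_of_compact_support (isCompact_closedBall 0 (1 / 2))
    (f := fun t x => gsq (fun i => v i t) x * weight (√(a - t))⁻¹ x)
    ((continuous_uncurry_gsq hv).continuousOn.mul (continuousOn_weight hs))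
    fun t x _ hx => by rw [weight_eq_zero (le_of_lt (by simpa using hx)), mul_zero]

lemma exists_energy_inequality : ∃ C : ℝ, 0 < C ∧ ∀ (v : Fin 3 → ℝ → E3 → ℝ) (P : ℝ → E3 → ℝ),
    IsLocalNS v P → ∀ a : ℝ, 0 < a → ∀ s₀ ∈ Icc (-(1 / 4) : ℝ) 0, ∀ s ∈ Icc s₀ 0, ∀ g : ℝ → ℝ,
    IntervalIntegrable g volume s₀ s → (∀ t ∈ Icc s₀ 0, flux v P (√(a - t))⁻¹ t ≤ g t) →
    (∫ x, vsq (fun i => v i s) x * weight (√(a - s))⁻¹ x)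
      + 2 * (∫ t in s₀..s, ∫ x, gsq (fun i => v i t) x * weight (√(a - t))⁻¹ x)
      ≤ (∫ x, vsq (fun i => v i s₀) x * weight (√(a - s₀))⁻¹ x)
        + C * (∫ t in s₀..s, ∫ x in closedBall 0 (1 / 2), vsq (fun i => v i t) x)
        + ∫ t in s₀..s, g t := by
  obtain ⟨C, hC, hb⟩ := exists_deriv_energy_bound
  refine ⟨C, hC, fun v P h a ha s₀ hs₀ s hs g hg hfl => ?_⟩
  set D : ℝ → E3 → ℝ := fun t x => (∑ i, 2 * (v i t x * deriv (fun s => v i s x) t))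
      * weight (√(a - t))⁻¹ x + vsq (fun i => v i t) x * ((3 / 2 * (√(a - t))⁻¹ ^ 2
        - (√(a - t))⁻¹ ^ 4 / 4 * ‖x‖ ^ 2) * weight (√(a - t))⁻¹ x) with hD
  have hlt : ∀ t ∈ Icc s₀ s, t < a := fun t ht => by linarith [ht.2, hs.2]
  have cw := continuousOn_weight hlt
  have cb : ContinuousOn (fun q : ℝ × E3 => (√(a - q.1))⁻¹) (Icc s₀ s ×ˢ univ) :=
    ContinuousOn.inv₀ (by fun_prop) fun q hq =>
      (Real.sqrt_pos.2 (by have := hlt q.1 hq.1; linarith)).ne'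
  have cv : ∀ i, Continuous fun q : ℝ × E3 => v i q.1 q.2 := fun i => (h.smooth i).continuous
  have cd : ∀ i, Continuous fun q : ℝ × E3 => deriv (fun s => v i s q.2) q.1 := fun i =>
    (contDiff_uncurry_deriv (h.smooth i)).continuous
  have cs : Continuous fun q : ℝ × E3 => vsq (fun i => v i q.1) q.2 :=
    continuous_uncurry_vsq h.smooth
  have cD : ContinuousOn D.uncurry (Icc s₀ s ×ˢ univ) := by
    have h1 : Continuous fun q : ℝ × E3 => ∑ i, 2 * (v i q.1 q.2 * deriv (fun s => v i s q.2) q.1) := by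
      fun_prop
    have h2 : ContinuousOn (fun q : ℝ × E3 => 3 / 2 * (√(a - q.1))⁻¹ ^ 2
        - (√(a - q.1))⁻¹ ^ 4 / 4 * ‖q.2‖ ^ 2) (Icc s₀ s ×ˢ univ) := by fun_prop
    exact (h1.continuousOn.mul cw).add (cs.continuousOn.mul (h2.mul cw))
  have hD0 : ∀ t x, 1 / 2 ≤ ‖x‖ → D t x = 0 := fun t x hx => by
    simp [hD, weight_eq_zero hx]
  have iF : ∀ t, Integrable fun x => vsq (fun i => v i t) x * weight (√(a - t))⁻¹ x := fun t =>
    ((continuous_vsq (h.slice t)).mul (contDiff_weight _).continuous).integrable_of_hasCompactSupport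
      (hasCompactSupport_of_norm fun x hx => mul_eq_zero_of_right _ (weight_eq_zero hx))
  have hmain := integral_sub_eq_of_hasDerivAt (D := D) (R := 1 / 2)
    (F := fun t x => vsq (fun i => v i t) x * weight (√(a - t))⁻¹ x) hs.1 cD ?_ hD0 (iF s₀) (iF s)
  · have c1 : ContinuousOn (fun t => ∫ x, D t x) (Icc s₀ s) :=
      continuousOn_integral_of_compact_support (isCompact_closedBall 0 (1 / 2)) cD
        fun t x _ hx => hD0 t x (le_of_lt (by simpa using hx))
    have c2 := continuousOn_weighted_dissipation h.smooth hlt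
    rw [← uIcc_of_le hs.1] at c1 c2
    have i1 := c1.intervalIntegrable (μ := volume)
    have i2 := c2.intervalIntegrable (μ := volume)
    have i3 := (continuous_energy h.smooth (1 / 2)).intervalIntegrable (μ := volume) s₀ s
    have hle : (∫ t in s₀..s, ∫ x, D t x) ≤ ∫ t in s₀..s,
        (C * (∫ x in closedBall 0 (1 / 2), vsq (fun i => v i t) x)
        - 2 * (∫ x, gsq (fun i => v i t) x * weight (√(a - t))⁻¹ x) + g t) := by
      refine intervalIntegral.integral_mono_on hs.1 i1
        (((i3.const_mul C).sub (i2.const_mul 2)).add hg) fun t ht => ?_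
      refine (hb v P h t ⟨hs₀.1.trans ht.1, ht.2.trans hs.2⟩ _ (by positivity)).trans ?_
      have := hfl t ⟨ht.1, ht.2.trans hs.2⟩
      linarith
    rw [intervalIntegral.integral_add ((i3.const_mul C).sub (i2.const_mul 2)) hg,
      intervalIntegral.integral_sub (i3.const_mul C) (i2.const_mul 2),
      intervalIntegral.integral_const_mul, intervalIntegral.integral_const_mul] at hle
    linarith
  · intro t ht x
    have h1 : HasDerivAt (fun t => vsq (fun i => v i t) x)
        (∑ i, 2 * (v i t x * deriv (fun s => v i s x) t)) t := by
      unfold vsq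
      refine HasDerivAt.fun_sum fun i _ => ?_
      have h2 : HasDerivAt (fun s => v i s x) (deriv (fun s => v i s x) t) t :=
        ((contDiff_slice_time (h.smooth i) x).differentiable (by simp)).differentiableAt.hasDerivAt
      refine (h2.fun_pow 2).congr_deriv ?_
      ring
    exact (h1.fun_mul (hasDerivAt_weight (hlt t ht) x)).congr_deriv (by ring)

end EnergyInequality

section Iteration

variable {v : Fin 3 → ℝ → E3 → ℝ} {P : ℝ → E3 → ℝ}

lemma exists_dyadic_scale {t : ℝ} (ht : -(1 / 4) ^ 3 ≤ t) {N : ℕ} (hN : 3 ≤ N) :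
    ∃ K, 3 ≤ K ∧ K ≤ N ∧ -(1 / 4) ^ K ≤ t ∧ (K = N ∨ t < -(1 / 4) ^ (K + 1)) := by
  induction N, hN using Nat.le_induction with
  | base => exact ⟨3, le_rfl, le_rfl, ht, Or.inl rfl⟩
  | succ N hN ih =>
    obtain ⟨K, h3, hK, h1, h2⟩ := ih
    rcases h2 with rfl | h2
    · by_cases h : -(1 / 4) ^ (K + 1) ≤ t
      · exact ⟨K + 1, by omega, le_rfl, h, Or.inl rfl⟩
      · exact ⟨K, h3, by omega, h1, Or.inr (not_le.1 h)⟩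
    · exact ⟨K, h3, by omega, h1, Or.inr h2⟩

/-- The energy bounds at the dyadic scale `(1/2)^n`. -/
def EnergyBound (v : Fin 3 → ℝ → E3 → ℝ) (M : ℝ) (n : ℕ) : Prop :=
  (∀ t ∈ Icc (-(1 / 4) ^ n : ℝ) 0,
    ∫ x in closedBall 0 ((1 / 2) ^ n), vsq (fun i => v i t) x ≤ M ^ 2 * (1 / 8) ^ n) ∧
  ∫ t in (-(1 / 4) ^ n : ℝ)..0, ∫ x in closedBall 0 ((1 / 2) ^ n), gsq (fun i => v i t) x
    ≤ M ^ 2 * (1 / 8) ^ n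

/-- The contribution of the dyadic scale `(1/2)^k` to the flux. -/
def fluxDensity (v : Fin 3 → ℝ → E3 → ℝ) (P : ℝ → E3 → ℝ) (M : ℝ) (k : ℕ) (t : ℝ) : ℝ :=
  M ^ 2 * 2 ^ k + 4 ^ k * (∫ x in closedBall 0 (4 * (1 / 2) ^ k), gsq (fun i => v i t) x)
    + ∫ x in closedBall 0 1, |P t x|

lemma fluxDensity_nonneg (M : ℝ) (k : ℕ) (t : ℝ) : 0 ≤ fluxDensity v P M k t := by
  have h1 : 0 ≤ ∫ x in closedBall 0 (4 * (1 / 2) ^ k), gsq (fun i => v i t) x :=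
    integral_nonneg fun x => gsq_nonneg _ x
  have h2 : 0 ≤ ∫ x in closedBall (0 : E3) 1, |P t x| := integral_nonneg fun x => abs_nonneg _
  unfold fluxDensity
  positivity

lemma continuous_fluxDensity (h : IsLocalNS v P) (M : ℝ) (k : ℕ) :
    Continuous (fluxDensity v P M k) :=
  (continuous_const.add (continuous_const.mul (continuous_dissipation h.smooth _))).add
    (continuous_pressure_mass h.smooth_pressure 1)

lemma exists_flux_le : ∃ C : ℝ, 0 < C ∧ ∀ (v : Fin 3 → ℝ → E3 → ℝ) (P : ℝ → E3 → ℝ) (M : ℝ) (N : ℕ),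
    IsLocalNS v P → 0 ≤ M → 3 ≤ N → (∀ j, 1 ≤ j → j ≤ N → EnergyBound v M j) →
    ∀ t ∈ Icc (-(1 / 4) ^ 3 : ℝ) 0, flux v P (√((1 / 4) ^ N - t))⁻¹ t
      ≤ C * M * ∑ k ∈ Finset.Icc 3 N, (Icc (-(1 / 4) ^ k) 0).indicator (fluxDensity v P M k) t := by
  obtain ⟨C, hC, hb⟩ := exists_flux_sum_bound
  refine ⟨C, hC, fun v P M N h hM hN hE t ht => ?_⟩
  obtain ⟨K, h3, hK, h1, h2⟩ := exists_dyadic_scale ht.1 hN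
  have hmono : ∀ k, k ≤ K → -(1 / 4) ^ k ≤ t := fun k hk =>
    (neg_le_neg (pow_le_pow_of_le_one (by norm_num) (by norm_num) hk)).trans h1
  have ht' : t ∈ Icc (-(1 / 4) : ℝ) 0 := ⟨by linarith [hmono 1 (by omega)], ht.2⟩
  have hs : (1 / 2) ^ (K + 1) ≤ √((1 / 4) ^ N - t) := by
    refine Real.le_sqrt_of_sq_le ?_
    have e : ((1 / 2 : ℝ) ^ (K + 1)) ^ 2 = (1 / 4) ^ (K + 1) := by
      rw [← pow_mul, mul_comm, pow_mul]; norm_num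
    rw [e]
    have p1 : (0 : ℝ) < (1 / 4) ^ N := by positivity
    rcases h2 with rfl | h2
    · have : (1 / 4 : ℝ) ^ (K + 1) ≤ (1 / 4) ^ K :=
        pow_le_pow_of_le_one (by norm_num) (by norm_num) (by omega)
      linarith [ht.2]
    · linarith
  have hsp : 0 < √((1 / 4) ^ N - t) := lt_of_lt_of_le (by positivity) hs
  have hKb : (1 / 2) ^ K * (√((1 / 4) ^ N - t))⁻¹ ≤ 4 := by
    rw [← div_eq_mul_inv, div_le_iff₀ hsp]
    rw [pow_succ] at hs
    linarith
  refine (le_abs_self _).trans ((hb (fun i => v i t) (P t) M _ K (h.slice t)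
    (contDiff_slice_space h.smooth_pressure t).continuous (h.isWeakPressure ht')
    (fun _ hx => h.div ht' hx) h3 hM (fun j hj hjK => (hE j hj (hjK.trans hK)).1 t
      ⟨hmono j hjK, ht.2⟩) (by positivity) hKb).trans ?_)
  refine mul_le_mul_of_nonneg_left ?_ (by positivity)
  calc _ = ∑ k ∈ Finset.Icc 3 K, (Icc (-(1 / 4) ^ k) 0).indicator (fluxDensity v P M k) t := by
        refine Finset.sum_congr rfl fun k hk => ?_
        have hm : t ∈ Icc (-(1 / 4) ^ k : ℝ) 0 := ⟨hmono k (Finset.mem_Icc.1 hk).2, ht.2⟩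
        rw [indicator_of_mem hm]
        rfl
    _ ≤ _ := Finset.sum_le_sum_of_subset_of_nonneg (Finset.Icc_subset_Icc le_rfl hK)
        fun k _ _ => indicator_nonneg (fun t _ => fluxDensity_nonneg M k t) t

lemma integral_indicator_fluxDensity (M : ℝ) {k : ℕ} (hk : 3 ≤ k) :
    ∫ t in (-(1 / 4) ^ 3 : ℝ)..0, (Icc (-(1 / 4) ^ k) 0).indicator (fluxDensity v P M k) t
      = ∫ t in (-(1 / 4) ^ k : ℝ)..0, fluxDensity v P M k t := by
  have h1 : (1 / 4 : ℝ) ^ k ≤ (1 / 4) ^ 3 := pow_le_pow_of_le_one (by norm_num) (by norm_num) hk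
  have h2 : (0 : ℝ) < (1 / 4) ^ k := by positivity
  rw [intervalIntegral.integral_of_le (by linarith), intervalIntegral.integral_of_le (by linarith),
    ← integral_Icc_eq_integral_Ioc, ← integral_Icc_eq_integral_Ioc,
    setIntegral_indicator measurableSet_Icc, inter_eq_right.2 (Icc_subset_Icc (by linarith) le_rfl)]

lemma intervalIntegrable_indicator_fluxDensity (h : IsLocalNS v P) (M : ℝ) (k : ℕ) (a b : ℝ) :
    IntervalIntegrable ((Icc (-(1 / 4) ^ k) 0).indicator (fluxDensity v P M k)) volume a b := by
  have := (continuous_fluxDensity h M k).intervalIntegrable (μ := volume) a b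
  exact ⟨this.1.indicator measurableSet_Icc, this.2.indicator measurableSet_Icc⟩

lemma integral_fluxDensity_le (h : IsLocalNS v P) (M : ℝ) (j : ℕ) (hE : EnergyBound v M j) :
    ∫ t in (-(1 / 4) ^ (j + 2) : ℝ)..0, fluxDensity v P M (j + 2) t
      ≤ 65 * M ^ 2 * (1 / 2) ^ (j + 2)
        + ∫ t in (-(1 / 4) ^ (j + 2) : ℝ)..0, ∫ x in closedBall 0 1, |P t x| := by
  have e : (4 : ℝ) * (1 / 2) ^ (j + 2) = (1 / 2) ^ j := by rw [pow_add]; ring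
  have c1 := continuous_dissipation h.smooth ((1 / 2) ^ j)
  have c2 := continuous_pressure_mass h.smooth_pressure 1
  have hpos : (0 : ℝ) < (1 / 4) ^ (j + 2) := by positivity
  have h1 : (∫ t in (-(1 / 4) ^ (j + 2) : ℝ)..0, ∫ x in closedBall 0 ((1 / 2) ^ j),
      gsq (fun i => v i t) x) ≤ M ^ 2 * (1 / 8) ^ j := by
    refine le_trans (intervalIntegral.integral_mono_interval ?_ (by linarith) le_rfl
      (Filter.Eventually.of_forall fun t => integral_nonneg fun x => gsq_nonneg _ x)
      (c1.intervalIntegrable _ _)) hE.2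
    exact neg_le_neg (pow_le_pow_of_le_one (by norm_num) (by norm_num) (by omega))
  have i1 := (c1.intervalIntegrable (μ := volume) (-(1 / 4) ^ (j + 2)) 0).const_mul (4 ^ (j + 2))
  have i2 := c2.intervalIntegrable (μ := volume) (-(1 / 4) ^ (j + 2)) 0
  unfold fluxDensity
  rw [e, intervalIntegral.integral_add (intervalIntegrable_const.add i1) i2,
    intervalIntegral.integral_add intervalIntegrable_const i1,
    intervalIntegral.integral_const_mul, intervalIntegral.integral_const_mul,
    intervalIntegral.integral_const]
  have e1 : (4 : ℝ) ^ (j + 2) * (M ^ 2 * (1 / 8) ^ j) = 64 * M ^ 2 * (1 / 2) ^ (j + 2) := by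
    have : (4 : ℝ) ^ j * (1 / 8) ^ j = (1 / 2) ^ j := by rw [← mul_pow]; norm_num
    rw [pow_add, pow_add, ← this]; ring
  have e2 : M ^ 2 * (0 - -(1 / 4 : ℝ) ^ (j + 2)) • (2 : ℝ) ^ (j + 2) = M ^ 2 * (1 / 2) ^ (j + 2) := by
    have : (1 / 4 : ℝ) ^ (j + 2) * 2 ^ (j + 2) = (1 / 2) ^ (j + 2) := by rw [← mul_pow]; norm_num
    rw [← this, smul_eq_mul]; ring
  rw [e2]
  have := mul_le_mul_of_nonneg_left h1 (show (0 : ℝ) ≤ 4 ^ (j + 2) by positivity)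
  linarith

lemma integrable_mul_weight {f : E3 → ℝ} (hf : Continuous f) (b : ℝ) :
    Integrable fun x => f x * weight b x :=
  (hf.mul (contDiff_weight b).continuous).integrable_of_hasCompactSupport
    (hasCompactSupport_of_norm fun _ hx => mul_eq_zero_of_right _ (weight_eq_zero hx))

lemma integral_mul_weight_le {f : E3 → ℝ} (hf : Continuous f) (h0 : ∀ x, 0 ≤ f x) {b : ℝ}
    (hb : 0 ≤ b) : ∫ x, f x * weight b x ≤ b ^ 3 * ∫ x in closedBall 0 (1 / 2), f x := by
  rw [← setIntegral_eq_integral_of_forall_compl_eq_zero (s := closedBall 0 (1 / 2))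
    fun x hx => mul_eq_zero_of_right _ (weight_eq_zero (le_of_lt (by simpa using hx))),
    ← integral_const_mul]
  refine setIntegral_mono (integrable_mul_weight hf b).integrableOn
    ((integrableOn_closedBall hf _).const_mul _) fun x => ?_
  rw [mul_comm]
  exact mul_le_mul_of_nonneg_right (weight_le hb x) (h0 x)

lemma le_integral_mul_weight {f : E3 → ℝ} (hf : Continuous f) (h0 : ∀ x, 0 ≤ f x) {b c r : ℝ}
    (hb : 0 ≤ b) (hc : ∀ x ∈ closedBall 0 r, c ≤ weight b x) :
    c * ∫ x in closedBall 0 r, f x ≤ ∫ x, f x * weight b x := by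
  rw [← integral_const_mul]
  refine (setIntegral_mono_on ((integrableOn_closedBall hf _).const_mul _)
    (integrable_mul_weight hf b).integrableOn measurableSet_closedBall fun x hx => ?_).trans
    (setIntegral_le_integral (integrable_mul_weight hf b)
      (Filter.Eventually.of_forall fun x => mul_nonneg (h0 x) (weight_nonneg hb x)))
  rw [mul_comm]
  exact mul_le_mul_of_nonneg_left (hc x hx) (h0 x)

lemma sum_Icc_half_pow_le (N : ℕ) : ∑ k ∈ Finset.Icc 3 N, (1 / 2 : ℝ) ^ k ≤ 2 :=
  (Summable.sum_le_tsum _ (fun _ _ => by positivity) summable_geometric_two).trans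
    tsum_geometric_two.le

/-- The energy inequality against the Gaussian weight concentrated at the scale `(1/2)^N`. -/
lemma exists_weighted_energy_bound : ∃ C : ℝ, 0 < C ∧
    ∀ (v : Fin 3 → ℝ → E3 → ℝ) (P : ℝ → E3 → ℝ) (M E T : ℝ) (N : ℕ),
    IsLocalNS v P → 0 ≤ M → 3 ≤ N → (∀ j, 1 ≤ j → j ≤ N → EnergyBound v M j) →
    (∀ t ∈ Icc (-(1 / 4) : ℝ) 0, ∫ x in closedBall 0 (1 / 2), vsq (fun i => v i t) x ≤ E) →
    ∑ k ∈ Finset.Icc 3 N, (∫ t in (-(1 / 4) ^ k : ℝ)..0, ∫ x in closedBall 0 1, |P t x|) ≤ T →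
    ∀ s ∈ Icc (-(1 / 4) ^ 3 : ℝ) 0,
    (∫ x, vsq (fun i => v i s) x * weight (√((1 / 4) ^ N - s))⁻¹ x)
      + 2 * (∫ t in (-(1 / 4) ^ 3 : ℝ)..s, ∫ x, gsq (fun i => v i t) x
        * weight (√((1 / 4) ^ N - t))⁻¹ x) ≤ C * (E + M ^ 3 + M * T) := by
  obtain ⟨C₁, hC₁, h1⟩ := exists_energy_inequality
  obtain ⟨C₂, hC₂, h2⟩ := exists_flux_le
  refine ⟨512 + C₁ + 130 * C₂, by positivity, fun v P M E T N h hM hN hE hA hT s hs => ?_⟩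
  have hq : ∀ t, t ∈ Icc (-(1 / 4) ^ 3 : ℝ) 0 → t ∈ Icc (-(1 / 4) : ℝ) 0 := fun t ht =>
    ⟨le_trans (by norm_num) ht.1, ht.2⟩
  have hs3 : (-(1 / 4) ^ 3 : ℝ) ∈ Icc (-(1 / 4) ^ 3 : ℝ) 0 := ⟨le_rfl, by norm_num⟩
  have hE0 : 0 ≤ E := le_trans (integral_nonneg fun x => vsq_nonneg _ x) (hA 0 (by norm_num))
  have h_intg := fun k a b => intervalIntegrable_indicator_fluxDensity h M k a b
  have hgint : ∀ b, IntervalIntegrable (fun t => C₂ * M * ∑ k ∈ Finset.Icc 3 N,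
      (Icc (-(1 / 4) ^ k) 0).indicator (fluxDensity v P M k) t) volume (-(1 / 4) ^ 3) b := fun b => by
    have := (IntervalIntegrable.sum (Finset.Icc 3 N) fun k _ => h_intg k (-(1 / 4) ^ 3) b).const_mul
      (C₂ * M)
    simpa only [Finset.sum_apply] using this
  have hmain := h1 v P h ((1 / 4) ^ N) (by positivity) _ (hq _ hs3) s hs _ (hgint s)
    (h2 v P M N h hM hN hE)
  have b1 : (∫ x, vsq (fun i => v i (-(1 / 4) ^ 3)) x
      * weight (√((1 / 4) ^ N - -(1 / 4) ^ 3))⁻¹ x) ≤ 512 * E := by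
    have hsq : (1 / 8 : ℝ) ≤ √((1 / 4) ^ N - -(1 / 4) ^ 3) := by
      refine Real.le_sqrt_of_sq_le ?_
      have : (0 : ℝ) < (1 / 4) ^ N := by positivity
      linarith
    have hb8 : (√((1 / 4 : ℝ) ^ N - -(1 / 4) ^ 3))⁻¹ ≤ 8 := by
      rw [inv_le_comm₀ (by linarith) (by norm_num)]; linarith
    refine (integral_mul_weight_le (continuous_vsq (h.slice _)) (vsq_nonneg _)
      (by positivity)).trans ?_
    refine mul_le_mul ((pow_le_pow_left₀ (by positivity) hb8 3).trans (by norm_num))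
      (hA _ (hq _ hs3)) (integral_nonneg fun x => vsq_nonneg _ x) (by norm_num)
  have b2 : (∫ t in (-(1 / 4) ^ 3 : ℝ)..s, ∫ x in closedBall 0 (1 / 2), vsq (fun i => v i t) x)
      ≤ E := by
    have := intervalIntegral.integral_mono_on hs.1
      ((continuous_energy h.smooth (1 / 2)).intervalIntegrable (μ := volume) _ _)
      (intervalIntegrable_const (c := E)) fun t ht => hA t (hq t ⟨ht.1, ht.2.trans hs.2⟩)
    rw [intervalIntegral.integral_const, smul_eq_mul] at this
    have h3 : s - -(1 / 4) ^ 3 ≤ 1 := by linarith [hs.2]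
    nlinarith
  have b3 : (∫ t in (-(1 / 4) ^ 3 : ℝ)..s, C₂ * M * ∑ k ∈ Finset.Icc 3 N,
      (Icc (-(1 / 4) ^ k) 0).indicator (fluxDensity v P M k) t)
      ≤ C₂ * M * (130 * M ^ 2 + T) := by
    refine le_trans (intervalIntegral.integral_mono_interval le_rfl hs.1 hs.2
      (Filter.Eventually.of_forall fun t => ?_) (hgint 0)) ?_
    · exact mul_nonneg (by positivity) (Finset.sum_nonneg fun k _ =>
        indicator_nonneg (fun t _ => fluxDensity_nonneg M k t) t)
    rw [intervalIntegral.integral_const_mul,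
      intervalIntegral.integral_finsetSum fun k _ => h_intg k _ _]
    refine mul_le_mul_of_nonneg_left ?_ (by positivity)
    calc _ ≤ ∑ k ∈ Finset.Icc 3 N, (65 * M ^ 2 * (1 / 2) ^ k
          + ∫ t in (-(1 / 4) ^ k : ℝ)..0, ∫ x in closedBall 0 1, |P t x|) := by
          refine Finset.sum_le_sum fun k hk => ?_
          obtain ⟨hk3, hkN⟩ := Finset.mem_Icc.1 hk
          rw [integral_indicator_fluxDensity M hk3]
          obtain ⟨j, rfl⟩ : ∃ j, k = j + 2 := ⟨k - 2, by omega⟩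
          exact integral_fluxDensity_le h M j (hE j (by omega) (by omega))
      _ ≤ _ := by
          rw [Finset.sum_add_distrib, ← Finset.mul_sum]
          have := mul_le_mul_of_nonneg_left (sum_Icc_half_pow_le N)
            (show 0 ≤ 65 * M ^ 2 by positivity)
          linarith
  have hT0 : 0 ≤ T := le_trans (Finset.sum_nonneg fun k _ => intervalIntegral.integral_nonneg
    (neg_nonpos.2 (by positivity)) fun t _ => integral_nonneg fun x => abs_nonneg _) hT
  have m3 : 0 ≤ M ^ 3 := by positivity
  have mT : 0 ≤ M * T := by positivity
  have h5 := mul_le_mul_of_nonneg_left b2 hC₁.le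
  calc _ ≤ 512 * E + C₁ * E + C₂ * M * (130 * M ^ 2 + T) := by linarith
    _ ≤ _ := by
      have : 0 ≤ 512 * (M ^ 3 + M * T) + C₁ * (M ^ 3 + M * T) + 130 * C₂ * E
        + 129 * C₂ * (M * T) := by positivity
      nlinarith

end Iteration

section Induction

variable {v : Fin 3 → ℝ → E3 → ℝ} {P : ℝ → E3 → ℝ}

lemma le_weight {N : ℕ} (hN : 3 ≤ N) {s : ℝ} (hs : s ∈ Icc (-(1 / 4) ^ (N + 1) : ℝ) 0) {x : E3}
    (hx : x ∈ closedBall (0 : E3) ((1 / 2) ^ (N + 1))) :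
    8 ^ (N + 1) / 128 ≤ weight (√((1 / 4) ^ N - s))⁻¹ x := by
  have hx : ‖x‖ ≤ (1 / 2) ^ (N + 1) := by simpa using hx
  have e4 : ((1 / 2 : ℝ) ^ N) ^ 2 = (1 / 4) ^ N := by
    rw [← pow_mul, mul_comm, pow_mul]; norm_num
  have p4 : (0 : ℝ) < (1 / 4) ^ N := by positivity
  have p2 : (0 : ℝ) < (1 / 2) ^ N := by positivity
  have q1 : (1 / 2) ^ N ≤ √((1 / 4) ^ N - s) := by
    refine Real.le_sqrt_of_sq_le ?_
    rw [e4]; linarith [hs.2]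
  have q2 : √((1 / 4) ^ N - s) ≤ 2 * (1 / 2) ^ N := by
    rw [Real.sqrt_le_left (by positivity), mul_pow, e4]
    have := hs.1
    rw [pow_succ] at this
    linarith
  have hp : 0 < √((1 / 4) ^ N - s) := p2.trans_le q1
  set b := (√((1 / 4) ^ N - s))⁻¹ with hb
  have hb0 : 0 < b := inv_pos.2 hp
  have h2N : (2 : ℝ) ^ N * (1 / 2) ^ N = 1 := by rw [← mul_pow]; norm_num
  have b1 : 2 ^ N / 2 ≤ b := by
    rw [hb, le_inv_comm₀ (by positivity) hp]
    refine q2.trans (le_of_eq ?_)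
    rw [eq_comm, inv_eq_of_mul_eq_one_right]
    linear_combination h2N
  have b2 : b * ‖x‖ ≤ 1 / 2 := by
    rw [hb, inv_mul_le_iff₀ hp]
    rw [pow_succ] at hx
    linarith
  have h1 : 15 / 16 ≤ Real.exp (-(b ^ 2 / 4 * ‖x‖ ^ 2)) := by
    have h3 : b ^ 2 / 4 * ‖x‖ ^ 2 ≤ 1 / 16 := by
      have := pow_le_pow_left₀ (by positivity) b2 2
      rw [mul_pow] at this
      linarith
    linarith [Real.add_one_le_exp (-(b ^ 2 / 4 * ‖x‖ ^ 2))]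
  have h2 : cutoff ((1 / 2) ^ 3) x = 1 := by
    refine cutoff_eq_one (by norm_num) (hx.trans ?_)
    refine (pow_le_pow_of_le_one (by norm_num) (by norm_num) (show 4 ≤ N + 1 by omega)).trans ?_
    norm_num
  unfold weight gauss
  rw [h2, mul_one]
  have h3 := pow_le_pow_left₀ (by positivity) b1 3
  have e8 : ((2 : ℝ) ^ N / 2) ^ 3 = 8 ^ N / 8 := by
    rw [div_pow, ← pow_mul, mul_comm, pow_mul]; norm_num
  rw [e8] at h3
  have p8 : (0 : ℝ) < 8 ^ N := by positivity
  calc (8 : ℝ) ^ (N + 1) / 128 = 8 ^ N / 8 * (1 / 2) := by rw [pow_succ]; ring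
    _ ≤ _ := by gcongr; linarith

lemma exists_energyBound_succ : ∃ C : ℝ, 0 < C ∧
    ∀ (v : Fin 3 → ℝ → E3 → ℝ) (P : ℝ → E3 → ℝ) (M E T : ℝ) (N : ℕ),
    IsLocalNS v P → 0 ≤ M → 3 ≤ N → (∀ j, 1 ≤ j → j ≤ N → EnergyBound v M j) →
    (∀ t ∈ Icc (-(1 / 4) : ℝ) 0, ∫ x in closedBall 0 (1 / 2), vsq (fun i => v i t) x ≤ E) →
    ∑ k ∈ Finset.Icc 3 N, (∫ t in (-(1 / 4) ^ k : ℝ)..0, ∫ x in closedBall 0 1, |P t x|) ≤ T →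
    C * (E + M ^ 3 + M * T) ≤ M ^ 2 → EnergyBound v M (N + 1) := by
  obtain ⟨C, hC, hb⟩ := exists_weighted_energy_bound
  refine ⟨128 * C, by positivity, fun v P M E T N h hM hN hE hA hT hM2 => ?_⟩
  have hmain := hb v P M E T N h hM hN hE hA hT
  have e8 : (8 : ℝ) ^ (N + 1) * (1 / 8) ^ (N + 1) = 1 := by rw [← mul_pow]; norm_num
  have p8 : (0 : ℝ) < 8 ^ (N + 1) := by positivity
  have pN : (0 : ℝ) < (1 / 4) ^ N := by positivity
  have hN3 : (1 / 4 : ℝ) ^ (N + 1) ≤ (1 / 4) ^ 3 :=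
    pow_le_pow_of_le_one (by norm_num) (by norm_num) (by omega)
  have pN1 : (0 : ℝ) < (1 / 4) ^ (N + 1) := by positivity
  have conv : ∀ X : ℝ, 8 ^ (N + 1) / 128 * X ≤ C * (E + M ^ 3 + M * T) →
      X ≤ M ^ 2 * (1 / 8) ^ (N + 1) := by
    intro X hX
    have : 8 ^ (N + 1) * X ≤ M ^ 2 := by linarith
    have := mul_le_mul_of_nonneg_right this (show (0 : ℝ) ≤ (1 / 8) ^ (N + 1) by positivity)
    calc X = (8 ^ (N + 1) * (1 / 8) ^ (N + 1)) * X := by rw [e8, one_mul]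
      _ ≤ _ := by linarith
  have hnn : ∀ t, 0 ≤ ∫ x, gsq (fun i => v i t) x * weight (√((1 / 4) ^ N - t))⁻¹ x := fun t =>
    integral_nonneg fun x => mul_nonneg (gsq_nonneg _ x) (weight_nonneg (by positivity) x)
  refine ⟨fun t ht => conv _ ?_, conv _ ?_⟩
  · have ht3 : t ∈ Icc (-(1 / 4) ^ 3 : ℝ) 0 := ⟨by linarith [ht.1], ht.2⟩
    refine (le_integral_mul_weight (continuous_vsq (h.slice t)) (vsq_nonneg _) (by positivity)
      fun x hx => le_weight hN ht hx).trans ?_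
    have h1 := hmain t ht3
    have h2 := intervalIntegral.integral_nonneg ht3.1 (μ := volume) fun t _ => hnn t
    linarith
  · have h0 : (0 : ℝ) ∈ Icc (-(1 / 4) ^ 3 : ℝ) 0 := ⟨by norm_num, le_rfl⟩
    have h1 := hmain 0 h0
    have h2 : 0 ≤ ∫ x, vsq (fun i => v i 0) x * weight (√((1 / 4) ^ N - 0))⁻¹ x :=
      integral_nonneg fun x => mul_nonneg (vsq_nonneg _ x) (weight_nonneg (by positivity) x)
    have c1 : ContinuousOn (fun t => ∫ x, gsq (fun i => v i t) x
        * weight (√((1 / 4) ^ N - t))⁻¹ x) (uIcc (-(1 / 4) ^ 3) 0) :=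
      continuousOn_weighted_dissipation h.smooth fun t ht => by
        rw [uIcc_of_le (by norm_num)] at ht; linarith [ht.2]
    have i1 := c1.intervalIntegrable (μ := volume)
    have i2 : IntervalIntegrable (fun t => ∫ x, gsq (fun i => v i t) x
        * weight (√((1 / 4) ^ N - t))⁻¹ x) volume (-(1 / 4) ^ (N + 1)) 0 := by
      refine i1.mono_set ?_
      rw [uIcc_of_le (by linarith), uIcc_of_le (by norm_num)]
      exact Icc_subset_Icc (by linarith) le_rfl
    have h3 := intervalIntegral.integral_mono_interval (neg_le_neg hN3) (by linarith) le_rfl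
      (Filter.Eventually.of_forall hnn) i1
    rw [← intervalIntegral.integral_const_mul]
    have h4 := intervalIntegral.integral_mono_on (by linarith)
      (((continuous_dissipation h.smooth ((1 / 2) ^ (N + 1))).intervalIntegrable
        (μ := volume) (-(1 / 4) ^ (N + 1)) 0).const_mul (8 ^ (N + 1) / 128)) i2 fun t ht =>
      le_integral_mul_weight (continuous_gsq (h.slice t)) (gsq_nonneg _) (by positivity)
        fun x hx => le_weight hN ht hx
    have h5 := intervalIntegral.integral_nonneg h0.1 (μ := volume) fun t _ => hnn t
    linarith

lemma energyBound_of_le (h : IsLocalNS v P) {M E : ℝ} {n : ℕ} (hn : 1 ≤ n) (hn3 : n ≤ 3)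
    (hA : ∀ t ∈ Icc (-(1 / 4) : ℝ) 0, ∫ x in closedBall 0 (1 / 2), vsq (fun i => v i t) x ≤ E)
    (hG : ∫ t in (-(1 / 4) : ℝ)..0, ∫ x in closedBall 0 (1 / 2), gsq (fun i => v i t) x ≤ E)
    (hE : 512 * E ≤ M ^ 2) : EnergyBound v M n := by
  have h4 : (1 / 4 : ℝ) ^ n ≤ 1 / 4 := pow_le_of_le_one (by norm_num) (by norm_num) (by omega)
  have h2 : (1 / 2 : ℝ) ^ n ≤ 1 / 2 := pow_le_of_le_one (by norm_num) (by norm_num) (by omega)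
  have h8 : (1 / 8 : ℝ) ^ 3 ≤ (1 / 8) ^ n :=
    pow_le_pow_of_le_one (by norm_num) (by norm_num) hn3
  have p4 : (0 : ℝ) < (1 / 4) ^ n := by positivity
  have hEn : E ≤ M ^ 2 * (1 / 8) ^ n := by
    have := mul_le_mul_of_nonneg_left h8 (sq_nonneg M)
    linarith
  refine ⟨fun t ht => ?_, ?_⟩
  · exact ((setIntegral_closedBall_mono (continuous_vsq (h.slice t)) (vsq_nonneg _) h2).trans
      (hA t ⟨by linarith [ht.1], ht.2⟩)).trans hEn
  · refine le_trans (le_trans (intervalIntegral.integral_mono_on (by linarith)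
      ((continuous_dissipation h.smooth _).intervalIntegrable _ _)
      ((continuous_dissipation h.smooth _).intervalIntegrable _ _) fun t _ =>
      setIntegral_closedBall_mono (continuous_gsq (h.slice t)) (gsq_nonneg _) h2) ?_) (hG.trans hEn)
    exact intervalIntegral.integral_mono_interval (neg_le_neg h4) (by linarith) le_rfl
      (Filter.Eventually.of_forall fun t => integral_nonneg fun x => gsq_nonneg _ x)
      ((continuous_dissipation h.smooth _).intervalIntegrable _ _)

lemma exists_energyBound : ∃ C : ℝ, 0 < C ∧
    ∀ (v : Fin 3 → ℝ → E3 → ℝ) (P : ℝ → E3 → ℝ) (M E T : ℝ),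
    IsLocalNS v P → 0 ≤ M →
    (∀ t ∈ Icc (-(1 / 4) : ℝ) 0, ∫ x in closedBall 0 (1 / 2), vsq (fun i => v i t) x ≤ E) →
    ∫ t in (-(1 / 4) : ℝ)..0, ∫ x in closedBall 0 (1 / 2), gsq (fun i => v i t) x ≤ E →
    (∀ N, ∑ k ∈ Finset.Icc 3 N, (∫ t in (-(1 / 4) ^ k : ℝ)..0,
      ∫ x in closedBall 0 1, |P t x|) ≤ T) →
    512 * E ≤ M ^ 2 → C * (E + M ^ 3 + M * T) ≤ M ^ 2 → ∀ n, 1 ≤ n → EnergyBound v M n := by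
  obtain ⟨C, hC, hb⟩ := exists_energyBound_succ
  refine ⟨C, hC, fun v P M E T h hM hA hG hT hE hM2 n => ?_⟩
  induction n using Nat.strong_induction_on with
  | _ n ih =>
    intro hn
    by_cases hn3 : n ≤ 3
    · exact energyBound_of_le h hn hn3 hA hG hE
    · obtain ⟨N, rfl⟩ : ∃ N, n = N + 1 := ⟨n - 1, by omega⟩
      exact hb v P M E T N h hM (by omega) (fun j hj hjN => ih j (by omega) hj) hA (hT N) hM2

lemma volume_mul_vsq_zero_le {w : Fin 3 → E3 → ℝ} (hw : ∀ i, ContDiff ℝ ∞ (w i)) {M : ℝ}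
    (h : ∀ n, 1 ≤ n → ∫ x in closedBall 0 ((1 / 2) ^ n), vsq w x ≤ M ^ 2 * (1 / 8) ^ n) :
    volume.real (closedBall (0 : E3) 1) * vsq w 0 ≤ M ^ 2 := by
  set V := volume.real (closedBall (0 : E3) 1) with hV
  have hV0 : 0 < V :=
    ENNReal.toReal_pos (measure_closedBall_pos _ _ one_pos).ne' measure_closedBall_lt_top.ne
  by_contra! hlt
  rw [mul_comm, ← div_lt_iff₀ hV0] at hlt
  obtain ⟨q, hq1, hq2⟩ := exists_between hlt
  have hc := continuous_vsq hw
  obtain ⟨δ, hδ, hball⟩ := Metric.eventually_nhds_iff.1 (hc.continuousAt.eventually (lt_mem_nhds hq2))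
  obtain ⟨m, hm⟩ := exists_pow_lt_of_lt_one hδ (show (1 / 2 : ℝ) < 1 by norm_num)
  have hn : (1 / 2 : ℝ) ^ (m + 1) < δ := by
    rw [pow_succ]; have : (0 : ℝ) < (1 / 2) ^ m := by positivity
    linarith
  have h1 := h (m + 1) (by omega)
  have h2 : volume.real (closedBall (0 : E3) ((1 / 2) ^ (m + 1))) * q
      ≤ ∫ x in closedBall 0 ((1 / 2) ^ (m + 1)), vsq w x := by
    rw [← smul_eq_mul, ← setIntegral_const]
    refine setIntegral_mono_on (integrableOn_closedBall continuous_const _)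
      (integrableOn_closedBall hc _) measurableSet_closedBall fun x hx => (hball ?_).le
    exact lt_of_le_of_lt (mem_closedBall.1 hx) hn
  rw [volume_real_closedBall (by positivity)] at h2
  have e : ((1 / 2 : ℝ) ^ (m + 1)) ^ 3 = (1 / 8) ^ (m + 1) := by
    rw [← pow_mul, mul_comm, pow_mul]; norm_num
  rw [e, ← hV] at h2
  rw [div_lt_iff₀ hV0] at hq1
  have p8 : (0 : ℝ) < (1 / 8) ^ (m + 1) := by positivity
  nlinarith

lemma le_add_rpow_mul_rpow {p x l : ℝ} (hp : 1 ≤ p) (hx : 0 ≤ x) (hl : 0 < l) :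
    x ≤ l + l ^ (1 - p) * x ^ p := by
  have h0 : 0 ≤ l ^ (1 - p) * x ^ p := by positivity
  rcases le_or_gt x l with h | h
  · linarith
  · have hx0 : 0 < x := hl.trans h
    have h1 : x ^ (1 - p) ≤ l ^ (1 - p) := Real.rpow_le_rpow_of_nonpos hl h.le (by linarith)
    have h2 : x ^ (1 - p) * x ^ p = x := by
      rw [← Real.rpow_add hx0, sub_add_cancel, Real.rpow_one]
    have h3 := mul_le_mul_of_nonneg_right h1 (show 0 ≤ x ^ p by positivity)
    linarith

lemma integral_le_of_integral_rpow_le {p η μ : ℝ} (hp : 1 < p) (hμ : 0 < μ) {f : ℝ → ℝ}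
    (hf : Continuous f) (h0 : ∀ t, 0 ≤ f t) (h : ∫ t in (-(1 / 4) : ℝ)..0, f t ^ p ≤ η) {k : ℕ}
    (hk : 1 ≤ k) : ∫ t in (-(1 / 4) ^ k : ℝ)..0, f t
      ≤ (4 ^ (1 / p) / 4 : ℝ) ^ k * (μ + μ ^ (1 - p) * η) := by
  have hp0 : 0 < p := by linarith
  set L : ℝ := 4 ^ (1 / p) with hL
  have hL0 : 0 < L := by positivity
  have hLp : L ^ (1 - p) = L / 4 := by
    rw [hL, ← Real.rpow_mul (by norm_num), show 1 / p * (1 - p) = 1 / p - 1 by field_simp,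
      Real.rpow_sub_one (by norm_num)]
  have hl : 0 < μ * L ^ k := by positivity
  have hl2 : (μ * L ^ k) ^ (1 - p) = μ ^ (1 - p) * (L / 4) ^ k := by
    rw [Real.mul_rpow hμ.le (by positivity), ← Real.rpow_natCast, ← Real.rpow_mul hL0.le, mul_comm
      (k : ℝ), Real.rpow_mul hL0.le, hLp, Real.rpow_natCast]
  have cp : Continuous fun t => f t ^ p := hf.rpow_const fun _ => Or.inr hp0.le
  have p4 : (0 : ℝ) < (1 / 4) ^ k := by positivity
  have h4 : (1 / 4 : ℝ) ^ k ≤ 1 / 4 := pow_le_of_le_one (by norm_num) (by norm_num) (by omega)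
  have ip := (cp.intervalIntegrable (μ := volume) (-(1 / 4) ^ k) 0).const_mul
    (μ ^ (1 - p) * (L / 4) ^ k)
  have h1 := intervalIntegral.integral_mono_on (by linarith)
    (hf.intervalIntegrable (μ := volume) (-(1 / 4) ^ k) 0)
    ((intervalIntegrable_const (c := μ * L ^ k)).add ip) fun t _ => by
      have := le_add_rpow_mul_rpow hp.le (h0 t) hl
      rw [hl2] at this
      exact this
  have h2 : ∫ t in (-(1 / 4) ^ k : ℝ)..0, f t ^ p ≤ η := le_trans
    (intervalIntegral.integral_mono_interval (neg_le_neg h4) (by linarith) le_rfl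
      (Filter.Eventually.of_forall fun t => Real.rpow_nonneg (h0 t) p) (cp.intervalIntegrable _ _)) h
  rw [intervalIntegral.integral_add intervalIntegrable_const ip, intervalIntegral.integral_const,
    intervalIntegral.integral_const_mul, smul_eq_mul] at h1
  have h3 := mul_le_mul_of_nonneg_left h2 (show 0 ≤ μ ^ (1 - p) * (L / 4) ^ k by positivity)
  have e : (0 - -(1 / 4 : ℝ) ^ k) * (μ * L ^ k) = (L / 4) ^ k * μ := by
    rw [div_eq_mul_one_div L 4, mul_pow]; ring
  rw [e] at h1
  linarith

/-- Local smallness at the space-time origin for globally smooth fields. -/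
lemma exists_vsq_zero_le_one {p : ℝ} (hp : 1 < p) : ∃ η : ℝ, 0 < η ∧
    ∀ (v : Fin 3 → ℝ → E3 → ℝ) (P : ℝ → E3 → ℝ), IsLocalNS v P →
    (∀ t ∈ Icc (-(1 / 4) : ℝ) 0, ∫ x in closedBall 0 (1 / 2), vsq (fun i => v i t) x ≤ η) →
    ∫ t in (-(1 / 4) : ℝ)..0, ∫ x in closedBall 0 (1 / 2), gsq (fun i => v i t) x ≤ η →
    ∫ t in (-(1 / 4) : ℝ)..0, (∫ x in closedBall 0 1, |P t x|) ^ p ≤ η →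
    vsq (fun i => v i 0) 0 ≤ 1 := by
  obtain ⟨C, hC, hb⟩ := exists_energyBound
  set V := volume.real (closedBall (0 : E3) 1) with hV
  have hV0 : 0 < V :=
    ENNReal.toReal_pos (measure_closedBall_pos _ _ one_pos).ne' measure_closedBall_lt_top.ne
  set θ : ℝ := 4 ^ (1 / p) / 4 with hθ
  have hθ0 : 0 ≤ θ := by positivity
  have hθ1 : θ < 1 := by
    rw [hθ, div_lt_one (by norm_num)]
    exact Real.rpow_lt_self_of_one_lt (by norm_num) ((div_lt_one (by linarith)).2 hp)
  set S := ∑' k : ℕ, θ ^ k with hS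
  have hsum : Summable fun k : ℕ => θ ^ k := summable_geometric_of_lt_one hθ0 hθ1
  have hS0 : 0 < S := hsum.tsum_pos (fun k => by positivity) 0 (by simp)
  set M := min (1 / (4 * C)) (min 1 V) with hM
  have hM0 : 0 < M := by positivity
  have hM1 : C * M ≤ 1 / 4 := by
    have h1 : M ≤ 1 / (4 * C) := min_le_left _ _
    rw [le_div_iff₀ (by positivity)] at h1
    linarith
  have hMV : M ^ 2 ≤ V := by
    have h1 : M ≤ 1 := (min_le_right _ _).trans (min_le_left _ _)
    have h2 : M ≤ V := (min_le_right _ _).trans (min_le_right _ _)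
    nlinarith
  set μ := M / (4 * C * S) with hμ
  have hμ0 : 0 < μ := by positivity
  have hμ1 : C * S * μ = M / 4 := by rw [hμ]; field_simp
  set B := C + 512 + C * S * μ ^ (1 - p) with hB
  have hB0 : 0 < B := by positivity
  refine ⟨M ^ 2 / (4 * (B + B * M)), by positivity, fun v P h hA hG hP => ?_⟩
  set η := M ^ 2 / (4 * (B + B * M)) with hη
  have hη0 : 0 < η := by positivity
  have hη1 : (B + B * M) * η = M ^ 2 / 4 := by rw [hη]; field_simp
  have hT : ∀ N, ∑ k ∈ Finset.Icc 3 N, (∫ t in (-(1 / 4) ^ k : ℝ)..0,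
      ∫ x in closedBall 0 1, |P t x|) ≤ S * (μ + μ ^ (1 - p) * η) := by
    intro N
    calc _ ≤ ∑ k ∈ Finset.Icc 3 N, θ ^ k * (μ + μ ^ (1 - p) * η) :=
          Finset.sum_le_sum fun k hk => integral_le_of_integral_rpow_le hp hμ0
            (continuous_pressure_mass h.smooth_pressure 1)
            (fun t => integral_nonneg fun x => abs_nonneg _) hP
            (by have := (Finset.mem_Icc.1 hk).1; omega)
      _ ≤ _ := by
          rw [← Finset.sum_mul]
          exact mul_le_mul_of_nonneg_right
            (hsum.sum_le_tsum _ fun k _ => by positivity) (by positivity)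
  set Q := C * S * μ ^ (1 - p) with hQ
  have hQ0 : 0 < Q := by positivity
  have x1 : 0 < C * η := by positivity
  have x2 : 0 < Q * η := by positivity
  have x3 : 0 < C * η * M := by positivity
  have x4 : 0 < Q * η * M := by positivity
  have x5 : 0 < η * M := by positivity
  have hη2 : C * η + 512 * η + Q * η + (C * η * M + 512 * (η * M) + Q * η * M) = M ^ 2 / 4 := by
    rw [← hη1, hB]; ring
  have hbound := hb v P M η _ h hM0.le hA hG hT (by nlinarith) (by
    have e : C * (η + M ^ 3 + M * (S * (μ + μ ^ (1 - p) * η)))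
        = C * η + C * M * M ^ 2 + C * S * μ * M + Q * η * M := by rw [hQ]; ring
    rw [e, hμ1]
    have := mul_le_mul_of_nonneg_right hM1 (sq_nonneg M)
    linarith)
  have hfin := volume_mul_vsq_zero_le (h.slice 0) fun n hn =>
    (hbound n hn).1 0 ⟨neg_nonpos.2 (by positivity), le_rfl⟩
  rw [← hV] at hfin
  nlinarith

end Induction

section Localization

lemma pd_comp_add_left (f : E3 → ℝ) (a : E3) (j : Fin 3) (x : E3) :
    pd (fun y => f (a + y)) j x = pd f j (a + x) := by
  unfold pd
  rw [fderiv_comp_add_left]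

lemma lintegral_le_of_le_indicator_add {X : Type*} [AddGroup X] [MeasurableSpace X]
    [MeasurableAdd X] {μ : Measure X} [μ.IsAddLeftInvariant] {F G : X → ℝ≥0∞} {S T : Set X}
    (hS : MeasurableSet S) (hT : MeasurableSet T) (a : X)
    (h : ∀ x ∈ S, G x ≤ T.indicator F (a + x)) : ∫⁻ x in S, G x ∂μ ≤ ∫⁻ x in T, F x ∂μ := by
  calc ∫⁻ x in S, G x ∂μ = ∫⁻ x, S.indicator G x ∂μ := (lintegral_indicator hS _).symm
    _ ≤ ∫⁻ x, T.indicator F (a + x) ∂μ := by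
      refine lintegral_mono fun x => ?_
      by_cases hx : x ∈ S
      · rw [indicator_of_mem hx]; exact h x hx
      · rw [indicator_of_notMem hx]; exact zero_le
    _ = ∫⁻ x, T.indicator F x ∂μ := lintegral_add_left_eq_self _ a
    _ = ∫⁻ x in T, F x ∂μ := lintegral_indicator hT _

/-- A smooth cutoff for a compact subcylinder of a parabolic cylinder centred near the origin. -/
lemma exists_cylinder_cutoff {t₀ : ℝ} {x₀ : E3} (ht : t₀ ∈ Ioo (-(1 : ℝ) / 4) 0)
    (hx : x₀ ∈ ball (0 : E3) (1 / 2)) : ∃ (χ : ℝ × E3 → ℝ) (I : Set ℝ) (B : Set E3),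
    ContDiff ℝ ∞ χ ∧ IsOpen I ∧ IsOpen B ∧ Icc (-(1 / 4)) 0 ⊆ I ∧ closedBall 0 (1 / 2) ⊆ B ∧
    (∀ q, 0 ≤ χ q ∧ χ q ≤ 1) ∧ (∀ t ∈ I, ∀ x ∈ B, χ (t, x) = 1) ∧
    (∀ t ∈ I, ∀ x ∈ B, (t₀ + t, x₀ + x) ∈ Ioo (-1 : ℝ) 0 ×ˢ ball (0 : E3) 1) ∧
    ∀ q ∈ tsupport χ, (t₀ + q.1, x₀ + q.2) ∈ Ioo (-1 : ℝ) 0 ×ˢ ball (0 : E3) 1 := by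
  have hx' : ‖x₀‖ < 1 / 2 := by simpa using hx
  obtain ⟨ht1, ht2⟩ := ht
  let f : ContDiffBump (-(1 / 8) : ℝ) :=
    ⟨1 / 8 - t₀ / 3, 1 / 8 - t₀ / 2, by linarith, by linarith⟩
  let g : ContDiffBump (0 : E3) :=
    ⟨1 / 2 + (1 / 2 - ‖x₀‖) / 3, 1 / 2 + (1 / 2 - ‖x₀‖) / 2, by linarith, by linarith⟩
  have hin : ∀ t x, t ∈ closedBall (-(1 / 8) : ℝ) f.rOut → x ∈ closedBall (0 : E3) g.rOut →
      (t₀ + t, x₀ + x) ∈ Ioo (-1 : ℝ) 0 ×ˢ ball (0 : E3) 1 := by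
    intro t x h1 h2
    rw [mem_closedBall, Real.dist_eq, abs_le] at h1
    have h2 : ‖x‖ ≤ 1 / 2 + (1 / 2 - ‖x₀‖) / 2 := by simpa [g] using h2
    have h1 : -(1 / 8 - t₀ / 2) ≤ t - -(1 / 8) ∧ t - -(1 / 8) ≤ 1 / 8 - t₀ / 2 := h1
    refine ⟨⟨by dsimp only; linarith [h1.1], by dsimp only; linarith [h1.2]⟩, ?_⟩
    rw [mem_ball_zero_iff]
    dsimp only
    linarith [norm_add_le x₀ x]
  refine ⟨fun q => f q.1 * g q.2, ball (-(1 / 8)) f.rIn, ball 0 g.rIn,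
    (f.contDiff.comp contDiff_fst).mul (g.contDiff.comp contDiff_snd), isOpen_ball, isOpen_ball,
    fun t h => ?_, closedBall_subset_ball ?_, fun q => ⟨mul_nonneg f.nonneg g.nonneg,
      mul_le_one₀ f.le_one g.nonneg g.le_one⟩, fun t h1 x h2 => ?_, fun t h1 x h2 => ?_,
    fun q hq => ?_⟩
  · rw [mem_ball, Real.dist_eq, abs_lt]
    have h1 : f.rIn = 1 / 8 - t₀ / 3 := rfl
    constructor <;> linarith [h.1, h.2]
  · have h1 : g.rIn = 1 / 2 + (1 / 2 - ‖x₀‖) / 3 := rfl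
    linarith
  · change f t * g x = 1
    rw [f.one_of_mem_closedBall (ball_subset_closedBall h1),
      g.one_of_mem_closedBall (ball_subset_closedBall h2), one_mul]
  · exact hin t x (closedBall_subset_closedBall f.rIn_lt_rOut.le (ball_subset_closedBall h1))
      (closedBall_subset_closedBall g.rIn_lt_rOut.le (ball_subset_closedBall h2))
  · have hcl : IsClosed (closedBall (-(1 / 8) : ℝ) f.rOut ×ˢ closedBall (0 : E3) g.rOut) :=
      isClosed_closedBall.prod isClosed_closedBall
    have hsub := closure_minimal (s := Function.support fun q : ℝ × E3 => f q.1 * g q.2)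
      (fun q hq => ?_) hcl
    · exact hin q.1 q.2 (hsub hq).1 (hsub hq).2
    · have h1 : f q.1 ≠ 0 := left_ne_zero_of_mul hq
      have h2 : g q.2 ≠ 0 := right_ne_zero_of_mul hq
      refine ⟨ball_subset_closedBall ?_, ball_subset_closedBall ?_⟩
      · rw [← f.support_eq]; exact h1
      · rw [← g.support_eq]; exact h2

/-- Translate a local solution and extend it smoothly to the whole space-time. -/
lemma IsNSSolution.exists_isLocalNS {u : ℝ → E3 → E3} {P : ℝ → E3 → ℝ}
    (h : IsNSSolution u P (Ioo (-1 : ℝ) 0 ×ˢ ball (0 : E3) 1)) {t₀ : ℝ} {x₀ : E3}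
    (ht : t₀ ∈ Ioo (-(1 : ℝ) / 4) 0) (hx : x₀ ∈ ball (0 : E3) (1 / 2)) :
    ∃ (v : Fin 3 → ℝ → E3 → ℝ) (Q : ℝ → E3 → ℝ), IsLocalNS v Q ∧
    (∀ t ∈ Icc (-(1 / 4) : ℝ) 0, ∀ x ∈ closedBall (0 : E3) (1 / 2),
      (t₀ + t, x₀ + x) ∈ Ioo (-1 : ℝ) 0 ×ˢ ball (0 : E3) 1 ∧
      vsq (fun i => v i t) x = ‖u (t₀ + t) (x₀ + x)‖ ^ 2 ∧
      gsq (fun i => v i t) x = gradSq (u (t₀ + t)) (x₀ + x)) ∧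
    ∀ t x, ENNReal.ofReal |Q t x|
      ≤ (ball (0 : E3) 1).indicator (fun y => ENNReal.ofReal |P (t₀ + t) y|) (x₀ + x) := by
  obtain ⟨χ, I, B, hχ, hI, hB, hI1, hB1, h01, hone, hin, hsupp⟩ := exists_cylinder_cutoff ht hx
  obtain ⟨su, sP, hns, hdiv⟩ := h
  set U : Set (ℝ × E3) := Ioo (-1 : ℝ) 0 ×ˢ ball (0 : E3) 1 with hU
  have oU : IsOpen U := isOpen_Ioo.prod isOpen_ball
  have smooth : ∀ {f : ℝ × E3 → ℝ}, ContDiffOn ℝ ∞ f U →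
      ContDiff ℝ ∞ fun q : ℝ × E3 => χ q * f (t₀ + q.1, x₀ + q.2) := by
    intro f hf
    refine contDiff_iff_contDiffAt.2 fun q => ?_
    by_cases hq' : q ∈ tsupport χ
    swap
    · refine (contDiffAt_const (c := (0 : ℝ))).congr_of_eventuallyEq ?_
      filter_upwards [notMem_tsupport_iff_eventuallyEq.1 hq'] with y hy
      rw [hy, Pi.zero_apply, zero_mul]
    have hq : (t₀ + q.1, x₀ + q.2) ∈ U := hsupp q hq'
    have hT : ContDiff ℝ ∞ fun q : ℝ × E3 => (t₀ + q.1, x₀ + q.2) :=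
      (contDiff_const.add contDiff_fst).prodMk (contDiff_const.add contDiff_snd)
    exact hχ.contDiffAt.mul ((hf.contDiffAt (oU.mem_nhds hq)).comp q hT.contDiffAt)
  have sui : ∀ i, ContDiffOn ℝ ∞ (fun q : ℝ × E3 => u q.1 q.2 i) U := fun i =>
    (contDiff_coord i).comp_contDiffOn su
  set v : Fin 3 → ℝ → E3 → ℝ := fun i t x => χ (t, x) * u (t₀ + t) (x₀ + x) i with hv
  set Q : ℝ → E3 → ℝ := fun t x => χ (t, x) * P (t₀ + t) (x₀ + x) with hQ
  have ev : ∀ t ∈ I, ∀ x ∈ B, ∀ i, v i t x = u (t₀ + t) (x₀ + x) i := fun t ht x hx i => by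
    simp only [hv]; rw [hone t ht x hx, one_mul]
  have eQ : ∀ t ∈ I, ∀ x ∈ B, Q t x = P (t₀ + t) (x₀ + x) := fun t ht x hx => by
    simp only [hQ]; rw [hone t ht x hx, one_mul]
  have epd : ∀ t ∈ I, ∀ x ∈ B, ∀ i j, pd (v i t) j x = pd (fun y => u (t₀ + t) y i) j (x₀ + x) := by
    intro t ht x hx i j
    rw [← pd_comp_add_left (fun y => u (t₀ + t) y i) x₀ j x]
    refine pd_congr ?_
    filter_upwards [hB.mem_nhds hx] with y hy using ev t ht y hy i
  have epd2 : ∀ t ∈ I, ∀ x ∈ B, ∀ i j, pd (pd (v i t) j) j x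
      = pd (pd (fun y => u (t₀ + t) y i) j) j (x₀ + x) := by
    intro t ht x hx i j
    rw [← pd_comp_add_left (pd (fun y => u (t₀ + t) y i) j) x₀ j x]
    refine pd_congr ?_
    filter_upwards [hB.mem_nhds hx] with y hy using epd t ht y hy i j
  have epdQ : ∀ t ∈ I, ∀ x ∈ B, ∀ j, pd (Q t) j x = pd (fun y => P (t₀ + t) y) j (x₀ + x) := by
    intro t ht x hx j
    rw [← pd_comp_add_left (fun y => P (t₀ + t) y) x₀ j x]
    refine pd_congr ?_
    filter_upwards [hB.mem_nhds hx] with y hy using eQ t ht y hy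
  have ed : ∀ t ∈ I, ∀ x ∈ B, ∀ i, deriv (fun s => v i s x) t
      = deriv (fun s => u s (x₀ + x) i) (t₀ + t) := by
    intro t ht x hx i
    rw [← deriv_comp_const_add (f := fun s => u s (x₀ + x) i)]
    refine Filter.EventuallyEq.deriv_eq ?_
    filter_upwards [hI.mem_nhds ht] with s hs using ev s hs x hx i
  refine ⟨v, Q, ⟨fun i => smooth (sui i), smooth sP, fun t ht x hx i => ?_, fun t ht x hx => ?_⟩,
    fun t ht x hx => ⟨hin t (hI1 ht) x (hB1 hx), ?_, ?_⟩, fun t x => ?_⟩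
  · have ht := hI1 ht
    have hx := hB1 hx
    rw [ed t ht x hx, epdQ t ht x hx]
    simp only [ev t ht x hx, epd t ht x hx, epd2 t ht x hx]
    exact hns _ (hin t ht x hx) i
  · have hx := hB1 hx
    filter_upwards [hI.mem_nhds (hI1 ht)] with s hs
    simp only [epd s hs x hx]
    exact hdiv _ (hin s hs x hx)
  · simp only [vsq, ev t (hI1 ht) x (hB1 hx)]
    rw [EuclideanSpace.real_norm_sq_eq]
  · simp only [gsq, gradSq, epd t (hI1 ht) x (hB1 hx)]
  · by_cases hq : χ (t, x) = 0
    · simp [hQ, hq]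
    · have := hsupp (t, x) (subset_tsupport _ hq)
      rw [indicator_of_mem this.2]
      refine ENNReal.ofReal_le_ofReal ?_
      simp only [hQ]
      rw [abs_mul, abs_of_nonneg (h01 _).1]
      exact mul_le_of_le_one_left (abs_nonneg _) (h01 _).2

lemma ofReal_setIntegral_closedBall {f : E3 → ℝ} (hf : Continuous f) (h0 : ∀ x, 0 ≤ f x) (r : ℝ) :
    ENNReal.ofReal (∫ x in closedBall 0 r, f x) = ∫⁻ x in closedBall 0 r, ENNReal.ofReal (f x) :=
  ofReal_integral_eq_lintegral_ofReal (integrableOn_closedBall hf r)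
    (Filter.Eventually.of_forall h0)

lemma ofReal_intervalIntegral {f : ℝ → ℝ} (hf : Continuous f) (h0 : ∀ x, 0 ≤ f x) {a b : ℝ}
    (hab : a ≤ b) : ENNReal.ofReal (∫ t in a..b, f t) = ∫⁻ t in Ioc a b, ENNReal.ofReal (f t) := by
  rw [intervalIntegral.integral_of_le hab]
  exact ofReal_integral_eq_lintegral_ofReal (hf.intervalIntegrable a b).1
    (Filter.Eventually.of_forall h0)

end Localization

/-- Local smallness criterion (Proposition 3.1): for any `p > 1` there is `η > 0` such that
any smooth solution of Navier–Stokes on `Q₁ = (−1,0) × B₁` with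
`sup_t ∫_{B₁}|u|² + ∫∫_{Q₁}|∇u|² + ∫ (∫_{B₁}|P|)^p dt ≤ η` satisfies `|u| ≤ 1` on `Q_{1/2}`. -/
theorem ns_local_smallness (p : ℝ) (hp : 1 < p) :
    ∃ η > (0:ℝ), ∀ (u : ℝ → E3 → E3) (P : ℝ → E3 → ℝ),
      IsNSSolution u P (Set.Ioo (-1 : ℝ) 0 ×ˢ ball (0:E3) 1) →
      (⨆ t ∈ Set.Ioo (-1 : ℝ) 0, ∫⁻ x in ball (0:E3) 1, ENNReal.ofReal (‖u t x‖ ^ 2))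
        + (∫⁻ t in Set.Ioo (-1 : ℝ) 0, ∫⁻ x in ball (0:E3) 1,
            ENNReal.ofReal (gradSq (u t) x))
        + (∫⁻ t in Set.Ioo (-1 : ℝ) 0,
            (∫⁻ x in ball (0:E3) 1, ENNReal.ofReal |P t x|) ^ p)
        ≤ ENNReal.ofReal η →
      ∀ t ∈ Set.Ioo (-(1:ℝ)/4) 0, ∀ x ∈ ball (0:E3) (1/2), ‖u t x‖ ≤ 1 := by
  obtain ⟨η, hη, hsmall⟩ := exists_vsq_zero_le_one hp
  refine ⟨η, hη, fun u P h hle t₀ ht x₀ hx => ?_⟩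
  obtain ⟨v, Q, hloc, hvu, hQP⟩ := h.exists_isLocalNS ht hx
  have hA := (le_self_add.trans le_self_add).trans hle
  have hG := (le_add_self.trans le_self_add).trans hle
  have hP := le_add_self.trans hle
  have hmem : ∀ t ∈ Icc (-(1 / 4) : ℝ) 0, t₀ + t ∈ Ioo (-1 : ℝ) 0 := fun t ht =>
    (hvu t ht 0 (by simp)).1.1
  have h0 : (0 : ℝ) ∈ Icc (-(1 / 4) : ℝ) 0 := ⟨by norm_num, le_rfl⟩
  have hfin := hsmall v Q hloc (fun t ht => ?_) ?_ ?_
  · rw [(hvu 0 h0 0 (by simp)).2.1, add_zero, add_zero] at hfin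
    exact (sq_le_one_iff₀ (norm_nonneg _)).1 hfin
  · rw [← ENNReal.ofReal_le_ofReal_iff hη.le,
      ofReal_setIntegral_closedBall (continuous_vsq (hloc.slice t)) (vsq_nonneg _)]
    refine le_trans ?_ ((le_iSup₂ (f := fun t (_ : t ∈ Ioo (-1 : ℝ) 0) =>
      ∫⁻ x in ball (0 : E3) 1, ENNReal.ofReal (‖u t x‖ ^ 2)) (t₀ + t) (hmem t ht)).trans hA)
    refine lintegral_le_of_le_indicator_add measurableSet_closedBall measurableSet_ball x₀
      fun x hx => ?_
    obtain ⟨h1, h2, -⟩ := hvu t ht x hx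
    rw [indicator_of_mem h1.2, h2]
  · rw [← ENNReal.ofReal_le_ofReal_iff hη.le, ofReal_intervalIntegral
      (continuous_dissipation hloc.smooth _)
      (fun t => integral_nonneg fun x => gsq_nonneg _ x) (by norm_num)]
    refine le_trans (lintegral_le_of_le_indicator_add measurableSet_Ioc measurableSet_Ioo t₀
      fun t ht => ?_) hG
    have ht := Ioc_subset_Icc_self ht
    rw [indicator_of_mem (hmem t ht),
      ofReal_setIntegral_closedBall (continuous_gsq (hloc.slice t)) (gsq_nonneg _)]
    refine lintegral_le_of_le_indicator_add measurableSet_closedBall measurableSet_ball x₀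
      fun x hx => ?_
    obtain ⟨h1, -, h2⟩ := hvu t ht x hx
    rw [indicator_of_mem h1.2, h2]
  · have hp0 : 0 ≤ p := by linarith
    have hn : ∀ t, 0 ≤ ∫ x in closedBall (0 : E3) 1, |Q t x| := fun t =>
      integral_nonneg fun x => abs_nonneg _
    rw [← ENNReal.ofReal_le_ofReal_iff hη.le, ofReal_intervalIntegral
      ((continuous_pressure_mass hloc.smooth_pressure _).rpow_const fun _ => Or.inr hp0)
      (fun t => Real.rpow_nonneg (hn t) p) (by norm_num)]
    refine le_trans (lintegral_le_of_le_indicator_add measurableSet_Ioc measurableSet_Ioo t₀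
      fun t ht => ?_) hP
    rw [indicator_of_mem (hmem t (Ioc_subset_Icc_self ht)),
      ← ENNReal.ofReal_rpow_of_nonneg (hn t) hp0,
      ofReal_setIntegral_closedBall
        (contDiff_slice_space hloc.smooth_pressure t).continuous.abs fun x => abs_nonneg _]
    refine ENNReal.rpow_le_rpow ?_ hp0
    exact lintegral_le_of_le_indicator_add measurableSet_closedBall measurableSet_ball x₀
      fun x _ => hQP t x
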